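/- arXiv:2505.17981 — 5 statements merged into one kernel-verified Lean document; each statement's English description precedes it below -/
import Mathlib

section
/- For all k ≥ 3 there exists n₀ such that for every n ≥ n₀ divisible by k, every k-uniform hypergraph H on n vertices with minimum positive codegree δ⁺(H) ≥ ((k−1)/k)·n − (k−2) and with no isolated vertices contains a perfect matching. -/
open Finset

variable {V : Type*} [Fintype V] [DecidableEq V]

/-- The degree of a vertex set `S` in a hypergraph `H`: the number of edges containing `S`. -/
def deg (H : Finset (Finset V)) (S : Finset V) : ℕ :=
  (H.filter fun e => S ⊆ e).card

/-- The minimum positive codegree of a `k`-uniform hypergraph `H`: the minimum of `deg S`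
over all `(k-1)`-sets `S` with `deg S ≥ 1`. -/
noncomputable def minPosCodeg (k : ℕ) (H : Finset (Finset V)) : ℕ :=
  sInf {d | ∃ S : Finset V, S.card = k - 1 ∧ 0 < deg H S ∧ deg H S = d}

/-- `M` is a perfect matching of the hypergraph `H`: a set of pairwise disjoint edges
covering every vertex. -/
def IsPerfectMatching (H M : Finset (Finset V)) : Prop :=
  M ⊆ H ∧ (M : Set (Finset V)).PairwiseDisjoint id ∧ ∀ v : V, ∃ e ∈ M, v ∈ e

/-- The fiber of `c` over `p`. -/
def fiber {α κ : Type*} [Fintype α] [DecidableEq κ] (c : α → κ) (p : κ) : Finset α :=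
  univ.filter fun v => c v = p

@[simp]
theorem mem_fiber {α κ : Type*} [Fintype α] [DecidableEq κ] {c : α → κ} {p : κ} {v : α} :
    v ∈ fiber c p ↔ c v = p := by
  simp [fiber]

open Classical in
/-- The vertices outside `F` that do not extend `F` to a face of `Δ`. -/
noncomputable def misses (Δ : Finset V → Prop) (F : Finset V) : Finset V :=
  univ.filter fun x => x ∉ F ∧ ¬ Δ (insert x F)

theorem mem_misses {Δ : Finset V → Prop} {F : Finset V} {x : V} :
    x ∈ misses Δ F ↔ x ∉ F ∧ ¬ Δ (insert x F) := by
  simp [misses]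

/-- `Δ` is an abstract simplicial complex on `V` in which every face with fewer than `k` vertices
fails to extend to a larger face by fewer than `m` of the vertices outside it. -/
structure IsExtendable (Δ : Finset V → Prop) (k m : ℕ) : Prop where
  mono : ∀ ⦃F G : Finset V⦄, F ⊆ G → Δ G → Δ F
  singleton : ∀ v, Δ {v}
  card_misses_lt : ∀ F, Δ F → F.card < k → (misses Δ F).card < m

/-- Coning a complex over the vertices outside `W` preserves extendability. -/
theorem IsExtendable.inter {Δ : Finset V → Prop} {k m : ℕ} (h : IsExtendable Δ k m)
    (W : Finset V) : IsExtendable (fun F => Δ (F ∩ W)) k m where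
  mono F G hFG hG := h.mono (inter_subset_inter_right hFG) hG
  singleton v := h.mono inter_subset_left (h.singleton v)
  card_misses_lt F hF hk := by
    refine lt_of_le_of_lt (card_le_card fun x hx => ?_)
      (h.card_misses_lt (F ∩ W) hF ((card_le_card inter_subset_left).trans_lt hk))
    rw [mem_misses] at hx ⊢
    refine ⟨fun hx' => hx.1 (mem_inter.1 hx').1, fun hx' => hx.2 (h.mono ?_ hx')⟩
    intro y
    simp only [mem_inter, mem_insert]
    tauto

/-- A bipartite relation between two sets of equal size `t` that omits fewer than `t` pairs
contains a perfect matching. -/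
theorem exists_injOn_of_card_not_lt {α β : Type*} [DecidableEq α] [DecidableEq β]
    (A : Finset α) (B : Finset β) (r : α → β → Prop) [∀ a b, Decidable (r a b)]
    (hAB : A.card = B.card)
    (h : ((A ×ˢ B).filter fun q => ¬ r q.1 q.2).card < B.card) :
    ∃ g : α → β, Set.InjOn g A ∧ ∀ a ∈ A, g a ∈ B ∧ r a (g a) := by
  classical
  have hall : ∀ s : Finset A, s.card ≤ (s.biUnion fun a => B.filter fun b => r a b).card := by
    intro s
    by_contra! hs
    set N := s.biUnion fun a => B.filter fun b => r a b with hN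
    have hNB : N ⊆ B := biUnion_subset.2 fun a _ => filter_subset _ _
    have hsub : (s.map (Function.Embedding.subtype _)) ×ˢ (B \ N) ⊆
        (A ×ˢ B).filter fun q => ¬ r q.1 q.2 := by
      rintro ⟨a, b⟩ hab
      simp only [mem_product, mem_map, Function.Embedding.subtype_apply, Subtype.exists,
        exists_and_right, exists_eq_right, mem_sdiff, hN, mem_biUnion, mem_filter,
        not_exists, not_and] at hab ⊢
      obtain ⟨⟨ha, has⟩, hb, hbn⟩ := hab
      exact ⟨⟨ha, hb⟩, fun hr => hbn a ⟨ha, has⟩ hb hr⟩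
    have h1 := card_le_card hsub
    rw [card_product, card_map, card_sdiff_of_subset hNB] at h1
    have h2 : s.card ≤ A.card := by
      simpa using card_le_univ s
    have h3 := card_le_card hNB
    obtain ⟨d, hd⟩ := Nat.exists_eq_add_of_le h3
    obtain ⟨a, ha⟩ := Nat.exists_eq_add_of_lt hs
    obtain ⟨q, hq⟩ := Nat.exists_eq_add_of_le (h2.trans hAB.le)
    have h4 : s.card * (B.card - N.card) < B.card := h1.trans_lt h
    have h5 : B.card - N.card = a + 1 + q := by omega
    rw [h5, hq, ha] at h4
    nlinarith [Nat.zero_le (N.card * a), Nat.zero_le (a * a), Nat.zero_le (N.card * q),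
      Nat.zero_le (a * q)]
  obtain ⟨f, hf, hfr⟩ := (all_card_le_biUnion_card_iff_exists_injective _).1 hall
  have hfr' : ∀ a, f a ∈ B ∧ r a (f a) := fun a => mem_filter.1 (hfr a)
  rcases A.eq_empty_or_nonempty with rfl | ⟨a₀, ha₀⟩
  · simp at hAB
    rw [← hAB] at h
    simp at h
  · refine ⟨fun a => if ha : a ∈ A then f ⟨a, ha⟩ else f ⟨a₀, ha₀⟩, ?_, ?_⟩
    · intro a ha b hb hab
      simp only [mem_coe] at ha hb
      simp only [ha, hb, dite_true] at hab
      simpa using hf hab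
    · intro a ha
      simpa only [ha, dite_true] using hfr' ⟨a, ha⟩

/-- A partition of `k * m` vertices into `m` classes of size at most `k` has classes of size
exactly `k`. -/
theorem card_fiber_eq_of_le {α κ : Type*} [Fintype α] [Fintype κ] [DecidableEq κ] {k m : ℕ}
    (hV : Fintype.card α = k * m) (hκ : Fintype.card κ = m) (c : α → κ)
    (hc : ∀ p, (fiber c p).card ≤ k) (p : κ) : (fiber c p).card = k := by
  have hsum : ∑ p, (fiber c p).card = ∑ _p : κ, k := by
    have : (univ : Finset α).card = ∑ p, (fiber c p).card :=
      card_eq_sum_card_fiberwise (fun _ _ => mem_coe.2 (mem_univ _))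
    rw [← this, card_univ, hV, sum_const, card_univ, hκ, smul_eq_mul, mul_comm]
  exact (sum_eq_sum_iff_of_le fun p _ => hc p).1 hsum p (mem_univ p)

/-- A partition of `k * m` vertices into `m + 1` faces, of which `k` have `k - 1` vertices and the
others have `k` vertices, can be turned into a partition into `m` faces with `k` vertices by
distributing one of the classes over the smaller ones. -/
theorem IsExtendable.exists_partition_of_deficient {Δ : Finset V → Prop} {k m : ℕ}
    (h : IsExtendable Δ k m) (hk : 1 ≤ k) (hV : Fintype.card V = k * m)
    {κ : Type*} [Fintype κ] [DecidableEq κ] (hκ : Fintype.card κ = m + 1)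
    (c : V → κ) (K : Finset κ) (hK : K.card = k) (hface : ∀ p, Δ (fiber c p))
    (hsmall : ∀ p ∈ K, (fiber c p).card = k - 1) (hlarge : ∀ p ∉ K, (fiber c p).card = k) :
    ∃ c' : V → Fin m, ∀ i, Δ (fiber c' i) ∧ (fiber c' i).card = k := by
  classical
  let r : V → κ → Prop := fun x p => Δ (insert x (fiber c p))
  obtain ⟨b, -, hb⟩ : ∃ b ∈ (univ : Finset κ),
      ((fiber c b ×ˢ K.erase b).filter fun q => ¬ r q.1 q.2).card < (K.erase b).card := by
    apply exists_lt_of_sum_lt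
    have h1 : ∑ b, (K.erase b).card = k * m := by
      have : ∀ b, (K.erase b).card = ∑ p ∈ K, if p ≠ b then 1 else 0 := by
        intro b
        rw [← card_filter]
        congr 1
        ext p
        simp [and_comm]
      simp_rw [this]
      rw [sum_comm]
      have : ∀ p ∈ K, (∑ b, if p ≠ b then 1 else 0) = m := by
        intro p _
        rw [← card_filter, filter_ne, card_erase_of_mem (mem_univ _), card_univ, hκ]
        rfl
      rw [sum_congr rfl this, sum_const, hK, smul_eq_mul]
    have h2 : ∑ b, ((fiber c b ×ˢ K.erase b).filter fun q => ¬ r q.1 q.2).card ≤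
        ∑ p ∈ K, (misses Δ (fiber c p)).card := by
      rw [← card_sigma, ← card_sigma]
      refine card_le_card_of_injOn (fun q => ⟨q.2.2, q.2.1⟩) ?_ ?_
      · rintro ⟨b, x, p⟩ hq
        simp only [coe_sigma, Set.mem_sigma_iff, mem_coe, mem_univ, mem_filter, mem_product,
          mem_fiber, mem_erase, true_and, mem_misses] at hq ⊢
        exact ⟨hq.1.2.2, fun hx => hq.1.2.1 (hx.symm.trans hq.1.1), hq.2⟩
      · rintro ⟨b, x, p⟩ hq ⟨b', x', p'⟩ hq' heq
        simp only [coe_sigma, Set.mem_sigma_iff, mem_coe, mem_univ, mem_filter, mem_product,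
          mem_fiber, mem_erase, true_and] at hq hq'
        simp only [Sigma.mk.injEq, heq_eq_eq] at heq
        obtain ⟨rfl, rfl⟩ := heq
        obtain rfl : b = b' := hq.1.1.symm.trans hq'.1.1
        rfl
    rw [h1]
    refine h2.trans_lt ?_
    calc ∑ p ∈ K, (misses Δ (fiber c p)).card < ∑ _p ∈ K, m := by
          refine sum_lt_sum_of_nonempty (card_pos.1 (by omega)) fun p hp => ?_
          exact h.card_misses_lt _ (hface p) (by rw [hsmall p hp]; omega)
      _ = k * m := by rw [sum_const, hK, smul_eq_mul]
  have hcard : (fiber c b).card = (K.erase b).card := by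
    by_cases hbK : b ∈ K
    · rw [hsmall b hbK, card_erase_of_mem hbK, hK]
    · rw [hlarge b hbK, erase_eq_of_notMem hbK, hK]
  obtain ⟨g, hg, hgr⟩ := exists_injOn_of_card_not_lt _ _ r hcard hb
  have hne : ∀ v, (if c v = b then g v else c v) ≠ b := by
    intro v
    split_ifs with hv
    · exact (mem_erase.1 (hgr v (mem_fiber.2 hv)).1).1
    · exact hv
  let c₁ : V → {p // p ≠ b} := fun v => ⟨if c v = b then g v else c v, hne v⟩
  have hcardκ : Fintype.card {p // p ≠ b} = m := by
    rw [Fintype.card_subtype_compl, hκ, Fintype.card_subtype_eq]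
    rfl
  have hc₁ : ∀ p, Δ (fiber c₁ p) ∧ (fiber c₁ p).card ≤ k := by
    rintro ⟨p, hp⟩
    have hmem : ∀ v, v ∈ fiber c₁ ⟨p, hp⟩ ↔ c v = p ∨ (c v = b ∧ g v = p) := by
      intro v
      simp only [mem_fiber, c₁, Subtype.mk.injEq]
      split_ifs with hv
      · simp [hv, hp.symm]
      · simp [hv]
    by_cases hex : ∃ x, c x = b ∧ g x = p
    · obtain ⟨x, hx, rfl⟩ := hex
      have heq : fiber c₁ ⟨g x, hp⟩ = insert x (fiber c (g x)) := by
        ext v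
        rw [hmem, mem_insert, mem_fiber]
        constructor
        · rintro (hv | ⟨hv, hgv⟩)
          · exact Or.inr hv
          · exact Or.inl (hg (mem_coe.2 (mem_fiber.2 hv)) (mem_coe.2 (mem_fiber.2 hx)) hgv)
        · rintro (rfl | hv)
          · exact Or.inr ⟨hx, rfl⟩
          · exact Or.inl hv
      obtain ⟨hgK, hgx⟩ := hgr x (mem_fiber.2 hx)
      rw [heq]
      refine ⟨hgx, (card_insert_le _ _).trans ?_⟩
      rw [hsmall _ (mem_of_mem_erase hgK)]
      omega
    · have heq : fiber c₁ ⟨p, hp⟩ = fiber c p := by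
        ext v
        rw [hmem, mem_fiber]
        exact or_iff_left fun hv => hex ⟨v, hv⟩
      rw [heq]
      refine ⟨hface p, ?_⟩
      by_cases hpK : p ∈ K
      · rw [hsmall p hpK]
        omega
      · exact (hlarge p hpK).le
  let e := Fintype.equivFinOfCardEq hcardκ
  have hfib : ∀ i, fiber (fun v => e (c₁ v)) i = fiber c₁ (e.symm i) := by
    intro i
    ext v
    simp [Equiv.eq_symm_apply]
  refine ⟨fun v => e (c₁ v), fun i => ?_⟩
  rw [hfib]
  exact ⟨(hc₁ _).1, card_fiber_eq_of_le hV hcardκ c₁ (fun p => (hc₁ p).2) _⟩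

theorem fiber_update_self {κ : Type*} [DecidableEq κ] (c : V → κ) (x : V) (p : κ) :
    fiber (Function.update c x p) p = insert x (fiber c p) := by
  ext v
  by_cases hv : v = x <;> simp [hv]

theorem fiber_update_of_ne {κ : Type*} [DecidableEq κ] (c : V → κ) (x : V) {p q : κ}
    (hpq : q ≠ p) : fiber (Function.update c x p) q = (fiber c q).erase x := by
  ext v
  by_cases hv : v = x <;> simp [hv, hpq.symm]

/-- A face that is an extra class of a partition can be grown one vertex at a time, each new vertex
coming from a different full class. -/
theorem IsExtendable.exists_growing_partition {Δ : Finset V → Prop} {k m : ℕ}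
    (h : IsExtendable Δ k m) (hk : 2 ≤ k) (hm : 2 * k ≤ m) (u : V)
    (c : V → Fin m) (hface : ∀ i, Δ ((fiber c i).erase u)) (hcard : ∀ i, (fiber c i).card = k)
    (j : ℕ) (hj : j + 2 ≤ k) :
    ∃ (c' : V → Option (Fin m)) (J : Finset (Fin m)), J.card = j + 1 ∧
      (∀ p, Δ (fiber c' p)) ∧ (fiber c' none).card = j + 1 ∧
      (∀ i ∈ J, (fiber c' (some i)).card = k - 1) ∧
      ∀ i ∉ J, (fiber c' (some i)).card = k := by
  induction j with
  | zero =>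
    have hnone : fiber (fun v => some (c v)) none = ∅ := by
      ext v
      simp
    have hsome : ∀ i, fiber (fun v => some (c v)) (some i) = fiber c i := by
      intro i
      ext v
      simp
    refine ⟨Function.update (fun v => some (c v)) u none, {c u}, by simp, ?_, ?_, ?_, ?_⟩
    · rintro (_ | i)
      · rw [fiber_update_self, hnone]
        exact h.singleton u
      · rw [fiber_update_of_ne _ _ (by simp), hsome]
        exact hface i
    · rw [fiber_update_self, hnone]
      simp
    · intro i hi
      rw [mem_singleton] at hi
      rw [fiber_update_of_ne _ _ (by simp), hsome, card_erase_of_mem (by simp [hi]), hcard]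
    · intro i hi
      rw [mem_singleton] at hi
      rw [fiber_update_of_ne _ _ (by simp), hsome,
        erase_eq_of_notMem (by simpa using Ne.symm hi), hcard]
  | succ j ih =>
    obtain ⟨c', J, hJ, hΔ, hnone, hsmall, hlarge⟩ := ih (by omega)
    obtain ⟨x, i, hiJ, hx, hxΔ⟩ : ∃ x i, i ∉ J ∧ c' x = some i ∧
        Δ (insert x (fiber c' none)) := by
      by_contra! hcon
      have hsub : (Jᶜ.biUnion fun i => fiber c' (some i)) ⊆ misses Δ (fiber c' none) := by
        intro x hx
        simp only [mem_biUnion, mem_compl, mem_fiber] at hx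
        obtain ⟨i, hi, hxi⟩ := hx
        rw [mem_misses]
        exact ⟨by simp [hxi], hcon x i hi hxi⟩
      have hle := card_le_card hsub
      rw [card_biUnion, sum_congr rfl fun i hi => hlarge i (mem_compl.1 hi), sum_const,
        card_compl, Fintype.card_fin, hJ, smul_eq_mul] at hle
      · have hlt := h.card_misses_lt _ (hΔ none) (by omega)
        have : (m - (j + 1)) * 2 ≤ (m - (j + 1)) * k := Nat.mul_le_mul_left _ hk
        omega
      · intro a _ b _ hab
        rw [Function.onFun, disjoint_left]
        intro v hva hvb
        rw [mem_fiber] at hva hvb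
        exact hab (Option.some_injective _ (hva.symm.trans hvb))
    refine ⟨Function.update c' x none, insert i J, by rw [card_insert_of_notMem hiJ, hJ],
      ?_, ?_, ?_, ?_⟩
    · rintro (_ | i')
      · rwa [fiber_update_self]
      · rw [fiber_update_of_ne _ _ (by simp)]
        exact h.mono (erase_subset _ _) (hΔ _)
    · rw [fiber_update_self, card_insert_of_notMem (by simp [hx]), hnone]
    · intro i' hi'
      rw [fiber_update_of_ne _ _ (by simp)]
      rcases mem_insert.1 hi' with rfl | hi'
      · rw [card_erase_of_mem (by simp [hx]), hlarge _ hiJ]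
      · have hne : i ≠ i' := fun hii => hiJ (hii ▸ hi')
        rw [erase_eq_of_notMem (by simpa [hx] using hne), hsmall _ hi']
    · intro i' hi'
      rw [mem_insert, not_or] at hi'
      rw [fiber_update_of_ne _ _ (by simp),
        erase_eq_of_notMem (by simpa [hx] using Ne.symm hi'.1), hlarge _ hi'.2]

/-- A partition into `k`-sets all of which become faces on removing `u` can be replaced by a
partition into faces of size `k`. -/
theorem IsExtendable.exists_partition_of_erase {Δ : Finset V → Prop} {k m : ℕ}
    (h : IsExtendable Δ k m) (hk : 2 ≤ k) (hm : 2 * k ≤ m) (hV : Fintype.card V = k * m) (u : V)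
    (c : V → Fin m) (hface : ∀ i, Δ ((fiber c i).erase u)) (hcard : ∀ i, (fiber c i).card = k) :
    ∃ c' : V → Fin m, ∀ i, Δ (fiber c' i) ∧ (fiber c' i).card = k := by
  obtain ⟨c', J, hJ, hΔ, hnone, hsmall, hlarge⟩ :=
    h.exists_growing_partition hk hm u c hface hcard (k - 2) (by omega)
  refine h.exists_partition_of_deficient (by omega) hV (by simp) c' (insertNone J)
    (by rw [card_insertNone, hJ]; omega) hΔ ?_ ?_
  · rintro (_ | i) hi
    · omega
    · exact hsmall i (some_mem_insertNone.1 hi)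
  · rintro (_ | i) hi
    · exact absurd none_mem_insertNone hi
    · exact hlarge i fun hiJ => hi (some_mem_insertNone.2 hiJ)

/-- The vertices of an extendable complex can be partitioned into faces of size `k`. -/
theorem IsExtendable.exists_partition {Δ : Finset V → Prop} {k m : ℕ}
    (h : IsExtendable Δ k m) (hk : 2 ≤ k) (hm : 2 * k ≤ m) (hV : Fintype.card V = k * m) :
    ∃ c : V → Fin m, ∀ i, Δ (fiber c i) ∧ (fiber c i).card = k := by
  suffices hW : ∀ W : Finset V, ∃ c : V → Fin m, ∀ i, Δ (fiber c i ∩ W) ∧ (fiber c i).card = k by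
    simpa using hW univ
  intro W
  induction W using Finset.induction_on with
  | empty =>
    have hpos : 0 < Fintype.card V := by
      rw [hV]
      exact Nat.mul_pos (by omega) (by omega)
    obtain ⟨v⟩ := Fintype.card_pos_iff.1 hpos
    have e : V ≃ Fin k × Fin m := Fintype.equivOfCardEq (by simp [hV])
    refine ⟨fun v => (e v).2, fun i => ⟨h.mono (by simp) (h.singleton v), ?_⟩⟩
    refine Eq.trans ?_ (card_fin k)
    refine card_nbij' (fun v => (e v).1) (fun a => e.symm (a, i)) (by simp) (by simp) ?_
      (fun a _ => by simp)
    intro v hv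
    rw [mem_coe, mem_fiber] at hv
    exact e.symm_apply_eq.2 (Prod.ext rfl hv.symm)
  | insert u W _ ih =>
    obtain ⟨c, hc⟩ := ih
    refine (h.inter (insert u W)).exists_partition_of_erase hk hm hV u c (fun i => ?_)
      fun i => (hc i).2
    refine h.mono (fun v => ?_) (hc i).1
    simp only [mem_inter, mem_erase, mem_insert]
    tauto

/-- The complex generated by a `k`-uniform hypergraph without isolated vertices whose minimum
positive codegree `d` satisfies `n < d + k - 1 + m` is extendable. -/
theorem isExtendable_of_minPosCodeg {k m : ℕ} (hk : 2 ≤ k) {H : Finset (Finset V)}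
    (hH : ∀ e ∈ H, e.card = k) (hd : Fintype.card V < minPosCodeg k H + (k - 1) + m)
    (hiso : ∀ v, ∃ e ∈ H, v ∈ e) : IsExtendable (fun F => ∃ e ∈ H, F ⊆ e) k m where
  mono F G hFG := fun ⟨e, he, hGe⟩ => ⟨e, he, hFG.trans hGe⟩
  singleton v := by simpa using hiso v
  card_misses_lt := by
    rintro F ⟨e, he, hFe⟩ hF
    obtain ⟨S, hFS, hSe, hS⟩ := exists_subsuperset_card_eq hFe (n := k - 1) (by omega)
      (by rw [hH e he]; omega)
    have hpos : 0 < deg H S := card_pos.2 ⟨e, mem_filter.2 ⟨he, hSe⟩⟩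
    have hdeg : minPosCodeg k H ≤ deg H S := Nat.sInf_le ⟨S, hS, hpos, rfl⟩
    set N := univ.filter fun x => x ∉ S ∧ insert x S ∈ H with hN
    have hdegN : deg H S ≤ N.card := by
      have hsub : (H.filter fun e => S ⊆ e) ⊆ N.image fun x => insert x S := by
        intro f hf
        rw [mem_filter] at hf
        have hcard : S.card + 1 = f.card := by
          rw [hS, hH f hf.1]
          omega
        obtain ⟨x, hx, rfl⟩ := (covBy_iff_card_sdiff_eq_one.2
          ⟨hf.2, by rw [card_sdiff_of_subset hf.2]; omega⟩).exists_finset_insert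
        exact mem_image.2 ⟨x, by simp [hN, hx, hf.1], rfl⟩
      exact (card_le_card hsub).trans card_image_le
    have hdisj : Disjoint N S := disjoint_left.2 fun x hx => (mem_filter.1 hx).2.1
    have hsub : misses (fun F => ∃ e ∈ H, F ⊆ e) F ⊆ (N ∪ S)ᶜ := by
      intro x hx
      rw [mem_misses] at hx
      rw [mem_compl, mem_union, not_or]
      refine ⟨fun hxN => hx.2 ⟨_, (mem_filter.1 hxN).2.2, insert_subset_insert _ hFS⟩,
        fun hxS => hx.2 ⟨e, he, insert_subset (hSe hxS) hFe⟩⟩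
    have hle := card_le_card hsub
    have hle' := card_le_univ (N ∪ S)
    rw [card_compl, card_union_of_disjoint hdisj] at hle
    rw [card_union_of_disjoint hdisj] at hle'
    omega

theorem stmt6 (k : ℕ) (hk : 3 ≤ k) :
    ∃ n₀ : ℕ, ∀ n ≥ n₀, k ∣ n →
      ∀ H : Finset (Finset (Fin n)), (∀ e ∈ H, e.card = k) →
        ((k : ℝ) - 1) / k * n - ((k : ℝ) - 2) ≤ (minPosCodeg k H : ℝ) →
        (∀ v : Fin n, ∃ e ∈ H, v ∈ e) →
        ∃ M : Finset (Finset (Fin n)), IsPerfectMatching H M := by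
  refine ⟨k * (2 * k), ?_⟩
  rintro n hn ⟨m, rfl⟩ H hH hd hiso
  have hm : 2 * k ≤ m := Nat.le_of_mul_le_mul_left hn (by omega)
  have hcodeg : k * m < minPosCodeg k H + (k - 1) + m := by
    have hk0 : (k : ℝ) ≠ 0 := by positivity
    have heq : ((k : ℝ) - 1) / k * ((k * m : ℕ) : ℝ) = (k - 1) * m := by
      push_cast
      field_simp
    rw [heq] at hd
    have hle : (k : ℝ) * m + 2 ≤ minPosCodeg k H + k + m := by linarith
    have hle' : k * m + 2 ≤ minPosCodeg k H + k + m := by exact_mod_cast hle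
    omega
  obtain ⟨c, hc⟩ := (isExtendable_of_minPosCodeg (by omega) hH (by simpa using hcodeg)
    hiso).exists_partition (by omega) hm (by simp)
  refine ⟨univ.image (fiber c), ?_, ?_, fun v => ⟨fiber c (c v), by simp, by simp⟩⟩
  · intro f hf
    obtain ⟨i, -, rfl⟩ := mem_image.1 hf
    obtain ⟨⟨e, he, hie⟩, hcard⟩ := hc i
    rwa [eq_of_subset_of_card_le hie (by rw [hcard, hH e he])]
  · intro f hf g hg hfg
    obtain ⟨i, -, rfl⟩ := mem_image.1 (mem_coe.1 hf)
    obtain ⟨j, -, rfl⟩ := mem_image.1 (mem_coe.1 hg)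
    rw [Function.onFun, id, id, disjoint_left]
    intro v hvi hvj
    rw [mem_fiber] at hvi hvj
    exact hfg (by rw [← hvi, ← hvj])
end

section
/- For each k ≥ 3 there exists γ ∈ (0,1) such that for every n > 8k divisible by k the following holds: if H is a k-uniform hypergraph on n vertices with δ⁺(H) ≥ ((k−1)/k)·n − (k−2), no isolated vertices, and H is γ-extremal, then H contains a perfect matching. -/
open Finset

variable {V : Type*} [Fintype V] [DecidableEq V]

/-- `H` (a hypergraph on vertex set `V`) is `γ`-extremal: there is a set `S` of
`|V|/k` vertices such that at most `γ |V|^k` edges have at least two vertices in `S`. -/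
def IsExtremal (k : ℕ) (γ : ℝ) (H : Finset (Finset V)) : Prop :=
  ∃ S : Finset V, S.card = Fintype.card V / k ∧
    ((H.filter fun e => 2 ≤ (e ∩ S).card).card : ℝ) ≤ γ * (Fintype.card V : ℝ) ^ k

set_option linter.unusedSectionVars false

/-- A vertex set is supported if it is contained in an edge. -/
def Supported (H : Finset (Finset V)) (P : Finset V) : Prop := ∃ e ∈ H, P ⊆ e

instance (H : Finset (Finset V)) (P : Finset V) : Decidable (Supported H P) :=
  inferInstanceAs (Decidable (∃ e ∈ H, P ⊆ e))

/-- The vertices that cannot be added to `P` without destroying supportedness. -/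
def nonExt (H : Finset (Finset V)) (P : Finset V) : Finset V :=
  univ.filter fun w => ¬ Supported H (insert w P)

theorem mem_nonExt {H : Finset (Finset V)} {P : Finset V} {w : V} :
    w ∈ nonExt H P ↔ ¬ Supported H (insert w P) := by simp [nonExt]

theorem Supported.mono {H : Finset (Finset V)} {P Q : Finset V} (h : Supported H Q)
    (hPQ : P ⊆ Q) : Supported H P := by
  obtain ⟨e, he, hQ⟩ := h
  exact ⟨e, he, hPQ.trans hQ⟩

theorem nonExt_mono {H : Finset (Finset V)} {P Q : Finset V} (hPQ : P ⊆ Q) :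
    nonExt H P ⊆ nonExt H Q := by
  intro w hw
  rw [mem_nonExt] at hw ⊢
  exact fun h => hw (h.mono (insert_subset_insert w hPQ))

theorem mem_of_supported_of_card {k : ℕ} {H : Finset (Finset V)} (hK : ∀ e ∈ H, e.card = k)
    {P : Finset V} (h : Supported H P) (hP : P.card = k) : P ∈ H := by
  obtain ⟨e, he, hPe⟩ := h
  rwa [eq_of_subset_of_card_le hPe (by rw [hK e he, hP])]

theorem disjoint_nonExt {H : Finset (Finset V)} {P : Finset V} (h : Supported H P) :
    Disjoint (nonExt H P) P := by
  rw [disjoint_left]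
  intro w hw hwP
  rw [mem_nonExt, insert_eq_of_mem hwP] at hw
  exact hw h

theorem mem_nonExt_singleton_comm {H : Finset (Finset V)} {u v : V} :
    u ∈ nonExt H {v} ↔ v ∈ nonExt H {u} := by
  rw [mem_nonExt, mem_nonExt, pair_comm]

theorem card_nonExt_lt {k m : ℕ} (hk : 3 ≤ k) {H : Finset (Finset V)}
    (hn : Fintype.card V = k * m) (hK : ∀ e ∈ H, e.card = k)
    (hd : (k - 1) * m ≤ minPosCodeg k H + (k - 2))
    {P : Finset V} (hP : Supported H P) (hPk : P.card < k) : (nonExt H P).card < m := by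
  obtain ⟨e, he, hPe⟩ := hP
  obtain ⟨Q, hPQ, hQe, hQ⟩ := exists_subsuperset_card_eq hPe (n := k - 1) (by omega)
    (by rw [hK e he]; omega)
  have hQs : Supported H Q := ⟨e, he, hQe⟩
  have hpos : 0 < deg H Q := card_pos.2 ⟨e, by simp [he, hQe]⟩
  have hle : minPosCodeg k H ≤ deg H Q := Nat.sInf_le ⟨Q, hQ, hpos, rfl⟩
  set N := univ.filter fun w => w ∉ Q ∧ insert w Q ∈ H with hN
  have hdeg : deg H Q ≤ N.card := by
    have : (H.filter fun e => Q ⊆ e) ⊆ N.image fun w => insert w Q := by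
      intro f hf
      obtain ⟨hfH, hQf⟩ := mem_filter.1 hf
      have hc : (f \ Q).card = 1 := by rw [card_sdiff_of_subset hQf, hK f hfH, hQ]; omega
      obtain ⟨w, hw⟩ := card_eq_one.1 hc
      have hwQ : w ∉ Q := by
        have : w ∈ f \ Q := by rw [hw]; simp
        exact (mem_sdiff.1 this).2
      have hf' : insert w Q = f := by
        rw [insert_eq, ← hw, sdiff_union_of_subset hQf]
      exact mem_image.2 ⟨w, by simp [hN, hwQ, hf', hfH], hf'⟩
    exact (card_le_card this).trans card_image_le
  have h1 : Disjoint (nonExt H Q) Q := disjoint_nonExt hQs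
  have h2 : Disjoint (nonExt H Q ∪ Q) N := by
    rw [disjoint_left]
    intro w hw hwN
    simp only [hN, mem_filter, mem_univ, true_and] at hwN
    rcases mem_union.1 hw with hw | hw
    · exact mem_nonExt.1 hw ⟨_, hwN.2, Subset.refl _⟩
    · exact hwN.1 hw
  have h3 := card_le_univ ((nonExt H Q ∪ Q) ∪ N)
  rw [card_union_of_disjoint h2, card_union_of_disjoint h1, hQ, hn] at h3
  have h4 := card_le_card (nonExt_mono (H := H) hPQ)
  obtain ⟨j, rfl⟩ : ∃ j, k = j + 2 := ⟨k - 2, by omega⟩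
  have h5 : (j + 2) * m = (j + 2 - 1) * m + m := by
    rw [show j + 2 - 1 = j + 1 by omega]; ring
  omega

/-- Greedy extension of a supported set to an edge inside a prescribed vertex set `W`. -/
theorem exists_edge_extending {k : ℕ} {H : Finset (Finset V)} (hK : ∀ e ∈ H, e.card = k)
    (W : Finset V) {P : Finset V} (hP : Supported H P) (hPk : P.card ≤ k)
    (hW : ∀ Q, P ⊆ Q → Supported H Q → Q.card < k → (nonExt H Q ∩ W).card + k ≤ W.card) :
    ∃ e ∈ H, P ⊆ e ∧ e \ P ⊆ W := by
  induction hj : k - P.card generalizing P with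
  | zero =>
    exact ⟨P, mem_of_supported_of_card hK hP (by omega), Subset.refl _, by simp⟩
  | succ j ih =>
    have h1 := hW P (Subset.refl _) hP (by omega)
    have h2 : ((nonExt H P ∩ W) ∪ P).card < W.card :=
      (card_union_le _ _).trans_lt (by omega)
    obtain ⟨w, hwW, hw⟩ := exists_mem_notMem_of_card_lt_card h2
    simp only [mem_union, mem_inter, not_or, not_and] at hw
    have hwD : w ∉ nonExt H P := fun h => hw.1 h hwW
    rw [mem_nonExt, not_not] at hwD
    have hc : (insert w P).card = P.card + 1 := card_insert_of_notMem hw.2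
    obtain ⟨e, he, hPe, heW⟩ := ih hwD (by omega)
      (fun Q hQ => hW Q ((subset_insert _ _).trans hQ)) (by omega)
    refine ⟨e, he, (subset_insert _ _).trans hPe, fun x hx => ?_⟩
    by_cases hxw : x = w
    · exact hxw ▸ hwW
    · exact heW (by simp only [mem_sdiff, mem_insert] at hx ⊢; tauto)

theorem card_nonExt_sdiff_lt {k m : ℕ} {H : Finset (Finset V)}
    (hD : ∀ P, Supported H P → P.card < k → (nonExt H P).card < m)
    {P : Finset V} (hP : Supported H P) (hPk : P.card < k) {a : V} (ha : a ∈ P)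
    (A : Finset V) : (nonExt H P \ A).card + (nonExt H {a} ∩ A).card < m := by
  have h1 := card_le_card (inter_subset_inter_right (u := A)
    (nonExt_mono (H := H) (singleton_subset_iff.2 ha)))
  have h2 := card_sdiff_add_card_inter (nonExt H P) A
  have h3 := hD P hP hPk
  omega

theorem pow_le_mul_deg {k m : ℕ} (hk : 3 ≤ k) (hm : 0 < m) {H : Finset (Finset V)}
    (hn : Fintype.card V = k * m) (hK : ∀ e ∈ H, e.card = k)
    (hD : ∀ P, Supported H P → P.card < k → (nonExt H P).card < m)
    (j : ℕ) {P : Finset V} (hP : Supported H P) (hPj : P.card + j = k) :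
    m ^ j ≤ k ^ j * deg H P := by
  induction j generalizing P with
  | zero =>
    have : 0 < deg H P := card_pos.2
      ⟨P, by simp [mem_of_supported_of_card hK hP (by omega)]⟩
    rwa [pow_zero, pow_zero, one_mul]
  | succ j ih =>
    have h1 := hD P hP (by omega)
    set W := univ \ (nonExt H P ∪ P) with hWdef
    have hW : m ≤ W.card := by
      have h2 := card_union_le (nonExt H P) P
      have h3 : W.card = k * m - (nonExt H P ∪ P).card := by
        rw [hWdef, card_sdiff_of_subset (subset_univ _), card_univ, hn]
      obtain ⟨i, rfl⟩ : ∃ i, k = i + 2 := ⟨k - 2, by omega⟩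
      have : (i + 2) * m = i * m + m + m := by ring
      have : i ≤ i * m := Nat.le_mul_of_pos_right _ hm
      omega
    have h4 : ∑ w ∈ W, deg H (insert w P) ≤ k * deg H P := by
      have : ∀ w ∈ W, deg H (insert w P) =
        ∑ e ∈ H.filter (fun e => P ⊆ e), if w ∈ e then 1 else 0 := by
        intro w hw
        rw [deg, ← card_filter, filter_filter]
        congr 1
        ext e
        simp [insert_subset_iff, and_comm]
      rw [sum_congr rfl this, sum_comm, deg, mul_comm, ← smul_eq_mul]
      apply sum_le_card_nsmul
      intro e he
      rw [← card_filter]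
      refine (card_le_card (t := e) ?_).trans (hK e (mem_filter.1 he).1).le
      intro w hw
      exact (mem_filter.1 hw).2
    have h5 : W.card * m ^ j ≤ ∑ w ∈ W, k ^ j * deg H (insert w P) := by
      rw [← smul_eq_mul]
      apply card_nsmul_le_sum
      intro w hw
      simp only [hWdef, mem_sdiff, mem_univ, true_and, mem_union, not_or, mem_nonExt, not_not] at hw
      exact ih hw.1 (by rw [card_insert_of_notMem hw.2]; omega)
    rw [← mul_sum] at h5
    calc m ^ (j + 1) = m * m ^ j := by ring
      _ ≤ W.card * m ^ j := Nat.mul_le_mul_right _ hW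
      _ ≤ k ^ j * ∑ w ∈ W, deg H (insert w P) := h5
      _ ≤ k ^ j * (k * deg H P) := Nat.mul_le_mul_left _ h4
      _ = k ^ (j + 1) * deg H P := by ring

/-- Supported ordered pairs inside `S` are controlled by the edges meeting `S` at least twice. -/
theorem card_supported_pairs_mul_le {k m : ℕ} (hk : 3 ≤ k) (hm : 0 < m) {H : Finset (Finset V)}
    (hn : Fintype.card V = k * m) (hK : ∀ e ∈ H, e.card = k)
    (hD : ∀ P, Supported H P → P.card < k → (nonExt H P).card < m) (S : Finset V) :
    (S.offDiag.filter fun x => Supported H {x.1, x.2}).card * m ^ (k - 2) ≤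
      k ^ k * (H.filter fun e => 2 ≤ (e ∩ S).card).card := by
  set F := S.offDiag.filter fun x => Supported H {x.1, x.2} with hF
  set E := H.filter fun e => 2 ≤ (e ∩ S).card with hE
  have hne : ∀ x ∈ F, x.1 ∈ S ∧ x.2 ∈ S ∧ x.1 ≠ x.2 := fun x hx =>
    mem_offDiag.1 (mem_filter.1 hx).1
  have h1 : F.card * m ^ (k - 2) ≤ ∑ x ∈ F, k ^ (k - 2) * deg H {x.1, x.2} := by
    rw [← smul_eq_mul]
    apply card_nsmul_le_sum
    intro x hx
    exact pow_le_mul_deg hk hm hn hK hD _ (mem_filter.1 hx).2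
      (by rw [card_pair (hne x hx).2.2]; omega)
  have h2 : ∑ x ∈ F, deg H {x.1, x.2} ≤ k ^ 2 * E.card := by
    have : ∀ x ∈ F, deg H {x.1, x.2} = ∑ e ∈ E, if {x.1, x.2} ⊆ e then 1 else 0 := by
      intro x hx
      obtain ⟨h1, h2, h3⟩ := hne x hx
      rw [deg, ← card_filter, filter_filter]
      congr 1
      ext e
      simp only [mem_filter]
      refine ⟨fun h => ⟨h.1, ?_, h.2⟩, fun h => ⟨h.1, h.2.2⟩⟩
      rw [← card_pair h3]
      apply card_le_card
      rw [subset_inter_iff]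
      exact ⟨h.2, by simp [insert_subset_iff, h1, h2]⟩
    rw [sum_congr rfl this, sum_comm, mul_comm, ← smul_eq_mul]
    apply sum_le_card_nsmul
    intro e he
    rw [← card_filter]
    calc _ ≤ (e ×ˢ e).card := by
          apply card_le_card
          intro x hx
          have := (mem_filter.1 hx).2
          simpa [insert_subset_iff] using this
      _ = k ^ 2 := by rw [card_product, hK e (mem_filter.1 he).1, sq]
  rw [← mul_sum] at h1
  calc _ ≤ _ := h1
    _ ≤ k ^ (k - 2) * (k ^ 2 * E.card) := Nat.mul_le_mul_left _ h2
    _ = k ^ k * E.card := by rw [← mul_assoc, ← pow_add, Nat.sub_add_cancel (by omega)]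

section Arrangement

variable {I : Type*} [Fintype I] [DecidableEq I]

/-- If coordinate `c` is fixed and coordinate `j` is confined to a set `Y x` of at most `d` values
determined by the other coordinates, at most `d * p ^ (|I| - 2)` functions remain. -/
theorem card_filter_apply_mem_le {p d : ℕ} {c j : I} (hcj : j ≠ c) (i : Fin p)
    (Y : (I → Fin p) → Finset (Fin p)) (hY : ∀ x y, Y (Function.update x j y) = Y x)
    (hd : ∀ x, (Y x).card ≤ d) :
    (univ.filter fun x : I → Fin p => x c = i ∧ x j ∈ Y x).card ≤
      d * p ^ (Fintype.card I - 2) := by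
  set T := univ.filter fun x : I → Fin p => x c = i ∧ x j = i with hT
  have hTc : T.card ≤ p ^ (Fintype.card I - 2) := by
    have hsub : T ⊆ Fintype.piFinset fun l : I =>
        if l ∈ ({c, j} : Finset I) then ({i} : Finset (Fin p)) else univ := by
      intro x hx
      simp only [hT, mem_filter, mem_univ, true_and] at hx
      rw [Fintype.mem_piFinset]
      intro l
      by_cases h : l ∈ ({c, j} : Finset I)
      · rw [if_pos h]
        simp only [mem_insert, mem_singleton] at h
        rcases h with rfl | rfl
        · simp [hx.1]
        · simp [hx.2]
      · rw [if_neg h]; simp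
    refine (card_le_card hsub).trans ?_
    rw [Fintype.card_piFinset]
    have : ∀ l : I, (if l ∈ ({c, j} : Finset I) then ({i} : Finset (Fin p)) else univ).card =
        if l ∈ ({c, j} : Finset I) then 1 else p := by
      intro l; split_ifs <;> simp
    simp only [this]
    rw [prod_ite, prod_const_one, one_mul, prod_const, filter_not, filter_mem_eq_inter, univ_inter,
      card_sdiff_of_subset (subset_univ _), card_pair hcj.symm, card_univ]
  refine (card_le_mul_card_image_of_maps_to (f := fun x => Function.update x j i) (t := T)
    ?_ d ?_).trans (Nat.mul_le_mul_left _ hTc)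
  · intro x hx
    simp only [mem_filter, mem_univ, true_and] at hx
    simp [hT, Function.update_of_ne hcj.symm, hx.1]
  · intro y _
    refine (card_le_card_of_injOn (fun x => x j) ?_ ?_).trans (hd y)
    · intro x hx
      simp only [coe_filter, mem_filter, mem_univ, true_and, Set.mem_ofPred_eq] at hx
      rw [← hx.2, hY]
      exact hx.1.2
    · intro x hx x' hx' h
      simp only [coe_filter, mem_filter, mem_univ, true_and, Set.mem_ofPred_eq] at hx hx'
      have := hx.2.trans hx'.2.symm
      ext l
      by_cases hl : l = j
      · subst hl; exact congrArg Fin.val h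
      · simpa [Function.update_of_ne hl] using congrArg Fin.val (congrFun this l)

theorem card_filter_apply_eq {p : ℕ} (c : I) (i : Fin p) :
    (univ.filter fun x : I → Fin p => x c = i).card = p ^ (Fintype.card I - 1) := by
  have : (univ.filter fun x : I → Fin p => x c = i) = Fintype.piFinset fun l : I =>
      if l ∈ ({c} : Finset I) then ({i} : Finset (Fin p)) else univ := by
    ext x
    simp only [mem_filter, mem_univ, true_and, Fintype.mem_piFinset, mem_singleton]
    constructor
    · intro h l
      split_ifs with hl
      · simp [hl, h]
      · simp
    · intro h
      simpa using h c
  rw [this, Fintype.card_piFinset]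
  have : ∀ l : I, (if l ∈ ({c} : Finset I) then ({i} : Finset (Fin p)) else univ).card =
      if l ∈ ({c} : Finset I) then 1 else p := by
    intro l; split_ifs <;> simp
  simp only [this]
  rw [prod_ite, prod_const_one, one_mul, prod_const, filter_not, filter_mem_eq_inter, univ_inter,
    card_sdiff_of_subset (subset_univ _), card_singleton, card_univ]

theorem card_unsupported_le {p d : ℕ} {H : Finset (Finset V)} {A B : Finset V}
    (hcov : ∀ v, Supported H {v})
    (hA : ∀ P, Supported H P → P.card < Fintype.card I → (P ∩ A).Nonempty →
      (nonExt H P ∩ B).card ≤ d)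
    (hB : ∀ b ∈ B, (nonExt H {b} ∩ A).card ≤ d)
    (h : I → Fin p → V) (s₀ z : I) (hinj : ∀ s, Function.Injective (h s))
    (hhA : ∀ i, h s₀ i ∈ A) (hhB : ∀ s, s ≠ s₀ → ∀ i, h s i ∈ B) (j₀ : Fin p) :
    (univ.filter fun J : I → Fin p =>
      J z = j₀ ∧ ¬ Supported H (univ.image fun s => h s (J s))).card ≤
      (Fintype.card I + 1) * d * p ^ (Fintype.card I - 2) := by
  have key : ∀ C : Finset I, (univ.filter fun J : I → Fin p => J z = j₀ ∧
      ¬ Supported H ((insert s₀ (insert z C)).image fun s => h s (J s))).card ≤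
      (C.card + 1) * d * p ^ (Fintype.card I - 2) := by
    intro C
    induction C using Finset.induction_on with
    | empty =>
      by_cases hz : s₀ = z
      · subst hz
        simp [hcov]
      · refine le_trans (card_le_card ?_) (le_trans (card_filter_apply_mem_le hz j₀
          (fun _ => univ.filter fun y => h s₀ y ∈ nonExt H {h z j₀}) (by simp) (d := d) ?_) ?_)
        · intro J hJ
          simp only [mem_filter, mem_univ, true_and, image_insert, insert_empty_eq,
            image_singleton] at hJ ⊢
          refine ⟨hJ.1, ?_⟩
          rw [mem_nonExt, ← hJ.1]
          exact hJ.2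
        · intro _
          refine le_trans (card_le_card_of_injOn (h s₀) ?_ (hinj s₀).injOn)
            (hB (h z j₀) (hhB z (Ne.symm hz) j₀))
          intro y hy
          simp only [coe_filter, mem_univ, true_and, Set.mem_ofPred_eq] at hy
          exact mem_inter.2 ⟨hy, hhA y⟩
        · simp
    | insert j C hj ih =>
      by_cases hj' : j ∈ insert s₀ (insert z C)
      · have : insert s₀ (insert z (insert j C)) = insert s₀ (insert z C) := by
          rw [insert_comm z j, insert_comm s₀ j, insert_eq_of_mem hj']
        rw [this, card_insert_of_notMem hj]
        refine ih.trans ?_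
        gcongr
        omega
      · set C' := insert s₀ (insert z C) with hC'
        have hjz : j ≠ z := by rintro rfl; simp [hC'] at hj'
        have hjs : j ≠ s₀ := by rintro rfl; simp [hC'] at hj'
        have e1 : insert s₀ (insert z (insert j C)) = insert j C' := by
          rw [insert_comm z j, insert_comm s₀ j]
        set row : (I → Fin p) → Finset V := fun J => C'.image fun s => h s (J s) with hrow
        have hrowu : ∀ J y, row (Function.update J j y) = row J := by
          intro J y
          apply image_congr
          intro s hs
          have : s ≠ j := by rintro rfl; exact hj' hs
          simp [Function.update_of_ne this]
        let Y : (I → Fin p) → Finset (Fin p) := fun J =>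
          if Supported H (row J) then univ.filter fun y => h j y ∈ nonExt H (row J) else ∅
        have hYc : ∀ J, (Y J).card ≤ d := by
          intro J
          by_cases hs : Supported H (row J)
          · simp only [Y, if_pos hs]
            refine le_trans (card_le_card_of_injOn (h j) ?_ (hinj j).injOn)
              (hA (row J) hs ?_ ⟨h s₀ (J s₀), ?_⟩)
            · intro y hy
              simp only [coe_filter, mem_univ, true_and, Set.mem_ofPred_eq] at hy
              exact mem_inter.2 ⟨hy, hhB j hjs y⟩
            · exact card_image_le.trans_lt (card_lt_univ_of_notMem hj')
            · exact mem_inter.2 ⟨mem_image.2 ⟨s₀, mem_insert_self _ _, rfl⟩, hhA _⟩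
          · simp [Y, if_neg hs]
        have h2 := card_filter_apply_mem_le hjz j₀ Y (by intro x y; simp only [Y, hrowu]) hYc
        rw [e1, card_insert_of_notMem hj]
        refine le_trans (card_le_card (t := (univ.filter fun J : I → Fin p => J z = j₀ ∧
          ¬ Supported H (row J)) ∪ univ.filter fun x : I → Fin p => x z = j₀ ∧ x j ∈ Y x) ?_)
          ((card_union_le _ _).trans ?_)
        · intro J hJ
          simp only [mem_filter, mem_univ, true_and, mem_union, image_insert] at hJ ⊢
          by_cases hs : Supported H (row J)
          · right
            refine ⟨hJ.1, ?_⟩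
            simp only [Y, if_pos hs, mem_filter, mem_univ, true_and, mem_nonExt]
            exact hJ.2
          · exact Or.inl ⟨hJ.1, hs⟩
        · calc _ ≤ (C.card + 1) * d * p ^ (Fintype.card I - 2) +
                d * p ^ (Fintype.card I - 2) := add_le_add ih h2
            _ = _ := by ring
  have := key univ
  simpa using this

/-- A layout of `A ∪ B` as a table with columns indexed by `I`, column `0` being `A`. -/
def IsLayout [Zero I] {p : ℕ} (A B : Finset V) (g : I → Fin p → V) : Prop :=
  Function.Injective (fun x : I × Fin p => g x.1 x.2) ∧ (∀ i, g 0 i ∈ A) ∧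
    ∀ c, c ≠ 0 → ∀ i, g c i ∈ B

theorem exists_isLayout [Zero I] {p : ℕ} {A B : Finset V} (hAB : Disjoint A B)
    (hA : A.card = p) (hB : B.card = (Fintype.card I - 1) * p) :
    ∃ g : I → Fin p → V, IsLayout A B g := by
  have eA : Fin p ≃ A := Fintype.equivOfCardEq (by simp [hA])
  have eB : {c : I // c ≠ 0} × Fin p ≃ B := Fintype.equivOfCardEq (by
    simp [hB, Fintype.card_subtype_compl])
  refine ⟨fun c i => if h : c = 0 then eA i else eB (⟨c, h⟩, i), ?_, ?_, ?_⟩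
  · rintro ⟨c, i⟩ ⟨c', i'⟩ h
    by_cases hc : c = 0 <;> by_cases hc' : c' = 0
    · subst hc hc'
      simpa [Subtype.ext_iff] using h
    · simp only [hc, hc', dite_true, dite_false] at h
      exact absurd (h ▸ (eB _).2) (disjoint_left.1 hAB (eA i).2)
    · simp only [hc, hc', dite_true, dite_false] at h
      exact absurd (h ▸ (eB _).2) (disjoint_left.1 hAB (eA i').2)
    · simp only [hc, hc', dite_false] at h
      have := eB.injective (Subtype.ext h)
      simpa using this
  · intro i; simp
  · intro c hc i; simp [hc]

/-- If all rows of a layout are supported, the rows form a perfect matching of `A ∪ B`. -/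
theorem exists_matching_of_layout [Zero I] {p : ℕ} {H : Finset (Finset V)} {A B : Finset V}
    (hK : ∀ e ∈ H, e.card = Fintype.card I) (hAB : Disjoint A B) (hA : A.card = p)
    (hB : B.card = (Fintype.card I - 1) * p) {g : I → Fin p → V} (hg : IsLayout A B g)
    (hs : ∀ i, Supported H (univ.image fun c => g c i)) :
    ∃ M ⊆ H, (M : Set (Finset V)).PairwiseDisjoint id ∧ M.biUnion id = A ∪ B := by
  have hinj := hg.1
  refine ⟨univ.image fun i => univ.image fun c => g c i, ?_, ?_, ?_⟩
  · intro e he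
    obtain ⟨i, -, rfl⟩ := mem_image.1 he
    refine mem_of_supported_of_card hK (hs i) ?_
    rw [card_image_of_injective _ (fun c c' h => ?_), card_univ]
    exact congrArg Prod.fst (@hinj (c, i) (c', i) h)
  · intro e he f hf hef
    simp only [coe_image, coe_univ, Set.image_univ, Set.mem_range] at he hf
    obtain ⟨i, rfl⟩ := he
    obtain ⟨j, rfl⟩ := hf
    simp only [Function.onFun, id]
    rw [disjoint_left]
    intro v hv hv'
    obtain ⟨c, -, rfl⟩ := mem_image.1 hv
    obtain ⟨c', -, h⟩ := mem_image.1 hv'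
    have := congrArg Prod.snd (@hinj (c', j) (c, i) h)
    simp only at this
    exact hef (by rw [this])
  · have : (univ.image fun i => univ.image fun c => g c i).biUnion id =
        univ.image fun x : I × Fin p => g x.1 x.2 := by
      ext v
      simp only [mem_biUnion, mem_image, mem_univ, true_and, id, Prod.exists]
      constructor
      · rintro ⟨e, ⟨i, rfl⟩, hv⟩
        obtain ⟨c, -, h⟩ := mem_image.1 hv
        exact ⟨c, i, h⟩
      · rintro ⟨c, i, h⟩
        exact ⟨_, ⟨i, rfl⟩, mem_image.2 ⟨c, mem_univ _, h⟩⟩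
    rw [this]
    apply eq_of_subset_of_card_le
    · intro v hv
      obtain ⟨⟨c, i⟩, -, rfl⟩ := mem_image.1 hv
      rw [mem_union]
      by_cases hc : c = 0
      · subst hc; exact Or.inl (hg.2.1 i)
      · exact Or.inr (hg.2.2 c hc i)
    · rw [card_image_of_injective _ hinj, card_union_of_disjoint hAB, hA, hB, card_univ,
        Fintype.card_prod, Fintype.card_fin]
      have : 0 < Fintype.card I := Fintype.card_pos_iff.2 ⟨0⟩
      obtain ⟨q, hq⟩ : ∃ q, Fintype.card I = q + 1 := ⟨Fintype.card I - 1, by omega⟩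
      rw [hq, Nat.add_sub_cancel]
      apply le_of_eq
      ring

/-- A transversal system of `|I|` rows replacing an unsupported row can be chosen. -/
theorem exists_injective_supported [AddCommGroup I] {p d : ℕ} {H : Finset (Finset V)}
    {A B : Finset V} (hI : 2 ≤ Fintype.card I) (hcov : ∀ v, Supported H {v})
    (hA : ∀ P, Supported H P → P.card < Fintype.card I → (P ∩ A).Nonempty →
      (nonExt H P ∩ B).card ≤ d)
    (hB : ∀ b ∈ B, (nonExt H {b} ∩ A).card ≤ d)
    (hp : Fintype.card I * ((Fintype.card I + 1) * d) + Fintype.card I ^ 2 < p)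
    {g : I → Fin p → V} (hg : IsLayout A B g) (j₀ : Fin p) :
    ∃ J : I → Fin p, Function.Injective J ∧ J 0 = j₀ ∧
      ∀ r, Supported H (univ.image fun s => g (s + r) (J s)) := by
  by_contra! hcon
  set q := p ^ (Fintype.card I - 2) with hq
  let R : I → Finset (I → Fin p) := fun r => univ.filter fun J =>
    J 0 = j₀ ∧ ¬ Supported H (univ.image fun s => g (s + r) (J s))
  let Q : I × I → Finset (I → Fin p) := fun x => univ.filter fun J =>
    J 0 = j₀ ∧ J x.2 ∈ ({J x.1} : Finset (Fin p))
  set N := (univ : Finset (I × I)).filter fun x => x.1 ≠ x.2 ∧ x.2 ≠ 0 with hN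
  have hR : ∀ r, (R r).card ≤ (Fintype.card I + 1) * d * q := by
    intro r
    refine card_unsupported_le hcov hA hB (fun s => g (s + r)) (-r) 0 ?_ ?_ ?_ j₀
    · intro s i i' h
      exact congrArg Prod.snd (@hg.1 (s + r, i) (s + r, i') h)
    · intro i; simpa using hg.2.1 i
    · intro s hs i
      exact hg.2.2 _ (fun h => hs (eq_neg_of_add_eq_zero_left h)) i
  have hQ : ∀ x ∈ N, (Q x).card ≤ q := by
    intro x hx
    simp only [hN, mem_filter, mem_univ, true_and] at hx
    have := card_filter_apply_mem_le hx.2 j₀ (fun J => ({J x.1} : Finset (Fin p)))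
      (by intro J y; simp [Function.update_of_ne hx.1]) (d := 1) (by simp)
    simpa [Q, hq] using this
  have hsub : (univ.filter fun J : I → Fin p => J 0 = j₀) ⊆ univ.biUnion R ∪ N.biUnion Q := by
    intro J hJ
    simp only [mem_filter, mem_univ, true_and] at hJ
    rw [mem_union]
    by_cases hinj : Function.Injective J
    · left
      obtain ⟨r, hr⟩ := hcon J hinj hJ
      exact mem_biUnion.2 ⟨r, mem_univ _, by simp [R, hJ, hr]⟩
    · right
      simp only [Function.Injective, not_forall] at hinj
      obtain ⟨s, s', h, hne⟩ := hinj
      by_cases hs : s' = 0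
      · have hs0 : s ≠ 0 := fun h0 => hne (h0.trans hs.symm)
        refine mem_biUnion.2 ⟨(s', s), by simp [hN, Ne.symm hne, hs0], ?_⟩
        simp [Q, hJ, h]
      · exact mem_biUnion.2 ⟨(s, s'), by simp [hN, hne, hs], by simp [Q, hJ, h]⟩
  have h1 := (card_le_card hsub).trans (card_union_le _ _)
  rw [card_filter_apply_eq] at h1
  have h2 : (univ.biUnion R).card ≤ Fintype.card I * ((Fintype.card I + 1) * d * q) := by
    have := card_biUnion_le_card_mul univ R _ (fun r _ => hR r)
    rwa [card_univ] at this
  have h3 : (N.biUnion Q).card ≤ Fintype.card I ^ 2 * q := by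
    refine (card_biUnion_le_card_mul N Q _ hQ).trans (Nat.mul_le_mul_right _ ?_)
    refine (card_le_univ _).trans ?_
    rw [Fintype.card_prod, sq]
  have h4 : p ^ (Fintype.card I - 1) = p * q := by
    rw [hq, ← pow_succ', show Fintype.card I - 2 + 1 = Fintype.card I - 1 by omega]
  have hq0 : 0 < q := pow_pos (by omega) _
  have h5 := Nat.mul_lt_mul_of_pos_right hp hq0
  rw [h4] at h1
  have h6 : (Fintype.card I * ((Fintype.card I + 1) * d) + Fintype.card I ^ 2) * q =
    Fintype.card I * ((Fintype.card I + 1) * d * q) + Fintype.card I ^ 2 * q := by ring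
  omega

/-- A dense `A`-`B` structure has a perfect matching by edges with exactly one vertex in `A`. -/
theorem exists_matching_of_dense [AddCommGroup I] {p d : ℕ} {H : Finset (Finset V)}
    {A B : Finset V} (hI : 2 ≤ Fintype.card I) (hK : ∀ e ∈ H, e.card = Fintype.card I)
    (hcov : ∀ v, Supported H {v}) (hAB : Disjoint A B) (hAc : A.card = p)
    (hBc : B.card = (Fintype.card I - 1) * p)
    (hA : ∀ P, Supported H P → P.card < Fintype.card I → (P ∩ A).Nonempty →
      (nonExt H P ∩ B).card ≤ d)
    (hB : ∀ b ∈ B, (nonExt H {b} ∩ A).card ≤ d)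
    (hp : Fintype.card I * ((Fintype.card I + 1) * d) + Fintype.card I ^ 2 < p) :
    ∃ M ⊆ H, (M : Set (Finset V)).PairwiseDisjoint id ∧ M.biUnion id = A ∪ B := by
  classical
  let good : (I → Fin p → V) → Finset (Fin p) := fun g =>
    univ.filter fun i => Supported H (univ.image fun c => g c i)
  obtain ⟨g₀, hg₀⟩ := exists_isLayout (I := I) hAB hAc hBc
  obtain ⟨g, hg, hmax⟩ := exists_max_image
    ((univ : Finset (I → Fin p → V)).filter fun g => IsLayout A B g) (fun g => (good g).card)
    ⟨g₀, by simp [hg₀]⟩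
  simp only [mem_filter, mem_univ, true_and] at hg hmax
  refine exists_matching_of_layout hK hAB hAc hBc hg ?_
  by_contra! hcon
  obtain ⟨j₀, hj₀⟩ := hcon
  obtain ⟨J, hJ, hJ0, hJs⟩ := exists_injective_supported hI hcov hA hB hp hg j₀
  let π : I → Equiv.Perm (Fin p) := fun c => Equiv.Perm.viaEmbedding (Equiv.subLeft c) ⟨J, hJ⟩
  have hπ : ∀ c r, π c (J r) = J (c - r) := fun c r =>
    Equiv.Perm.viaEmbedding_apply (Equiv.subLeft c) ⟨J, hJ⟩ r
  have hπ' : ∀ c i, i ∉ Set.range J → π c i = i := fun c i hi =>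
    Equiv.Perm.viaEmbedding_apply_of_notMem (Equiv.subLeft c) ⟨J, hJ⟩ i hi
  let g' : I → Fin p → V := fun c i => g c (π c i)
  have hg' : IsLayout A B g' := by
    refine ⟨?_, fun i => hg.2.1 _, fun c hc i => hg.2.2 c hc _⟩
    rintro ⟨c, i⟩ ⟨c', i'⟩ h
    have := @hg.1 (c, π c i) (c', π c' i') h
    simp only [Prod.mk.injEq] at this
    obtain ⟨rfl, h2⟩ := this
    rw [(π c).injective h2]
  have hrow : ∀ r, Supported H (univ.image fun c => g' c (J r)) := by
    intro r
    convert hJs r using 1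
    ext v
    simp only [mem_image, mem_univ, true_and, g', hπ]
    constructor
    · rintro ⟨c, rfl⟩; exact ⟨c - r, by simp⟩
    · rintro ⟨s, rfl⟩; exact ⟨s + r, by simp⟩
  have hss : good g ⊂ good g' := by
    rw [ssubset_iff_of_subset]
    · exact ⟨j₀, by simpa [good, hJ0] using hrow 0, by simpa [good] using hj₀⟩
    · intro i hi
      simp only [good, mem_filter, mem_univ, true_and] at hi ⊢
      by_cases hr : i ∈ Set.range J
      · obtain ⟨r, rfl⟩ := hr
        exact hrow r
      · simpa [g', hπ' _ i hr] using hi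
  exact absurd (hmax g' hg') (not_le.2 (card_lt_card hss))

/-- If nothing obstructs extensions into `B`, every layout consists of edges. -/
theorem exists_matching_of_complete [Zero I] {p : ℕ} {H : Finset (Finset V)} {A B : Finset V}
    (hK : ∀ e ∈ H, e.card = Fintype.card I) (hcov : ∀ v, Supported H {v}) (hAB : Disjoint A B)
    (hAc : A.card = p) (hBc : B.card = (Fintype.card I - 1) * p)
    (hA : ∀ P, Supported H P → P.card < Fintype.card I → (P ∩ A).Nonempty →
      Disjoint (nonExt H P) B) :
    ∃ M ⊆ H, (M : Set (Finset V)).PairwiseDisjoint id ∧ M.biUnion id = A ∪ B := by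
  obtain ⟨g, hg⟩ := exists_isLayout (I := I) hAB hAc hBc
  refine exists_matching_of_layout hK hAB hAc hBc hg fun i => ?_
  have key : ∀ C : Finset I, Supported H ((insert 0 C).image fun c => g c i) := by
    intro C
    induction C using Finset.induction_on with
    | empty => simpa using hcov _
    | insert j C hj ih =>
      by_cases hj0 : j = 0
      · subst hj0; simpa using ih
      · rw [insert_comm, image_insert]
        by_contra hns
        refine disjoint_left.1 (hA _ ih ?_ ⟨g 0 i, ?_⟩) (mem_nonExt.2 hns) (hg.2.2 j hj0 i)
        · exact card_image_le.trans_lt (card_lt_univ_of_notMem (x := j) (by simp [hj, hj0]))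
        · exact mem_inter.2 ⟨mem_image_of_mem _ (mem_insert_self _ _), hg.2.1 i⟩
  simpa using key univ

end Arrangement

theorem card_biUnion_inter_of_forall {M : Finset (Finset V)} {A : Finset V} {j : ℕ}
    (hM : (M : Set (Finset V)).PairwiseDisjoint id) (h : ∀ e ∈ M, (e ∩ A).card = j) :
    (M.biUnion id ∩ A).card = M.card * j := by
  rw [biUnion_inter, card_biUnion, sum_congr rfl (by simpa using h), sum_const, smul_eq_mul]
  intro e he f hf hef
  exact (hM he hf hef).mono inter_subset_left inter_subset_left

theorem card_biUnion_of_forall {M : Finset (Finset V)} {j : ℕ}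
    (hM : (M : Set (Finset V)).PairwiseDisjoint id) (h : ∀ e ∈ M, e.card = j) :
    (M.biUnion id).card = M.card * j := by
  have := card_biUnion_inter_of_forall (A := univ) (j := j) hM (by simpa using h)
  simpa using this

theorem pairwiseDisjoint_insert_of_disjoint {M : Finset (Finset V)} {e : Finset V}
    (hM : (M : Set (Finset V)).PairwiseDisjoint id) (he : Disjoint e (M.biUnion id)) :
    ((insert e M : Finset (Finset V)) : Set (Finset V)).PairwiseDisjoint id := by
  rw [coe_insert]
  refine hM.insert fun f hf _ => he.mono_right ?_
  exact subset_biUnion_of_mem id (mem_coe.1 hf)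

/-- If every matching with fewer than `t` edges can be enlarged, there is one with `t` edges. -/
theorem exists_matching_of_greedy {E : Finset (Finset V)} (hE : ∀ e ∈ E, e.Nonempty) (t : ℕ)
    (h : ∀ M ⊆ E, (M : Set (Finset V)).PairwiseDisjoint id → M.card < t →
      ∃ e ∈ E, Disjoint e (M.biUnion id)) :
    ∃ M ⊆ E, (M : Set (Finset V)).PairwiseDisjoint id ∧ M.card = t := by
  induction t with
  | zero => exact ⟨∅, by simp, by simp, rfl⟩
  | succ t ih =>
    obtain ⟨M, hME, hM, hMt⟩ := ih fun M hM hd hc => h M hM hd (by omega)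
    obtain ⟨e, he, hed⟩ := h M hME hM (by omega)
    have heM : e ∉ M := by
      intro heM
      obtain ⟨x, hx⟩ := hE e he
      exact disjoint_left.1 hed hx (mem_biUnion.2 ⟨e, heM, hx⟩)
    exact ⟨insert e M, insert_subset he hME, pairwiseDisjoint_insert_of_disjoint hM hed,
      by rw [card_insert_of_notMem heM, hMt]⟩

section Balancing

variable {k m : ℕ} {H : Finset (Finset V)} {A : Finset V}

/-- A supported set containing a vertex of `A` extends to an edge by vertices outside `A ∪ U`. -/
theorem exists_edge_extending_compl (hK : ∀ e ∈ H, e.card = k)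
    (hD : ∀ P, Supported H P → P.card < k → (nonExt H P).card < m)
    (hA : ∀ a ∈ A, 3 * m ≤ 4 * (nonExt H {a} ∩ A).card) {P U : Finset V}
    (hU : 4 * (U.card + k) + m ≤ 4 * Aᶜ.card) (hP : Supported H P) (hPk : P.card ≤ k)
    {a : V} (haP : a ∈ P) (haA : a ∈ A) :
    ∃ e ∈ H, P ⊆ e ∧ e \ P ⊆ Aᶜ \ U := by
  refine exists_edge_extending hK (Aᶜ \ U) hP hPk fun Q hPQ hQ hQk => ?_
  have h1 := card_nonExt_sdiff_lt hD hQ hQk (hPQ haP) A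
  have h2 := hA a haA
  have h3 : (nonExt H Q ∩ (Aᶜ \ U)).card ≤ (nonExt H Q \ A).card := by
    apply card_le_card
    intro x
    simp only [mem_inter, mem_sdiff, mem_compl]
    tauto
  have h4 := le_card_sdiff U Aᶜ
  omega

/-- If `A` has `t` vertices too many, there are `t` disjoint edges meeting `A` twice. -/
theorem exists_matching_two (hk : 3 ≤ k) (hn : Fintype.card V = k * m)
    (hK : ∀ e ∈ H, e.card = k) (hcov : ∀ v, Supported H {v})
    (hD : ∀ P, Supported H P → P.card < k → (nonExt H P).card < m)
    (hA : ∀ a ∈ A, 3 * m ≤ 4 * (nonExt H {a} ∩ A).card) {t : ℕ} (hAt : A.card = m + t)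
    (ht : 100 * k * t ≤ m) (hkm : 100 * k ≤ m) :
    ∃ M ⊆ H.filter (fun e => (e ∩ A).card = 2),
      (M : Set (Finset V)).PairwiseDisjoint id ∧ M.card = t := by
  apply exists_matching_of_greedy
  · intro e he
    rw [← card_pos, hK e (mem_filter.1 he).1]; omega
  intro M hME hM hMt
  set U := M.biUnion id with hUdef
  have hU : U.card = M.card * k :=
    card_biUnion_of_forall hM fun e he => hK e (mem_filter.1 (hME he)).1
  have hUA : (U ∩ A).card = M.card * 2 :=
    card_biUnion_inter_of_forall hM fun e he => (mem_filter.1 (hME he)).2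
  have hkt : M.card * k ≤ k * t := by rw [mul_comm]; exact Nat.mul_le_mul_left _ hMt.le
  have hkt' : 100 * (k * t) ≤ m := by rwa [← mul_assoc]
  have htkt : t ≤ k * t := Nat.le_mul_of_pos_left _ (by omega)
  have hkm3 : 3 * m ≤ k * m := Nat.mul_le_mul_right _ hk
  have hAc : Aᶜ.card = k * m - (m + t) := by rw [card_compl, hn, hAt]
  obtain ⟨a, ha, a', ha', haa', hs⟩ : ∃ a ∈ A \ U, ∃ a' ∈ A \ U, a' ≠ a ∧ Supported H {a', a} := by
    by_contra! hcon
    have h1 := card_mul_le_card_mul (fun a u => u ∉ nonExt H {a}) (s := A \ U) (t := U ∩ A)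
      (m := t) (n := (m + 4 * t) / 4) ?_ ?_
    · have h2 : (A \ U).card = m + t - M.card * 2 := by
        have := card_sdiff_add_card_inter A U
        rw [inter_comm, hUA] at this
        omega
      rw [h2, hUA] at h1
      have h3 : (m - t) * t ≤ (m + t - M.card * 2) * t := Nat.mul_le_mul_right _ (by omega)
      have h4 : M.card * 2 * ((m + 4 * t) / 4) ≤ (2 * ((m + 4 * t) / 4)) * t := by
        rw [mul_assoc, mul_comm]
        exact Nat.mul_le_mul_left _ hMt.le
      have h5 := Nat.le_of_mul_le_mul_right ((h3.trans h1).trans h4) (by omega)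
      omega
    · intro a ha
      obtain ⟨haA, haU⟩ := mem_sdiff.1 ha
      have h2 := hD {a} (hcov a) (by rw [card_singleton]; omega)
      have h3 := card_le_card (inter_subset_left (s₁ := nonExt H {a}) (s₂ := A))
      have h4 := card_sdiff_add_card_inter A (nonExt H {a})
      rw [inter_comm] at h4
      have h5 : A \ nonExt H {a} ⊆
          insert a ((U ∩ A).bipartiteAbove (fun a u => u ∉ nonExt H {a}) a) := by
        intro x hx
        obtain ⟨hxA, hxD⟩ := mem_sdiff.1 hx
        rw [mem_insert, mem_bipartiteAbove, mem_inter]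
        by_cases hxa : x = a
        · exact Or.inl hxa
        · refine Or.inr ⟨⟨?_, hxA⟩, hxD⟩
          by_contra hxU
          exact hcon a ha x (mem_sdiff.2 ⟨hxA, hxU⟩) hxa (by simpa [mem_nonExt] using hxD)
      have h6 := (card_le_card h5).trans (card_insert_le _ _)
      omega
    · intro u hu
      obtain ⟨-, huA⟩ := mem_inter.1 hu
      have h2 := hA u huA
      have h4 := card_sdiff_add_card_inter A (nonExt H {u})
      rw [inter_comm] at h4
      have h5 : (A \ U).bipartiteBelow (fun a u => u ∉ nonExt H {a}) u ⊆ A \ nonExt H {u} := by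
        intro x hx
        rw [mem_bipartiteBelow] at hx
        exact mem_sdiff.2 ⟨(mem_sdiff.1 hx.1).1, fun h => hx.2 (mem_nonExt_singleton_comm.1 h)⟩
      have h6 := card_le_card h5
      omega
  rw [mem_sdiff] at ha ha'
  obtain ⟨e, he, hPe, heU⟩ := exists_edge_extending_compl hK hD hA (U := U) (by omega) hs
    (by rw [card_pair haa']; omega) (a := a) (by simp) ha.1
  have hout : ∀ x ∈ e, x ∉ ({a', a} : Finset V) → x ∉ A ∧ x ∉ U := by
    intro x hx hxP
    simpa using heU (mem_sdiff.2 ⟨hx, hxP⟩)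
  have heA : e ∩ A = {a', a} := by
    ext x
    rw [mem_inter]
    constructor
    · rintro ⟨hx, hxA⟩
      by_contra hxP
      exact (hout x hx hxP).1 hxA
    · intro hx
      refine ⟨hPe hx, ?_⟩
      rcases mem_insert.1 hx with rfl | hx
      · exact ha'.1
      · rw [mem_singleton.1 hx]; exact ha.1
  refine ⟨e, mem_filter.2 ⟨he, by rw [heA, card_pair haa']⟩, ?_⟩
  rw [disjoint_left]
  intro x hx hxU
  by_cases hxP : x ∈ ({a', a} : Finset V)
  · rcases mem_insert.1 hxP with rfl | hx
    · exact ha'.2 hxU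
    · rw [mem_singleton.1 hx] at hxU; exact ha.2 hxU
  · exact (hout x hx hxP).2 hxU

/-- If `A` has `t` vertices too few, there are `t` disjoint edges avoiding `A`. -/
theorem exists_matching_zero (hk : 3 ≤ k) (hn : Fintype.card V = k * m)
    (hK : ∀ e ∈ H, e.card = k) (hcov : ∀ v, Supported H {v})
    (hD : ∀ P, Supported H P → P.card < k → (nonExt H P).card < m)
    (hA : ∀ a ∈ A, 3 * m ≤ 4 * (nonExt H {a} ∩ A).card) {t : ℕ} (hAt : A.card + t = m)
    (ht : 100 * k * t ≤ m) (hkm : 100 * k ≤ m) :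
    ∃ M ⊆ H.filter (fun e => (e ∩ A).card = 0),
      (M : Set (Finset V)).PairwiseDisjoint id ∧ M.card = t := by
  apply exists_matching_of_greedy
  · intro e he
    rw [← card_pos, hK e (mem_filter.1 he).1]; omega
  intro M hME hM hMt
  set U := M.biUnion id with hUdef
  have hU : U.card = M.card * k :=
    card_biUnion_of_forall hM fun e he => hK e (mem_filter.1 (hME he)).1
  have hkt : M.card * k ≤ k * t := by rw [mul_comm]; exact Nat.mul_le_mul_left _ hMt.le
  have hkt' : 100 * (k * t) ≤ m := by rwa [← mul_assoc]
  have htkt : t ≤ k * t := Nat.le_mul_of_pos_left _ (by omega)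
  have hkm3 : 3 * m ≤ k * m := Nat.mul_le_mul_right _ hk
  have hAc : Aᶜ.card = k * m - A.card := by rw [card_compl, hn]
  obtain ⟨a, ha⟩ : A.Nonempty := card_pos.1 (by omega)
  obtain ⟨e, he, hPe, heU⟩ := exists_edge_extending_compl hK hD hA (U := U) (by omega) (hcov a)
    (by rw [card_singleton]; omega) (mem_singleton_self a) ha
  set Q := e \ {a} with hQdef
  have hQc : Q.card = k - 1 := by
    rw [hQdef, card_sdiff_of_subset hPe, hK e he, card_singleton]
  have hQ : Supported H Q := ⟨e, he, sdiff_subset⟩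
  have hQD := hD Q hQ (by omega)
  have hlt : ((U ∪ Q) ∪ nonExt H Q).card < Aᶜ.card := by
    have h1 := card_union_le (U ∪ Q) (nonExt H Q)
    have h2 := card_union_le U Q
    omega
  obtain ⟨w, hwA, hw⟩ := exists_mem_notMem_of_card_lt_card hlt
  simp only [mem_union, not_or, mem_nonExt, not_not] at hw
  have hmem : insert w Q ∈ H :=
    mem_of_supported_of_card hK hw.2 (by rw [card_insert_of_notMem hw.1.2]; omega)
  have hout : ∀ x ∈ insert w Q, x ∉ A ∧ x ∉ U := by
    intro x hx
    rcases mem_insert.1 hx with rfl | hx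
    · exact ⟨mem_compl.1 hwA, hw.1.1⟩
    · simpa using heU hx
  refine ⟨_, mem_filter.2 ⟨hmem, ?_⟩, disjoint_left.2 fun x hx => (hout x hx).2⟩
  rw [card_eq_zero, ← disjoint_iff_inter_eq_empty]
  exact disjoint_left.2 fun x hx => (hout x hx).1

/-- Extend a matching to cover `X`, using only edges that meet `A` once. -/
theorem exists_matching_covering (hK : ∀ e ∈ H, e.card = k) {M₀ : Finset (Finset V)}
    (hM₀H : M₀ ⊆ H) (hM₀ : (M₀ : Set (Finset V)).PairwiseDisjoint id)
    (hbal : (Aᶜ \ M₀.biUnion id).card = (k - 1) * (A \ M₀.biUnion id).card) (X : Finset V)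
    (hstep : ∀ U : Finset V, U.card ≤ (M₀.card + X.card) * k → ∀ x ∉ U,
      ∃ e ∈ H, x ∈ e ∧ Disjoint e U ∧ (e ∩ A).card = 1) :
    ∃ M ⊆ H, (M : Set (Finset V)).PairwiseDisjoint id ∧ X ⊆ M.biUnion id ∧
      M.card ≤ M₀.card + X.card ∧
      (Aᶜ \ M.biUnion id).card = (k - 1) * (A \ M.biUnion id).card := by
  induction X using Finset.induction_on with
  | empty => exact ⟨M₀, hM₀H, hM₀, by simp, by simp, hbal⟩
  | insert x X hx ih =>
    rw [card_insert_of_notMem hx] at hstep ⊢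
    obtain ⟨M, hMH, hM, hXM, hMc, hMb⟩ := ih fun U hU =>
      hstep U (hU.trans (Nat.mul_le_mul_right _ (by omega)))
    set U := M.biUnion id with hUdef
    by_cases hxU : x ∈ U
    · exact ⟨M, hMH, hM, insert_subset hxU hXM, by omega, hMb⟩
    have hU : U.card = M.card * k := card_biUnion_of_forall hM fun e he => hK e (hMH he)
    obtain ⟨e, he, hxe, heU, heA⟩ := hstep U
      (by rw [hU]; exact Nat.mul_le_mul_right _ (by omega)) x hxU
    have hUe : (insert e M).biUnion id = e ∪ U := by rw [biUnion_insert, id]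
    refine ⟨insert e M, insert_subset he hMH, pairwiseDisjoint_insert_of_disjoint hM heU, ?_,
      (card_insert_le _ _).trans (by omega), ?_⟩
    · rw [hUe]
      exact insert_subset (mem_union_left _ hxe) (hXM.trans subset_union_right)
    · have key : ∀ B : Finset V, (B \ (e ∪ U)).card + (e ∩ B).card = (B \ U).card := by
        intro B
        rw [← card_union_of_disjoint]
        · congr 1
          ext y
          have : y ∈ e → y ∉ U := fun h => disjoint_left.1 heU h
          simp only [mem_union, mem_sdiff, mem_inter]
          tauto
        · rw [disjoint_left]
          intro y
          simp only [mem_union, mem_sdiff, mem_inter]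
          tauto
      rw [hUe]
      have h1 := key A
      have h2 := key Aᶜ
      have h3 : (e ∩ Aᶜ).card = k - 1 := by
        have := card_sdiff_add_card_inter e A
        rw [← sdiff_eq_inter_compl]
        have := hK e he
        omega
      rw [heA] at h1
      rw [h3, hMb, ← h1, mul_add, mul_one] at h2
      omega

/-- The balancing step: a small matching after which `A` has the correct proportion. -/
theorem exists_balancing_matching (hk : 3 ≤ k) (hn : Fintype.card V = k * m)
    (hK : ∀ e ∈ H, e.card = k) (hcov : ∀ v, Supported H {v})
    (hD : ∀ P, Supported H P → P.card < k → (nonExt H P).card < m)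
    (hA : ∀ a ∈ A, 3 * m ≤ 4 * (nonExt H {a} ∩ A).card) {d : ℕ} (hA1 : A.card ≤ m + d)
    (hA2 : m ≤ A.card + d) (hd : 100 * k * d ≤ m) (hkm : 100 * k ≤ m) :
    ∃ M ⊆ H, (M : Set (Finset V)).PairwiseDisjoint id ∧ M.card ≤ d ∧
      (Aᶜ \ M.biUnion id).card = (k - 1) * (A \ M.biUnion id).card := by
  obtain ⟨j, rfl⟩ : ∃ j, k = j + 2 := ⟨k - 2, by omega⟩
  rw [show j + 2 - 1 = j + 1 by omega]
  have hsize : ∀ M ⊆ H, ∀ r : ℕ, (M : Set (Finset V)).PairwiseDisjoint id →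
      (∀ e ∈ M, (e ∩ A).card = r) → (A \ M.biUnion id).card + M.card * r = A.card ∧
      (Aᶜ \ M.biUnion id).card + A.card + M.card * (j + 2) = (j + 2) * m + M.card * r := by
    intro M hMH r hM hr
    have h1 := card_biUnion_inter_of_forall hM hr
    have h2 := card_biUnion_of_forall hM fun e he => hK e (hMH he)
    have h3 := card_sdiff_add_card_inter A (M.biUnion id)
    have h4 := card_sdiff_add_card_inter Aᶜ (M.biUnion id)
    have h5 := card_sdiff_add_card_inter (M.biUnion id) A
    rw [inter_comm] at h3 h4
    rw [← sdiff_eq_inter_compl] at h4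
    have h6 := card_add_card_compl A
    rw [hn] at h6
    omega
  rcases le_total m A.card with h | h
  · obtain ⟨t, ht⟩ := Nat.exists_eq_add_of_le h
    have htd : 100 * (j + 2) * t ≤ m := (Nat.mul_le_mul_left _ (by omega)).trans hd
    obtain ⟨M, hME, hM, hMt⟩ := exists_matching_two hk hn hK hcov hD hA ht htd hkm
    have hMH := hME.trans (filter_subset _ _)
    obtain ⟨h1, h2⟩ := hsize M hMH 2 hM fun e he => (mem_filter.1 (hME he)).2
    refine ⟨M, hMH, hM, by omega, ?_⟩
    rw [hMt, ht] at h1 h2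
    nlinarith
  · obtain ⟨t, ht⟩ := Nat.exists_eq_add_of_le h
    have htd : 100 * (j + 2) * t ≤ m := (Nat.mul_le_mul_left _ (by omega)).trans hd
    obtain ⟨M, hME, hM, hMt⟩ := exists_matching_zero hk hn hK hcov hD hA ht.symm htd hkm
    have hMH := hME.trans (filter_subset _ _)
    obtain ⟨h1, h2⟩ := hsize M hMH 0 hM fun e he => (mem_filter.1 (hME he)).2
    refine ⟨M, hMH, hM, by omega, ?_⟩
    rw [hMt] at h1 h2
    nlinarith

end Balancing

/-- If nearly all pairs in a set `S` of `|V| / k` vertices are unsupported, there is a perfect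
matching. -/
theorem exists_perfectMatching_of_sparse {k m N : ℕ} {H : Finset (Finset V)} (hk : 3 ≤ k)
    (hN : 200 * (k * k) ≤ N) (hNm : N ≤ m) (hn : Fintype.card V = k * m)
    (hK : ∀ e ∈ H, e.card = k) (hcov : ∀ v, Supported H {v})
    (hD : ∀ P, Supported H P → P.card < k → (nonExt H P).card < m)
    {S : Finset V} (hS : S.card = m) (hq : N ^ 2 * ∑ v ∈ S, (S \ nonExt H {v}).card ≤ m ^ 2) :
    ∃ M, IsPerfectMatching H M := by
  have hkk : 3 * k ≤ k * k := Nat.mul_le_mul_right _ hk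
  set q := ∑ v ∈ S, (S \ nonExt H {v}).card with hqdef
  set d := m / N with hd
  have hN0 : 0 < N := by omega
  have hm0 : 0 < m := by omega
  have hd1 : 1 ≤ d := (Nat.one_le_div_iff hN0).2 hNm
  have hNd : N * d ≤ m := Nat.mul_div_le m N
  have hkd : 200 * (k * k * d) ≤ m := by
    calc 200 * (k * k * d) = 200 * (k * k) * d := by ring
      _ ≤ N * d := Nat.mul_le_mul_right _ hN
      _ ≤ m := hNd
  have hkkd : 3 * (k * d) ≤ k * k * d := by
    rw [← mul_assoc]; exact Nat.mul_le_mul_right _ hkk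
  have hkd3 : 3 * d ≤ k * d := Nat.mul_le_mul_right _ hk
  -- a set whose members each contribute more than `d` to `q` has at most `d` elements
  have few : ∀ (Y : Finset V) (f : V → ℕ), (∀ v ∈ Y, d < f v) → ∑ v ∈ Y, f v ≤ q →
      Y.card ≤ d := by
    intro Y f hf hsum
    rw [hd, Nat.le_div_iff_mul_le hN0]
    have h1 : Y.card * m ≤ ∑ v ∈ Y, N * f v := by
      rw [← smul_eq_mul]
      apply card_nsmul_le_sum
      intro v hv
      exact ((Nat.div_lt_iff_lt_mul hN0).1 (hf v hv)).le.trans_eq (mul_comm _ _)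
    rw [← mul_sum] at h1
    refine Nat.le_of_mul_le_mul_right (c := m) ?_ hm0
    calc Y.card * N * m = N * (Y.card * m) := by ring
      _ ≤ N * (N * q) := Nat.mul_le_mul_left _ (h1.trans (Nat.mul_le_mul_left _ hsum))
      _ = N ^ 2 * q := by ring
      _ ≤ m ^ 2 := hq
      _ = m * m := sq m
  have hsplit : ∀ v, (S \ nonExt H {v}).card + (nonExt H {v} ∩ S).card = m := by
    intro v
    rw [inter_comm, card_sdiff_add_card_inter, hS]
  have hlocal : ∀ P, Supported H P → P.card < k → ∀ a ∈ P,
      (nonExt H P \ S).card ≤ (S \ nonExt H {a}).card := by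
    intro P hP hPk a ha
    have h1 := card_nonExt_sdiff_lt hD hP hPk ha S
    have h2 := hsplit a
    omega
  set X₁ := S.filter fun v => d < (S \ nonExt H {v}).card with hX₁
  set X₂ := Sᶜ.filter fun v => d < (nonExt H {v} ∩ S).card with hX₂
  have hX₁d : X₁.card ≤ d := few X₁ _ (fun v hv => (mem_filter.1 hv).2)
    (sum_le_sum_of_subset (filter_subset _ _))
  have hX₂d : X₂.card ≤ d := by
    refine few X₂ _ (fun v hv => (mem_filter.1 hv).2)
      ((sum_le_sum_of_subset (filter_subset _ _)).trans ?_)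
    have h1 := sum_card_bipartiteAbove_eq_sum_card_bipartiteBelow
      (s := Sᶜ) (t := S) (fun v s => s ∈ nonExt H {v})
    have h2 : ∀ v ∈ Sᶜ, (nonExt H {v} ∩ S).card =
        (S.bipartiteAbove (fun v s => s ∈ nonExt H {v}) v).card := by
      intro v _
      congr 1
      ext s
      rw [mem_inter, mem_bipartiteAbove, and_comm]
    rw [sum_congr rfl h2, h1]
    apply sum_le_sum
    intro s _
    refine le_trans (card_le_card ?_)
      (hlocal {s} (hcov s) (by rw [card_singleton]; omega) s (mem_singleton_self s))
    intro v hv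
    rw [mem_bipartiteBelow] at hv
    exact mem_sdiff.2 ⟨mem_nonExt_singleton_comm.1 hv.2, mem_compl.1 hv.1⟩
  set A := univ.filter fun v => 8 * (S \ nonExt H {v}).card ≤ m with hAdef
  have hSA : S \ A ⊆ X₁ := by
    intro v hv
    simp only [hAdef, mem_sdiff, mem_filter, mem_univ, true_and, hX₁] at hv ⊢
    exact ⟨hv.1, by omega⟩
  have hAS : A \ S ⊆ X₂ := by
    intro v hv
    simp only [hAdef, mem_sdiff, mem_filter, mem_univ, true_and, hX₂, mem_compl] at hv ⊢
    have := hsplit v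
    exact ⟨hv.2, by omega⟩
  have hSAd := (card_le_card hSA).trans hX₁d
  have hASd := (card_le_card hAS).trans hX₂d
  have hA1 : A.card ≤ m + d := by
    have := card_le_card_sdiff_add_card (s := A) (t := S)
    omega
  have hA2 : m ≤ A.card + d := by
    have := card_le_card_sdiff_add_card (s := S) (t := A)
    omega
  have hA : ∀ a ∈ A, 3 * m ≤ 4 * (nonExt H {a} ∩ A).card := by
    intro a ha
    have h1 := (mem_filter.1 ha).2
    have h2 := hsplit a
    have h3 : (nonExt H {a} ∩ S).card ≤ ((nonExt H {a} ∩ A) ∪ (S \ A)).card := by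
      apply card_le_card
      intro x
      simp only [mem_inter, mem_union, mem_sdiff]
      tauto
    have h4 := card_union_le (nonExt H {a} ∩ A) (S \ A)
    omega
  have hB : ∀ b ∉ A, m < 16 * (A \ nonExt H {b}).card := by
    intro b hb
    have h1 : m < 8 * (S \ nonExt H {b}).card := by simpa [hAdef] using hb
    have h3 : (S \ nonExt H {b}).card ≤ ((A \ nonExt H {b}) ∪ (S \ A)).card := by
      apply card_le_card
      intro x
      simp only [mem_union, mem_sdiff]
      tauto
    have h4 := card_union_le (A \ nonExt H {b}) (S \ A)
    omega
  obtain ⟨M₁, hM₁H, hM₁, hM₁d, hM₁b⟩ := exists_balancing_matching hk hn hK hcov hD hA hA1 hA2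
    (by rw [mul_assoc]; omega) (by omega)
  have hAc : Aᶜ.card = k * m - A.card := by rw [card_compl, hn]
  have hkm3 : 3 * m ≤ k * m := Nat.mul_le_mul_right _ hk
  have hXc : (X₁ ∪ X₂).card ≤ 2 * d := (card_union_le _ _).trans (by omega)
  have hUle : (M₁.card + (X₁ ∪ X₂).card) * k ≤ 3 * (k * d) := by
    calc _ ≤ (3 * d) * k := Nat.mul_le_mul_right _ (by omega)
      _ = _ := by ring
  obtain ⟨M₂, hM₂H, hM₂, hXM₂, hM₂d, hM₂b⟩ := exists_matching_covering hK hM₁H hM₁ hM₁b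
    (X₁ ∪ X₂) (by
      intro U hU x hx
      obtain ⟨P, a, haA, haP, hxP, hP, hP2, hPA, hPU⟩ : ∃ P a, a ∈ A ∧ a ∈ P ∧ x ∈ P ∧
          Supported H P ∧ P.card ≤ 2 ∧ P ∩ A = {a} ∧ Disjoint P U := by
        by_cases hxA : x ∈ A
        · refine ⟨{x}, x, hxA, mem_singleton_self x, mem_singleton_self x, hcov x, by simp, ?_, ?_⟩
          · exact inter_eq_left.2 (singleton_subset_iff.2 hxA)
          · exact disjoint_singleton_left.2 hx
        · have h1 := hB x hxA
          obtain ⟨a, ha, haU⟩ := exists_mem_notMem_of_card_lt_card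
            (show U.card < (A \ nonExt H {x}).card by omega)
          rw [mem_sdiff, mem_nonExt, not_not] at ha
          refine ⟨{a, x}, a, ha.1, by simp, by simp, ha.2, card_le_two, ?_, ?_⟩
          · rw [insert_inter_of_mem ha.1, singleton_inter_of_notMem hxA, insert_empty_eq]
          · simp [haU, hx]
      obtain ⟨e, he, hPe, heU⟩ := exists_edge_extending_compl hK hD hA (U := U) (by omega) hP
        (by omega) haP haA
      have hout : ∀ y ∈ e, y ∉ P → y ∉ A ∧ y ∉ U := by
        intro y hy hyP
        simpa using heU (mem_sdiff.2 ⟨hy, hyP⟩)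
      refine ⟨e, he, hPe hxP, disjoint_left.2 fun y hy hyU => ?_, ?_⟩
      · by_cases hyP : y ∈ P
        · exact disjoint_left.1 hPU hyP hyU
        · exact (hout y hy hyP).2 hyU
      · have : e ∩ A = P ∩ A := by
          ext y
          have h1 := hout y
          have h2 := @hPe y
          simp only [mem_inter]
          tauto
        rw [this, hPA, card_singleton])
  set U := M₂.biUnion id with hUdef
  have hUc : U.card ≤ 3 * (k * d) := by
    rw [hUdef, card_biUnion_of_forall hM₂ fun e he => hK e (hM₂H he)]
    exact (Nat.mul_le_mul_right _ hM₂d).trans hUle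
  have : NeZero k := ⟨by omega⟩
  have hcard : Fintype.card (ZMod k) = k := ZMod.card k
  have hA' : ∀ a ∈ A \ U, (S \ nonExt H {a}).card ≤ d := by
    intro a ha
    obtain ⟨haA, haU⟩ := mem_sdiff.1 ha
    by_contra hcon
    apply haU
    by_cases haS : a ∈ S
    · exact hXM₂ (mem_union_left _ (mem_filter.2 ⟨haS, by omega⟩))
    · exact hXM₂ (mem_union_right _ (hAS (mem_sdiff.2 ⟨haA, haS⟩)))
  have hA'S : A \ U ⊆ S := by
    intro a ha
    obtain ⟨haA, haU⟩ := mem_sdiff.1 ha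
    by_contra haS
    exact haU (hXM₂ (mem_union_right _ (hAS (mem_sdiff.2 ⟨haA, haS⟩))))
  have hB'S : ∀ b ∈ Aᶜ \ U, b ∉ S := by
    intro b hb hbS
    obtain ⟨hbA, hbU⟩ := mem_sdiff.1 hb
    exact hbU (hXM₂ (mem_union_left _ (hSA (mem_sdiff.2 ⟨hbS, mem_compl.1 hbA⟩))))
  obtain ⟨M₃, hM₃H, hM₃, hM₃U⟩ := exists_matching_of_dense (I := ZMod k) (d := d)
    (A := A \ U) (B := Aᶜ \ U) (H := H) (by omega) (by rwa [hcard]) hcov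
    (Disjoint.mono sdiff_subset sdiff_subset disjoint_compl_right) rfl
    (by rw [hcard]; exact hM₂b)
    (by
      rw [hcard]
      rintro P hP hPk ⟨a, ha⟩
      obtain ⟨haP, haA⟩ := mem_inter.1 ha
      refine (card_le_card ?_).trans ((hlocal P hP hPk a haP).trans (hA' a haA))
      intro x hx
      obtain ⟨hxP, hxB⟩ := mem_inter.1 hx
      exact mem_sdiff.2 ⟨hxP, hB'S x hxB⟩)
    (by
      intro b hb
      refine (card_le_card (inter_subset_inter_left hA'S)).trans ?_
      by_contra hcon
      refine (mem_sdiff.1 hb).2 (hXM₂ (mem_union_right _ (mem_filter.2 ⟨?_, by omega⟩)))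
      exact mem_compl.2 (hB'S b hb))
    (by
      rw [hcard]
      have h1 := le_card_sdiff U A
      have h2 : k * ((k + 1) * d) + k ^ 2 = k * k * d + k * d + k * k := by ring
      omega)
  refine ⟨M₂ ∪ M₃, union_subset hM₂H hM₃H, ?_, ?_⟩
  · rw [coe_union]
    refine Set.PairwiseDisjoint.union hM₂ hM₃ fun e he f hf _ => ?_
    refine Disjoint.mono (subset_biUnion_of_mem id (mem_coe.1 he))
      (subset_biUnion_of_mem id (mem_coe.1 hf)) ?_
    rw [hM₃U, disjoint_left]
    intro x hx hx'
    rcases mem_union.1 hx' with h | h <;> exact (mem_sdiff.1 h).2 hx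
  · intro v
    have hv : v ∈ U ∪ M₃.biUnion id := by
      rw [hM₃U]
      simp only [mem_union, mem_sdiff, mem_compl]
      tauto
    rcases mem_union.1 hv with h | h
    · obtain ⟨e, he, hve⟩ := mem_biUnion.1 h
      exact ⟨e, mem_union_left _ he, hve⟩
    · obtain ⟨e, he, hve⟩ := mem_biUnion.1 h
      exact ⟨e, mem_union_right _ he, hve⟩

/-- If no edge meets `S` twice, there is a perfect matching. -/
theorem exists_perfectMatching_of_independent {k m : ℕ} {H : Finset (Finset V)} (hk : 3 ≤ k)
    (hn : Fintype.card V = k * m) (hK : ∀ e ∈ H, e.card = k) (hcov : ∀ v, Supported H {v})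
    (hD : ∀ P, Supported H P → P.card < k → (nonExt H P).card < m)
    {S : Finset V} (hS : S.card = m) (hind : ∀ e ∈ H, (e ∩ S).card < 2) :
    ∃ M, IsPerfectMatching H M := by
  have : NeZero k := ⟨by omega⟩
  have hcard : Fintype.card (ZMod k) = k := ZMod.card k
  obtain ⟨M, hMH, hM, hMU⟩ := exists_matching_of_complete (I := ZMod k) (H := H) (A := S)
    (B := Sᶜ) (by rwa [hcard]) hcov disjoint_compl_right hS
    (by rw [hcard, card_compl, hn, hS, Nat.sub_one_mul])
    (by
      rw [hcard]
      rintro P hP hPk ⟨a, ha⟩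
      obtain ⟨haP, haS⟩ := mem_inter.1 ha
      have h1 := card_nonExt_sdiff_lt hD hP hPk haP S
      have h2 : (S.erase a).card ≤ (nonExt H {a} ∩ S).card := by
        apply card_le_card
        intro x hx
        obtain ⟨hxa, hxS⟩ := mem_erase.1 hx
        refine mem_inter.2 ⟨mem_nonExt.2 ?_, hxS⟩
        rintro ⟨e, he, hxe⟩
        have h3 := hind e he
        have h4 : ({x, a} : Finset V) ⊆ e ∩ S :=
          subset_inter hxe (by simp [insert_subset_iff, hxS, haS])
        have h5 := card_le_card h4
        rw [card_pair hxa] at h5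
        omega
      rw [card_erase_of_mem haS, hS] at h2
      have h6 : nonExt H P \ S = ∅ := card_eq_zero.1 (by omega)
      rw [disjoint_iff_inter_eq_empty, ← sdiff_eq_inter_compl, h6])
  refine ⟨M, hMH, hM, fun v => ?_⟩
  have hv : v ∈ M.biUnion id := by rw [hMU]; simp
  simpa using hv

/-- Summing supported neighbours within `S` counts each vertex and each supported ordered pair. -/
theorem sum_card_sdiff_nonExt_eq {H : Finset (Finset V)} (hcov : ∀ v, Supported H {v})
    (S : Finset V) : ∑ v ∈ S, (S \ nonExt H {v}).card =
      S.card + (S.offDiag.filter fun x => Supported H {x.1, x.2}).card := by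
  have h1 : (S.offDiag.filter fun x => Supported H {x.1, x.2}).card =
      ∑ v ∈ S, ((S \ nonExt H {v}).erase v).card := by
    rw [← card_sigma]
    refine card_bij (fun x _ => ⟨x.2, x.1⟩) ?_ ?_ ?_
    · rintro ⟨u, v⟩ hx
      simp only [mem_filter, mem_offDiag] at hx
      simp [mem_nonExt, hx]
    · rintro ⟨u, v⟩ _ ⟨u', v'⟩ _ h
      simp only [Sigma.mk.injEq, heq_eq_eq] at h
      simp [h]
    · rintro ⟨v, u⟩ hx
      simp only [mem_sigma, mem_erase, mem_sdiff, mem_nonExt, not_not] at hx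
      exact ⟨(u, v), by simp [hx], rfl⟩
  rw [h1, card_eq_sum_ones, ← sum_add_distrib]
  apply sum_congr rfl
  intro v hv
  have hvm : v ∈ S \ nonExt H {v} := by
    rw [mem_sdiff, mem_nonExt, not_not]
    exact ⟨hv, by simpa using hcov v⟩
  rw [add_comm, card_erase_add_one hvm]

theorem stmt7 (k : ℕ) (hk : 3 ≤ k) :
    ∃ γ : ℝ, 0 < γ ∧ γ < 1 ∧ ∀ n : ℕ, 8 * k < n → k ∣ n →
      ∀ H : Finset (Finset (Fin n)), (∀ e ∈ H, e.card = k) →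
        ((k : ℝ) - 1) / k * n - ((k : ℝ) - 2) ≤ (minPosCodeg k H : ℝ) →
        (∀ v : Fin n, ∃ e ∈ H, v ∈ e) →
        IsExtremal k γ H →
        ∃ M : Finset (Finset (Fin n)), IsPerfectMatching H M := by
  set N := 200 * (k * k) with hN
  set L := k ^ (2 * k) * (2 * N ^ 2) ^ k with hL
  have hN0 : 0 < N := by positivity
  have hL2 : 2 ≤ L := by
    have h1 : 2 * N ^ 2 ≤ (2 * N ^ 2) ^ k := Nat.le_self_pow (by omega) _
    have h2 : 0 < k ^ (2 * k) := by positivity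
    have h3 : 0 < N ^ 2 := by positivity
    nlinarith
  refine ⟨1 / L, by positivity, ?_, ?_⟩
  · rw [div_lt_one (by positivity)]
    exact_mod_cast hL2
  rintro n hn ⟨m, rfl⟩ H hK hdeg hiso ⟨S, hS, hE⟩
  rw [Fintype.card_fin] at hS hE
  rw [Nat.mul_div_cancel_left _ (by omega)] at hS
  have hm : 0 < m := by
    rcases Nat.eq_zero_or_pos m with rfl | h
    · omega
    · exact h
  have hV : Fintype.card (Fin (k * m)) = k * m := Fintype.card_fin _
  have hd : (k - 1) * m ≤ minPosCodeg k H + (k - 2) := by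
    have hk0 : (k : ℝ) ≠ 0 := by positivity
    have h1 : ((k : ℝ) - 1) / k * (k * m : ℕ) = (k - 1) * m := by
      push_cast; field_simp
    rw [h1] at hdeg
    have h2 : (((k - 1) * m : ℕ) : ℝ) ≤ ((minPosCodeg k H + (k - 2) : ℕ) : ℝ) := by
      push_cast [Nat.cast_sub (show 1 ≤ k by omega), Nat.cast_sub (show 2 ≤ k by omega)]
      linarith
    exact_mod_cast h2
  have hcov : ∀ v, Supported H {v} := fun v => by
    obtain ⟨e, he, hv⟩ := hiso v
    exact ⟨e, he, singleton_subset_iff.2 hv⟩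
  have hD : ∀ P, Supported H P → P.card < k → (nonExt H P).card < m :=
    fun P hP hPk => card_nonExt_lt hk hV hK hd hP hPk
  set E := H.filter fun e => 2 ≤ (e ∩ S).card with hEdef
  have hLE : L * E.card ≤ (k * m) ^ k := by
    have h1 : (0 : ℝ) < L := by positivity
    have h2 : (L : ℝ) * E.card ≤ ((k * m : ℕ) : ℝ) ^ k := by
      rw [one_div, ← div_eq_inv_mul, le_div_iff₀ h1] at hE
      linarith
    exact_mod_cast h2
  rcases Nat.eq_zero_or_pos E.card with hE0 | hE0
  · refine exists_perfectMatching_of_independent hk hV hK hcov hD hS fun e he => ?_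
    by_contra hcon
    have : e ∈ E := mem_filter.2 ⟨he, by omega⟩
    rw [card_eq_zero.1 hE0] at this
    simp at this
  have hm2 : 2 * N ^ 2 ≤ m := by
    have h1 : (k ^ 2 * (2 * N ^ 2)) ^ k ≤ (k * m) ^ k := by
      rw [mul_pow, ← pow_mul]
      exact (Nat.le_mul_of_pos_right _ hE0).trans hLE
    have h2 := (Nat.pow_le_pow_iff_left (by omega)).1 h1
    have h3 : k * (k * (2 * N ^ 2)) ≤ k * m := by
      calc _ = k ^ 2 * (2 * N ^ 2) := by ring
        _ ≤ _ := h2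
    exact (Nat.le_mul_of_pos_left _ (by omega)).trans (Nat.le_of_mul_le_mul_left h3 (by omega))
  refine exists_perfectMatching_of_sparse hk hN.ge ?_ hV hK hcov hD hS ?_
  · nlinarith
  rw [sum_card_sdiff_nonExt_eq hcov, hS]
  set F := (S.offDiag.filter fun x => Supported H {x.1, x.2}).card with hF
  have hpairs : F * m ^ (k - 2) ≤ k ^ k * E.card :=
    card_supported_pairs_mul_le hk hm hV hK hD S
  have hF2 : 2 * N ^ 2 * F ≤ m ^ 2 := by
    have hpos : 0 < k ^ (2 * k) * m ^ (k - 2) := by positivity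
    refine le_of_mul_le_mul_left (a := k ^ (2 * k) * m ^ (k - 2)) ?_ hpos
    calc k ^ (2 * k) * m ^ (k - 2) * (2 * N ^ 2 * F)
        = k ^ (2 * k) * (2 * N ^ 2) * (F * m ^ (k - 2)) := by ring
      _ ≤ k ^ (2 * k) * (2 * N ^ 2) ^ k * (k ^ k * E.card) :=
          Nat.mul_le_mul (Nat.mul_le_mul_left _ (Nat.le_self_pow (by omega) _)) hpairs
      _ = k ^ k * (L * E.card) := by rw [hL]; ring
      _ ≤ k ^ k * (k * m) ^ k := Nat.mul_le_mul_left _ hLE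
      _ = k ^ (2 * k) * m ^ k := by rw [mul_pow]; ring
      _ = k ^ (2 * k) * m ^ (k - 2) * m ^ 2 := by
          rw [mul_assoc, ← pow_add, Nat.sub_add_cancel (by omega)]
  have : 2 * N ^ 2 * m ≤ m ^ 2 := by
    rw [sq m]; exact Nat.mul_le_mul_right _ hm2
  nlinarith
end

section
/- Suppose 1/n ≪ β ≪ α, 1/k, and let H be a k-uniform hypergraph on n vertices with δ⁺(H) ≥ n/2 + αn and no isolated vertices. Then there exists a set A ⊆ V(H) with |A| ≤ βn such that for every S ⊆ V(H) \ A with |S| ≤ β²n and |S| divisible by k, the induced subhypergraph H[A ∪ S] contains a perfect matching. -/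
open Finset

variable {V : Type*} [Fintype V] [DecidableEq V]

/-- The minimum positive codegree bounds from below the number of one-vertex extensions of any
set of fewer than `k` vertices contained in an edge. -/
lemma minPosCodeg_le_card_extensions {k : ℕ} {H : Finset (Finset V)} (hH : ∀ e ∈ H, e.card = k)
    {B : Finset V} (hB : B.card < k) (hBe : ∃ e ∈ H, B ⊆ e) :
    minPosCodeg k H ≤ (univ.filter fun x => x ∉ B ∧ ∃ e ∈ H, insert x B ⊆ e).card := by
  obtain ⟨e, he, hBe⟩ := hBe
  obtain ⟨K, hBK, hKe, hK⟩ := exists_subsuperset_card_eq hBe (Nat.le_pred_of_lt hB)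
    (by rw [hH e he]; exact Nat.pred_le k)
  have hK' : K.card = k - 1 := hK
  have hpos : 0 < deg H K := card_pos.mpr ⟨e, by simp [he, hKe]⟩
  calc minPosCodeg k H ≤ deg H K := Nat.sInf_le ⟨K, hK', hpos, rfl⟩
    _ ≤ ((univ.filter fun x => x ∉ B ∧ ∃ e ∈ H, insert x B ⊆ e).image (insert · K)).card := by
      refine card_le_card fun f hf => ?_
      obtain ⟨hfH, hKf⟩ := mem_filter.mp hf
      have hfk := hH f hfH
      obtain ⟨x, hxf, hxK⟩ := exists_mem_notMem_of_card_lt_card (s := K) (t := f) (by omega)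
      have hins : insert x K ⊆ f := insert_subset hxf hKf
      refine mem_image.mpr ⟨x, mem_filter.mpr ⟨mem_univ _, fun h => hxK (hBK h), f, hfH,
        (insert_subset_insert x hBK).trans hins⟩, eq_of_subset_of_card_le hins ?_⟩
      rw [card_insert_of_notMem hxK]
      omega
    _ ≤ _ := card_image_le

/-- A set of vertices is matchable if it is the vertex set of a matching in `H`. -/
def Matchable (H : Finset (Finset V)) (X : Finset V) : Prop :=
  ∃ M ⊆ H, (M : Set (Finset V)).PairwiseDisjoint id ∧ M.biUnion id = X

lemma matchable_empty {ι : Type*} [DecidableEq ι] (H : Finset (Finset ι)) : Matchable H ∅ :=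
  ⟨∅, empty_subset _, by simp, by simp⟩

lemma matchable_of_mem {ι : Type*} [DecidableEq ι] {H : Finset (Finset ι)} {e : Finset ι}
    (he : e ∈ H) : Matchable H e :=
  ⟨{e}, by simpa using he, by simp, by simp⟩

lemma Matchable.union {ι : Type*} [DecidableEq ι] {H : Finset (Finset ι)} {X Y : Finset ι}
    (hX : Matchable H X)
    (hY : Matchable H Y) (hXY : Disjoint X Y) : Matchable H (X ∪ Y) := by
  obtain ⟨M, hM, hMd, rfl⟩ := hX
  obtain ⟨N, hN, hNd, rfl⟩ := hY
  refine ⟨M ∪ N, union_subset hM hN, ?_, union_biUnion⟩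
  rw [coe_union, Set.pairwiseDisjoint_union]
  refine ⟨hMd, hNd, fun e he f hf _ => ?_⟩
  exact hXY.mono (subset_biUnion_of_mem id he) (subset_biUnion_of_mem id hf)

open Classical in
/-- `Many d m Q` means that there are at least `d` choices of a first vertex, for each of which
there are at least `d` choices of a second one, and so on, such that the set of the `m` chosen
vertices satisfies `Q`. -/
def Many (d : ℝ) : ℕ → (Finset V → Prop) → Prop
  | 0, Q => Q ∅
  | m + 1, Q => d ≤ (univ.filter fun x => Many d m fun T => Q (insert x T)).card

lemma Many.succ {d : ℝ} {m : ℕ} {Q : Finset V → Prop} (N : Finset V) (hN : d ≤ N.card)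
    (h : ∀ x ∈ N, Many d m fun T => Q (insert x T)) : Many d (m + 1) Q := by
  classical
  exact hN.trans (Nat.cast_le.mpr (card_le_card fun x hx => mem_filter.mpr ⟨mem_univ _, h x hx⟩))

lemma Many.mono {d : ℝ} {m : ℕ} {Q Q' : Finset V → Prop} (h : Many d m Q)
    (hQ : ∀ T, Q T → Q' T) : Many d m Q' := by
  induction m generalizing Q Q' with
  | zero => exact hQ _ h
  | succ m ih =>
    refine le_trans (show d ≤ _ from h) ?_
    gcongr with x
    exact fun hx => ih hx fun T => hQ _

lemma Many.add {d : ℝ} {a b : ℕ} {Q : Finset V → Prop}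
    (h : Many d a fun T => Many d b fun T' => Q (T ∪ T')) : Many d (a + b) Q := by
  induction a generalizing Q with
  | zero => simpa [Many] using h
  | succ a ih =>
    rw [Nat.succ_add]
    refine le_trans (show d ≤ _ from h) ?_
    gcongr with x
    exact fun hx => ih (hx.mono fun T hT => hT.mono fun T' => by rw [insert_union]; exact id)

open Classical in
lemma Many.pow_le_card {d : ℝ} (hd : 0 ≤ d) {m : ℕ} {Q : Finset V → Prop} (h : Many d m Q) :
    d ^ m ≤ (univ.filter fun f : Fin m → V => Q (univ.image f)).card := by
  induction m generalizing Q with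
  | zero =>
    have : Q ∅ := h
    simp [this]
  | succ m ih =>
    set G : Finset V := univ.filter fun x => Many d m fun T => Q (insert x T)
    have hG : d ≤ G.card := h
    calc d ^ (m + 1) = d * d ^ m := by ring
      _ ≤ ∑ x ∈ G, d ^ m := by
        rw [sum_const, nsmul_eq_mul]
        gcongr
      _ ≤ ∑ x ∈ G, ((univ.filter fun f : Fin m → V => Q (insert x (univ.image f))).card : ℝ) :=
        sum_le_sum fun x hx => by
          have hx' : Many d m fun T => Q (insert x T) := (mem_filter.mp hx).2
          exact ih (Q := fun T => Q (insert x T)) hx'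
      _ = ((G.sigma fun x => univ.filter fun f : Fin m → V =>
          Q (insert x (univ.image f))).card : ℝ) := by
        rw [card_sigma]
        push_cast
        rfl
      _ ≤ _ := by
        norm_cast
        refine card_le_card_of_injOn (fun p => Fin.cons p.1 p.2) ?_ ?_
        · rintro ⟨x, f⟩ hp
          have hp' := (mem_filter.mp (mem_sigma.mp hp).2).2
          refine mem_filter.mpr ⟨mem_univ _, ?_⟩
          convert hp' using 1
          ext y
          simp [Fin.exists_fin_succ, eq_comm]
        · rintro ⟨x, f⟩ - ⟨y, g⟩ - hfg
          obtain ⟨rfl, rfl⟩ := Fin.cons_inj.mp hfg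
          rfl

/-- Every set of fewer than `k` vertices contained in an edge of `H` extends by more than half of
the vertices, with excess `d`, to a set contained in an edge. -/
def HasExtensions (k : ℕ) (H : Finset (Finset V)) (d : ℝ) : Prop :=
  ∀ B : Finset V, B.card < k → (∃ e ∈ H, B ⊆ e) →
    (Fintype.card V : ℝ) / 2 + d ≤
      (univ.filter fun x => x ∉ B ∧ ∃ e ∈ H, insert x B ⊆ e).card

lemma HasExtensions.many_link_aux {k : ℕ} {H : Finset (Finset V)} {d : ℝ}
    (hext : HasExtensions k H d) (hH : ∀ e ∈ H, e.card = k) {W : Finset V} (hW : (W.card : ℝ) ≤ d)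
    (r : ℕ) {X Y : Finset V} (hX : X.card + r = k) (hY : Y.card + r = k)
    (hXe : ∃ e ∈ H, X ⊆ e) (hYe : ∃ e ∈ H, Y ⊆ e) :
    Many d r fun T => Disjoint T W ∧ T ∪ X ∈ H ∧ T ∪ Y ∈ H := by
  induction r generalizing X Y with
  | zero =>
    have key : ∀ Z : Finset V, Z.card + 0 = k → (∃ e ∈ H, Z ⊆ e) → Z ∈ H := by
      rintro Z hZ ⟨e, he, hZe⟩
      rwa [eq_of_subset_of_card_le hZe (by rw [hH e he]; omega)]
    exact ⟨disjoint_empty_left _, by simpa using key X hX hXe, by simpa using key Y hY hYe⟩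
  | succ r ih =>
    set N : Finset V → Finset V := fun B =>
      univ.filter fun x => x ∉ B ∧ ∃ e ∈ H, insert x B ⊆ e with hN
    have h1 : (Fintype.card V : ℝ) / 2 + d ≤ (N X).card := hext X (by omega) hXe
    have h2 : (Fintype.card V : ℝ) / 2 + d ≤ (N Y).card := hext Y (by omega) hYe
    have h3 : ((N X ∪ N Y).card : ℝ) + (N X ∩ N Y).card = (N X).card + (N Y).card := by
      exact_mod_cast card_union_add_card_inter (N X) (N Y)
    have h4 : ((N X ∪ N Y).card : ℝ) ≤ Fintype.card V := by exact_mod_cast card_le_univ _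
    have h5 : ((N X ∩ N Y).card : ℝ) ≤ ((N X ∩ N Y) \ W).card + W.card := by
      exact_mod_cast card_le_card_sdiff_add_card
    have h6 : d ≤ ((N X ∩ N Y) \ W).card := by linarith
    refine Many.succ _ h6 fun x hx => ?_
    simp only [hN, mem_sdiff, mem_inter, mem_filter, mem_univ, true_and] at hx
    obtain ⟨⟨⟨hxX, hxXe⟩, hxY, hxYe⟩, hxW⟩ := hx
    refine (ih (X := insert x X) (Y := insert x Y)
      (by rw [card_insert_of_notMem hxX]; omega) (by rw [card_insert_of_notMem hxY]; omega)
      hxXe hxYe).mono ?_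
    rintro T ⟨hT, hTX, hTY⟩
    refine ⟨disjoint_insert_left.mpr ⟨hxW, hT⟩, ?_, ?_⟩
    · rwa [insert_union, ← union_insert]
    · rwa [insert_union, ← union_insert]

/-- Any two vertices have many common sets in their links. -/
lemma HasExtensions.many_link {k : ℕ} {H : Finset (Finset V)} {d : ℝ} (hk : 0 < k)
    (hext : HasExtensions k H d) (hH : ∀ e ∈ H, e.card = k) (hiso : ∀ v, ∃ e ∈ H, v ∈ e)
    {W : Finset V} (hW : (W.card : ℝ) ≤ d) (u v : V) :
    Many d (k - 1) fun T => Disjoint T W ∧ T ∪ {u} ∈ H ∧ T ∪ {v} ∈ H :=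
  hext.many_link_aux hH hW (k - 1) (by rw [card_singleton]; omega)
    (by rw [card_singleton]; omega) (by simpa using hiso u) (by simpa using hiso v)

lemma HasExtensions.many_switch {k : ℕ} {H : Finset (Finset V)} {d : ℝ} (hk : 0 < k)
    (hext : HasExtensions k H d) (hH : ∀ e ∈ H, e.card = k) (hiso : ∀ v, ∃ e ∈ H, v ∈ e)
    (j : ℕ) {X Y W : Finset V} (hX : X.card = j) (hY : Y.card = j) (hXW : X ⊆ W) (hYW : Y ⊆ W)
    (hW : (W.card : ℝ) + k * j ≤ d) :
    Many d (j * (k - 1)) fun T =>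
      Disjoint T W ∧ Matchable H (T ∪ X) ∧ Matchable H (T ∪ Y) := by
  induction j generalizing X Y W with
  | zero =>
    obtain rfl := card_eq_zero.mp hX
    obtain rfl := card_eq_zero.mp hY
    rw [zero_mul]
    exact ⟨disjoint_empty_left _, by simpa using matchable_empty H,
      by simpa using matchable_empty H⟩
  | succ j ih =>
    obtain ⟨x, X, hxX, rfl, hX'⟩ := card_eq_succ.mp hX
    obtain ⟨y, Y, hyY, rfl, hY'⟩ := card_eq_succ.mp hY
    obtain ⟨hxW, hXW⟩ := insert_subset_iff.mp hXW
    obtain ⟨hyW, hYW⟩ := insert_subset_iff.mp hYW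
    push_cast at hW
    have hWd : (W.card : ℝ) ≤ d := by
      have : (0 : ℝ) ≤ k * (j + 1) := by positivity
      linarith
    rw [Nat.succ_mul, Nat.add_comm]
    refine Many.add ((hext.many_link hk hH hiso hWd x y).mono ?_)
    rintro T ⟨hTW, hTx, hTy⟩
    have hT : (T.card : ℝ) ≤ k := by
      rw [← hH _ hTx]
      exact_mod_cast card_le_card subset_union_left
    have hWT : ((W ∪ T).card : ℝ) ≤ W.card + T.card := by exact_mod_cast card_union_le W T
    refine (ih (W := W ∪ T) hX' hY' (hXW.trans subset_union_left)
      (hYW.trans subset_union_left) (by linarith)).mono ?_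
    rintro T' ⟨hT', hTX, hTY⟩
    rw [disjoint_union_right] at hT'
    have key : ∀ {z : V} {Z : Finset V}, z ∈ W → z ∉ Z → Z ⊆ W → T ∪ {z} ∈ H →
        Matchable H (T' ∪ Z) → Matchable H (T ∪ T' ∪ insert z Z) := by
      intro z Z hzW hzZ hZW hz hZ
      have hdisj : Disjoint (T ∪ {z}) (T' ∪ Z) := by
        simp only [disjoint_union_left, disjoint_union_right, disjoint_singleton_left]
        exact ⟨⟨hT'.2.symm, fun h => disjoint_left.mp hT'.1 h hzW⟩, hTW.mono_right hZW, hzZ⟩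
      convert (matchable_of_mem hz).union hZ hdisj using 1
      ext a
      simp only [mem_union, mem_insert, mem_singleton]
      tauto
    exact ⟨disjoint_union_left.mpr ⟨hTW, hT'.1⟩, key hxW hxX hXW hTx hTX, key hyW hyY hYW hTy hTY⟩

/-- `T` absorbs `S` if both `T` and `T ∪ S` are matchable. -/
def AbsorbsSet (H : Finset (Finset V)) (S T : Finset V) : Prop :=
  Matchable H T ∧ Matchable H (T ∪ S)

lemma HasExtensions.many_absorbs {k : ℕ} {H : Finset (Finset V)} {d : ℝ} (hk : 0 < k)
    (hext : HasExtensions k H d) (hH : ∀ e ∈ H, e.card = k) (hiso : ∀ v, ∃ e ∈ H, v ∈ e)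
    {S U : Finset V} (hS : S.card = k) (hU : (U.card : ℝ) + 2 * k + k * k ≤ d)
    (hd : 2 * d ≤ Fintype.card V) :
    Many d (k * k) fun T => AbsorbsSet H S T ∧ Disjoint T U := by
  set W := U ∪ S with hWdef
  have hW : (W.card : ℝ) ≤ U.card + k := by
    rw [← hS]
    exact_mod_cast card_union_le U S
  have hkpos : (0 : ℝ) < k := by exact_mod_cast hk
  have hWd : (W.card : ℝ) ≤ d := by nlinarith
  have hedge : Many d (1 + (k - 1)) fun E => Disjoint E W ∧ E ∈ H := by
    refine Many.add ?_
    have hcompl : ((univ \ W).card : ℝ) + W.card = Fintype.card V := by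
      exact_mod_cast card_sdiff_add_card_eq_card (subset_univ W)
    refine Many.succ (univ \ W) (by linarith) fun x hx => ?_
    refine (hext.many_link hk hH hiso hWd x x).mono ?_
    rintro T ⟨hTW, hTx, -⟩
    have hxW : x ∉ W := (mem_sdiff.mp hx).2
    exact ⟨by simp [hxW, hTW], by simpa [union_comm] using hTx⟩
  have hkk : k * k = (1 + (k - 1)) + k * (k - 1) := by
    obtain ⟨k, rfl⟩ := Nat.exists_eq_succ_of_ne_zero hk.ne'
    simp only [Nat.succ_eq_add_one, Nat.add_sub_cancel]
    ring
  rw [hkk]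
  refine Many.add (hedge.mono ?_)
  rintro E ⟨hEW, hE⟩
  have hWE : ((W ∪ E).card : ℝ) ≤ W.card + k := by
    rw [← hH E hE]
    exact_mod_cast card_union_le W E
  refine (hext.many_switch hk hH hiso k (W := W ∪ E) hS (hH E hE)
    (subset_union_right.trans subset_union_left) subset_union_right (by linarith)).mono ?_
  rintro T ⟨hT, hTS, hTE⟩
  simp only [hWdef, disjoint_union_left, disjoint_union_right] at hT hEW ⊢
  refine ⟨⟨by rwa [union_comm], ?_⟩, hEW.1, hT.1.1⟩
  rw [union_assoc]
  exact (matchable_of_mem hE).union hTS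
    (disjoint_union_right.mpr ⟨hT.2.symm, hEW.2⟩)

open Classical in
/-- Greedy selection of disjoint sets: if every index `i` is related to a positive proportion of
the `m`-tuples avoiding any given small set, then the tuples can be selected one after the other
such that the sum of the weights `2⁻ʰ`, with `h` the number of selected sets related to `i`,
decreases geometrically. -/
lemma exists_disjoint_family {ι : Type*} {s : Finset ι} (hs : s.Nonempty)
    {R : ι → Finset V → Prop} {m t : ℕ} (hm : 0 < m) {c : ℝ} (hc : 0 < c)
    (hR : ∀ U : Finset V, U.card ≤ m * t → ∀ i ∈ s, c * (Fintype.card V : ℝ) ^ m ≤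
      (univ.filter fun f : Fin m → V => R i (univ.image f) ∧ Disjoint (univ.image f) U).card)
    (hV : 0 < Fintype.card V) (j : ℕ) (hj : j ≤ t) :
    ∃ F : Finset (Finset V), (F.biUnion id).card ≤ m * j ∧
      (F : Set (Finset V)).PairwiseDisjoint id ∧ (∀ T ∈ F, ∃ i ∈ s, R i T) ∧
      ∑ i ∈ s, (1 / 2 : ℝ) ^ (F.filter (R i)).card ≤ (1 - c / 2) ^ j * s.card := by
  induction j with
  | zero => exact ⟨∅, by simp, by simp, by simp, by simp⟩
  | succ j ih =>
    obtain ⟨F, hFc, hFd, hFR, hF⟩ := ih (by omega)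
    set U := F.biUnion id
    set w : ι → ℝ := fun i => (1 / 2 : ℝ) ^ (F.filter (R i)).card with hw
    have hw0 : ∀ i, 0 ≤ w i := fun i => by positivity
    set L : ι → Finset (Fin m → V) := fun i =>
      univ.filter fun f => R i (univ.image f) ∧ Disjoint (univ.image f) U with hL
    have hLc : ∀ i ∈ s, c * (Fintype.card V : ℝ) ^ m ≤ (L i).card :=
      hR U (hFc.trans (Nat.mul_le_mul_left m (by omega)))
    set P : Finset (Fin m → V) := s.biUnion L
    have hPc : (P.card : ℝ) ≤ (Fintype.card V : ℝ) ^ m := by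
      have := card_le_univ P
      rw [Fintype.card_fun, Fintype.card_fin] at this
      exact_mod_cast this
    have hV' : (0 : ℝ) < Fintype.card V := by exact_mod_cast hV
    have hPne : P.Nonempty := by
      obtain ⟨i, hi⟩ := hs
      have hpos : (0 : ℝ) < (L i).card := lt_of_lt_of_le (by positivity) (hLc i hi)
      exact (card_pos.mp (by exact_mod_cast hpos)).mono (subset_biUnion_of_mem L hi)
    have hLP : ∀ i ∈ s, L i ⊆ P := fun i hi => subset_biUnion_of_mem L hi
    have hcP : ∀ i ∈ s, c * P.card ≤ (L i).card := fun i hi =>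
      (mul_le_mul_of_nonneg_left hPc hc.le).trans (hLc i hi)
    have hc2 : 0 ≤ 1 - c / 2 := by
      obtain ⟨i, hi⟩ := hs
      have h1 : c * P.card ≤ 1 * P.card := by
        rw [one_mul]
        exact (hcP i hi).trans (Nat.cast_le.mpr (card_le_card (hLP i hi)))
      have := le_of_mul_le_mul_right h1 (Nat.cast_pos.mpr hPne.card_pos)
      linarith
    have hsum : ∑ f ∈ P, ∑ i ∈ s, w i * (1 - if f ∈ L i then 1 / 2 else 0) ≤
        ∑ f ∈ P, (1 - c / 2) * ∑ i ∈ s, w i := by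
      simp only [mul_sum]
      rw [sum_comm, sum_comm (s := P)]
      refine sum_le_sum fun i hi => ?_
      rw [← mul_sum, sum_sub_distrib, sum_ite_mem, inter_eq_right.mpr (hLP i hi), sum_const,
        sum_const, sum_const, nsmul_eq_mul, nsmul_eq_mul, nsmul_eq_mul]
      have := mul_le_mul_of_nonneg_left (hcP i hi) (hw0 i)
      linarith
    obtain ⟨f, hfP, hf⟩ := exists_le_of_sum_le hPne hsum
    obtain ⟨i₀, hi₀, hfi₀⟩ := mem_biUnion.mp hfP
    obtain ⟨hRf, hfU⟩ := (mem_filter.mp hfi₀).2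
    set T : Finset V := univ.image f with hT
    have hTne : T.Nonempty := ⟨f ⟨0, hm⟩, by simp [hT]⟩
    have hTF : T ∉ F := fun h =>
      hTne.ne_empty (disjoint_self.mp (hfU.mono_right (subset_biUnion_of_mem id h)))
    refine ⟨insert T F, ?_, ?_, ?_, ?_⟩
    · rw [biUnion_insert]
      refine (card_union_le _ _).trans ?_
      have hTc : T.card ≤ m := by simpa using card_image_le (s := univ) (f := f)
      rw [Nat.mul_succ, Nat.add_comm]
      exact Nat.add_le_add hFc hTc
    · rw [coe_insert]
      exact hFd.insert fun T' hT' _ => hfU.mono_right (subset_biUnion_of_mem id hT')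
    · intro T' hT'
      obtain rfl | hT' := mem_insert.mp hT'
      exacts [⟨i₀, hi₀, hRf⟩, hFR T' hT']
    · calc ∑ i ∈ s, (1 / 2 : ℝ) ^ ((insert T F).filter (R i)).card
          = ∑ i ∈ s, w i * (1 - if f ∈ L i then 1 / 2 else 0) := by
            refine sum_congr rfl fun i _ => ?_
            have hiff : f ∈ L i ↔ R i T := by simp [hL, hfU, ← hT]
            rw [filter_insert]
            by_cases h : R i T
            · rw [if_pos h, if_pos (hiff.mpr h), card_insert_of_notMem (by simp [hTF]), pow_succ]
              simp only [hw]
              norm_num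
            · rw [if_neg h, if_neg (mt hiff.mp h)]
              simp [hw]
        _ ≤ (1 - c / 2) * ∑ i ∈ s, w i := hf
        _ ≤ (1 - c / 2) * ((1 - c / 2) ^ j * s.card) := by gcongr
        _ = (1 - c / 2) ^ (j + 1) * s.card := by ring

open Classical in
/-- A family of disjoint matchable sets absorbs any set of `k * q` further vertices, provided every
`k`-set is absorbed by at least `q` members. -/
lemma matchable_biUnion_union {ι : Type*} [DecidableEq ι] {k : ℕ} {H : Finset (Finset ι)}
    (q : ℕ) {F : Finset (Finset ι)}
    (hFd : (F : Set (Finset ι)).PairwiseDisjoint id) (hF : ∀ T ∈ F, Matchable H T)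
    (hq : ∀ S : Finset ι, S.card = k → q ≤ (F.filter (AbsorbsSet H S)).card)
    {S : Finset ι} (hS : S.card = k * q) (hSF : Disjoint S (F.biUnion id)) :
    Matchable H (F.biUnion id ∪ S) := by
  induction q generalizing F S with
  | zero =>
    obtain rfl := card_eq_zero.mp hS
    clear hq hSF hS
    rw [union_empty]
    induction F using Finset.induction_on with
    | empty => exact matchable_empty H
    | insert T F hTF ih =>
      rw [coe_insert, Set.pairwiseDisjoint_insert] at hFd
      rw [biUnion_insert]
      refine (hF T (mem_insert_self _ _)).union
        (ih hFd.1 fun T' hT' => hF T' (mem_insert_of_mem hT')) ?_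
      rw [disjoint_biUnion_right]
      exact fun T' hT' => hFd.2 T' hT' fun h => hTF (h ▸ hT')
  | succ q ih =>
    obtain ⟨S₁, hS₁, hS₁c⟩ := exists_subset_card_eq (s := S) (n := k) (by rw [hS]; nlinarith)
    obtain ⟨T, hT⟩ := card_pos.mp (lt_of_lt_of_le (Nat.succ_pos q) (hq S₁ hS₁c))
    obtain ⟨hTF, -, hTS⟩ := mem_filter.mp hT
    have hsplit : F.biUnion id = T ∪ (F.erase T).biUnion id := by
      conv_lhs => rw [← insert_erase hTF]
      rw [biUnion_insert]
      rfl
    have hTd : Disjoint T ((F.erase T).biUnion id) := by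
      rw [disjoint_biUnion_right]
      exact fun T' hT' => hFd hTF (mem_of_mem_erase hT') (ne_of_mem_erase hT').symm
    rw [hsplit, disjoint_union_right] at hSF
    have hrest : Matchable H ((F.erase T).biUnion id ∪ (S \ S₁)) := by
      refine ih (hFd.subset (by simp)) (fun T' hT' => hF T' (mem_of_mem_erase hT')) ?_ ?_ ?_
      · intro S' hS'
        have h1 := hq S' hS'
        have h2 := pred_card_le_card_erase (s := F.filter (AbsorbsSet H S')) (a := T)
        rw [← filter_erase] at h2
        omega
      · rw [card_sdiff_of_subset hS₁, hS, hS₁c, Nat.mul_succ, Nat.add_sub_cancel]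
      · exact hSF.2.mono_left sdiff_subset
    have hdisj : Disjoint (T ∪ S₁) ((F.erase T).biUnion id ∪ (S \ S₁)) := by
      simp only [disjoint_union_left, disjoint_union_right]
      exact ⟨⟨hTd, hSF.2.mono_left hS₁⟩, hSF.1.symm.mono_right sdiff_subset, disjoint_sdiff⟩
    convert hTS.union hrest hdisj using 1
    rw [hsplit]
    conv_lhs => rw [← union_sdiff_of_subset hS₁]
    ext a
    simp only [mem_union]
    tauto

open Filter in
lemma eventually_mul_log_add_lt (a b : ℝ) {ε : ℝ} (hε : 0 < ε) :
    ∀ᶠ n : ℕ in atTop, a * Real.log n + b < ε * n := by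
  have h1 : (fun x : ℝ => a * Real.log x + b) =o[atTop] (id : ℝ → ℝ) :=
    (Real.isLittleO_log_id_atTop.const_mul_left a).add
      (Asymptotics.isLittleO_const_id_atTop b)
  have h2 := (h1.bound (half_pos hε)).and (eventually_gt_atTop 0)
  filter_upwards [tendsto_natCast_atTop_atTop.eventually h2] with n hn
  obtain ⟨hn, hn0⟩ := hn
  rw [id, Real.norm_of_nonneg hn0.le] at hn
  have := (le_abs_self _).trans hn
  nlinarith

lemma half_mul_le_add_log {c : ℝ} (hc : 0 ≤ 1 - c / 2) {h t n k : ℕ} (hn : 0 < n)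
    (hle : (1 / 2 : ℝ) ^ h ≤ (1 - c / 2) ^ t * (n : ℝ) ^ k) :
    c / 2 * t ≤ h + k * Real.log n := by
  have hn' : (0 : ℝ) < n := by exact_mod_cast hn
  have h1 : Real.exp (-1) ≤ 1 / 2 := by
    rw [Real.exp_neg, one_div]
    exact inv_anti₀ two_pos (by linarith [Real.add_one_le_exp 1])
  have h2 : 1 - c / 2 ≤ Real.exp (-(c / 2)) := by linarith [Real.add_one_le_exp (-(c / 2))]
  have key : Real.exp (h * -1) ≤ Real.exp (t * -(c / 2) + k * Real.log n) := by
    calc Real.exp (h * -1) = Real.exp (-1) ^ h := Real.exp_nat_mul _ _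
      _ ≤ (1 / 2) ^ h := by gcongr
      _ ≤ (1 - c / 2) ^ t * (n : ℝ) ^ k := hle
      _ ≤ Real.exp (-(c / 2)) ^ t * (n : ℝ) ^ k := by gcongr
      _ = Real.exp (t * -(c / 2) + k * Real.log n) := by
        rw [Real.exp_add, Real.exp_nat_mul, Real.exp_nat_mul, Real.exp_log hn']
  have := Real.exp_le_exp.mp key
  linarith

theorem stmt9 (k : ℕ) (hk : 0 < k) (α : ℝ) (hα : 0 < α) :
    ∃ β₀ : ℝ, 0 < β₀ ∧ ∀ β : ℝ, 0 < β → β ≤ β₀ →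
      ∃ n₀ : ℕ, ∀ n ≥ n₀,
        ∀ H : Finset (Finset (Fin n)), (∀ e ∈ H, e.card = k) →
          (n : ℝ) / 2 + α * n ≤ (minPosCodeg k H : ℝ) →
          (∀ v : Fin n, ∃ e ∈ H, v ∈ e) →
          ∃ A : Finset (Fin n), (A.card : ℝ) ≤ β * n ∧
            ∀ S : Finset (Fin n), Disjoint S A → (S.card : ℝ) ≤ β ^ 2 * n →
              k ∣ S.card →
              ∃ M ⊆ H, (M : Set (Finset (Fin n))).PairwiseDisjoint id ∧
                (∀ e ∈ M, e ⊆ A ∪ S) ∧ ∀ v ∈ A ∪ S, ∃ e ∈ M, v ∈ e := by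
  classical
  have hk' : (0 : ℝ) < k := by exact_mod_cast hk
  have hm : 0 < k * k := Nat.mul_pos hk hk
  have hm' : (0 : ℝ) < k * k := by positivity
  set c : ℝ := α ^ (k * k) with hc
  have hc0 : 0 < c := by positivity
  refine ⟨min (c / (8 * (k * k))) (α / 2), by positivity, fun β hβ hββ => ?_⟩
  have hβc : β * (8 * (k * k)) ≤ c := (le_div_iff₀ (by positivity)).mp (hββ.trans (min_le_left _ _))
  have hβα : β ≤ α / 2 := hββ.trans (min_le_right _ _)
  obtain ⟨n₀, hn₀⟩ := Filter.eventually_atTop.mp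
    (((eventually_mul_log_add_lt k (c / 2) (ε := c * β / (8 * (k * k))) (by positivity)).and
      (eventually_mul_log_add_lt 0 (2 * k + k * k) (half_pos hα))).and
      (Filter.eventually_gt_atTop 0))
  refine ⟨n₀, fun n hn H hH hδ hiso => ?_⟩
  obtain ⟨⟨hlog, hconst⟩, hn0⟩ := hn₀ n hn
  have hn' : (0 : ℝ) < n := by exact_mod_cast hn0
  have hext : HasExtensions k H (α * n) := fun B hB hBe => by
    rw [Fintype.card_fin]
    exact hδ.trans (Nat.cast_le.mpr (minPosCodeg_le_card_extensions hH hB hBe))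
  obtain ⟨e, he, -⟩ := hiso ⟨0, hn0⟩
  have hkn : k ≤ n := by simpa [hH e he] using card_le_univ e
  have hαn : 2 * (α * n) ≤ n := by
    have h1 := hext ∅ (by simpa using hk) ⟨e, he, empty_subset _⟩
    have h2 := h1.trans (Nat.cast_le.mpr (card_le_univ _))
    rw [Fintype.card_fin] at h2
    linarith
  have hα1 : α ≤ 1 := by nlinarith
  have hc1 : c ≤ 1 := pow_le_one₀ hα.le hα1
  set t : ℕ := ⌊β * n / (k * k)⌋₊ with ht
  have htle : k * k * (t : ℝ) ≤ β * n := by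
    rw [mul_comm]
    exact (le_div_iff₀ hm').mp (Nat.floor_le (by positivity))
  have htge : β * n / (k * k) < t + 1 := Nat.lt_floor_add_one _
  have hs : (powersetCard k (univ : Finset (Fin n))).Nonempty :=
    powersetCard_nonempty.mpr (by simpa using hkn)
  obtain ⟨F, hFc, hFd, hFR, hF⟩ := exists_disjoint_family hs (R := AbsorbsSet H) (t := t) hm hc0
    (fun U hU S hS => by
      have hU' : (U.card : ℝ) ≤ k * k * t := by exact_mod_cast hU
      have hmany := hext.many_absorbs hk hH hiso (U := U) (mem_powersetCard.mp hS).2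
        (by nlinarith) (by simpa using hαn)
      rw [hc, Fintype.card_fin, ← mul_pow]
      convert hmany.pow_le_card (by positivity))
    (by simpa using hn0) t le_rfl
  refine ⟨F.biUnion id, ?_, fun S hSA hSc ⟨q, hq⟩ => ?_⟩
  · refine le_trans ?_ htle
    exact_mod_cast hFc
  have hqS : (q : ℝ) ≤ β ^ 2 * n := by
    refine le_trans (Nat.cast_le.mpr ?_) hSc
    rw [hq]
    exact Nat.le_mul_of_pos_left q hk
  obtain ⟨M, hMH, hMd, hM⟩ := matchable_biUnion_union (k := k) q hFd
    (fun T hT => (hFR T hT).elim fun _ h => h.2.1)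
    (fun S' hS' => by
      by_contra! hlt
      have hlt' : ((F.filter (AbsorbsSet H S')).card : ℝ) ≤ q := by exact_mod_cast hlt.le
      have hchoose : ((powersetCard k (univ : Finset (Fin n))).card : ℝ) ≤ (n : ℝ) ^ k := by
        rw [card_powersetCard, card_univ, Fintype.card_fin]
        exact_mod_cast Nat.choose_le_pow n k
      have hw : (1 / 2 : ℝ) ^ (F.filter (AbsorbsSet H S')).card ≤
          (1 - c / 2) ^ t * (n : ℝ) ^ k := by
        refine le_trans (single_le_sum
          (f := fun i => (1 / 2 : ℝ) ^ (F.filter (AbsorbsSet H i)).card)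
          (fun i _ => by positivity) (mem_powersetCard.mpr ⟨subset_univ S', hS'⟩)) (hF.trans ?_)
        have : 0 ≤ 1 - c / 2 := by linarith
        gcongr
      have h1 := half_mul_le_add_log (by linarith) hn0 hw
      have h2 : β ^ 2 * n ≤ c * β / (8 * (k * k)) * n := by
        gcongr
        rw [le_div_iff₀ (by positivity)]
        nlinarith
      have h3 : c / 2 * (β * n / (k * k)) ≤ c / 2 * (t + 1) := by gcongr
      have h4 : c / 2 * (β * n / (k * k)) = 4 * (c * β / (8 * (k * k)) * n) := by
        field_simp
        ring
      have h5 : 0 < c * β / (8 * (k * k)) * n := by positivity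
      linarith)
    hq hSA
  refine ⟨M, hMH, hMd, fun e he => ?_, fun v hv => ?_⟩
  · rw [← hM]
    exact subset_biUnion_of_mem id he
  · rw [← hM] at hv
    exact mem_biUnion.mp hv
end

section
/- Suppose 1/n ≪ α ≪ γ, 1/k with k dividing n, and let H be a k-uniform hypergraph on n vertices with δ⁺(H) ≥ ((k−1)/k)·n − αn and no isolated vertices. Then either H is γ-extremal or H admits a perfect fractional matching. -/
open Finset

variable {V : Type*} [Fintype V] [DecidableEq V]

/-- `w` is a fractional matching of `H`: nonnegative weights supported on edges,
with total weight at most 1 at each vertex. -/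
def IsFracMatching (H : Finset (Finset V)) (w : Finset V → ℝ) : Prop :=
  (∀ e, 0 ≤ w e) ∧ (∀ e ∉ H, w e = 0) ∧
    ∀ v : V, (∑ e ∈ H.filter fun e => v ∈ e, w e) ≤ 1

/-- `w` is a perfect fractional matching of `H`: nonnegative weights supported on edges,
with total weight exactly 1 at each vertex. -/
def IsPerfFracMatching (H : Finset (Finset V)) (w : Finset V → ℝ) : Prop :=
  (∀ e, 0 ≤ w e) ∧ (∀ e ∉ H, w e = 0) ∧
    ∀ v : V, (∑ e ∈ H.filter fun e => v ∈ e, w e) = 1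

/-- Duality criterion for perfect fractional matchings in uniform hypergraphs. -/
theorem exists_isPerfFracMatching_of_sum_nonneg {V : Type*} [Fintype V] [DecidableEq V]
    [Nonempty V] {k : ℕ} (hk : 0 < k) (H : Finset (Finset V)) (hu : ∀ e ∈ H, e.card = k)
    (h : ∀ y : V → ℝ, (∀ e ∈ H, 0 ≤ ∑ v ∈ e, y v) → 0 ≤ ∑ v, y v) :
    ∃ w : Finset V → ℝ, IsPerfFracMatching H w := by
  classical
  have hk' : (0 : ℝ) < k := by exact_mod_cast hk
  have hn : (0 : ℝ) < Fintype.card V := by exact_mod_cast Fintype.card_pos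
  let L : (H → ℝ) →ₗ[ℝ] (V → ℝ) :=
    ∑ e : H, (LinearMap.proj e).smulRight (fun v => if v ∈ e.1 then (1 : ℝ) else 0)
  have hL (x : H → ℝ) (v : V) : L x v = ∑ e : H, if v ∈ e.1 then x e else 0 := by
    simp [L, LinearMap.sum_apply, Finset.sum_apply]
  have hclosed : IsClosed (L '' stdSimplex ℝ H) :=
    ((isCompact_stdSimplex ℝ H).image L.continuous_of_finiteDimensional).isClosed
  have hconv : Convex ℝ (L '' stdSimplex ℝ H) := (convex_stdSimplex ℝ H).linear_image L
  by_cases ht : (fun _ => (k : ℝ) / Fintype.card V : V → ℝ) ∈ L '' stdSimplex ℝ H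
  · obtain ⟨x, hx, hxt⟩ := ht
    refine ⟨fun e => if he : e ∈ H then Fintype.card V / k * x ⟨e, he⟩ else 0, ?_, ?_, ?_⟩
    · intro e
      dsimp only
      split_ifs with he
      · exact mul_nonneg (by positivity) (hx.1 _)
      · rfl
    · intro e he
      simp [he]
    · intro v
      have h1 := congrFun hxt v
      rw [hL] at h1
      rw [Finset.sum_filter, ← Finset.sum_coe_sort H]
      have h2 : ∀ e : H, (if v ∈ e.1 then
          (if he : e.1 ∈ H then (Fintype.card V : ℝ) / k * x ⟨e.1, he⟩ else 0) else 0) =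
          Fintype.card V / k * (if v ∈ e.1 then x e else 0) := by
        intro e
        simp [e.2]
      rw [Finset.sum_congr rfl fun e _ => h2 e, ← Finset.mul_sum, h1]
      field_simp
  · exfalso
    obtain ⟨f, u, hfu, huf⟩ := geometric_hahn_banach_point_closed hconv hclosed ht
    have hf (x : V → ℝ) : f x = ∑ v, x v * f (Pi.single v 1) := by
      conv_lhs => rw [pi_eq_sum_univ' x]
      simp only [map_sum, map_smul, smul_eq_mul]
    have h1 := h (fun v => f (Pi.single v 1) - u / k) ?_
    · rw [hf, ← Finset.mul_sum] at hfu
      rw [Finset.sum_sub_distrib, Finset.sum_const, Finset.card_univ, nsmul_eq_mul] at h1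
      have h2 : (k : ℝ) / Fintype.card V * (Fintype.card V * (u / k)) = u := by field_simp
      have h3 := mul_le_mul_of_nonneg_left (sub_nonneg.mp h1)
        (by positivity : (0 : ℝ) ≤ (k : ℝ) / Fintype.card V)
      linarith
    · intro e he
      have h2 := huf _ ⟨Pi.single ⟨e, he⟩ 1, single_mem_stdSimplex ℝ _, rfl⟩
      rw [hf] at h2
      have h3 : ∀ v, L (Pi.single ⟨e, he⟩ 1) v = if v ∈ e then 1 else 0 := by
        intro v
        rw [hL, Finset.sum_eq_single ⟨e, he⟩]
        · simp
        · intro b _ hb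
          simp [hb]
        · simp
      simp only [h3, ite_mul, one_mul, zero_mul, Finset.sum_ite_mem, Finset.univ_inter] at h2
      rw [Finset.sum_sub_distrib, Finset.sum_const, hu e he, nsmul_eq_mul,
        mul_div_cancel₀ _ hk'.ne']
      linarith

/-- Nested sets of `p ≤ q` smallest entries of a real tuple, with separating thresholds. -/
theorem exists_nested_sublevel {n : ℕ} (y : Fin n → ℝ) {p q : ℕ} (hp : 0 < p) (hpq : p ≤ q)
    (hq : q ≤ n) :
    ∃ (A B : Finset (Fin n)) (a b : ℝ), A ⊆ B ∧ A.card = p ∧ B.card = q ∧ a ≤ b ∧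
      (∀ v ∈ A, y v ≤ a) ∧ (∀ v ∉ A, a ≤ y v) ∧ (∀ v ∈ B, y v ≤ b) ∧ (∀ v ∉ B, b ≤ y v) := by
  have hm := Tuple.monotone_sort y
  set σ := Tuple.sort y
  have hcard (r : ℕ) (hr : r ≤ n) :
      ((univ.filter fun i : Fin n => i.1 < r).map σ.toEmbedding).card = r := by
    rw [Finset.card_map, Fin.card_filter_val_lt, min_eq_right hr]
  have hmem (r : ℕ) (v : Fin n) :
      v ∈ (univ.filter fun i : Fin n => i.1 < r).map σ.toEmbedding ↔ (σ.symm v).1 < r := by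
    simp [Finset.mem_map_equiv]
  have hle (r : ℕ) (hr0 : 0 < r) (hr : r ≤ n) (v : Fin n) (hv : (σ.symm v).1 < r) :
      y v ≤ y (σ ⟨r - 1, by omega⟩) := by
    have := hm (show σ.symm v ≤ ⟨r - 1, by omega⟩ from Fin.le_def.2 (by simp; omega))
    simpa using this
  have hge (r : ℕ) (hr0 : 0 < r) (hr : r ≤ n) (v : Fin n) (hv : ¬ (σ.symm v).1 < r) :
      y (σ ⟨r - 1, by omega⟩) ≤ y v := by
    have := hm (show ⟨r - 1, by omega⟩ ≤ σ.symm v from Fin.le_def.2 (by simp; omega))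
    simpa using this
  refine ⟨_, _, y (σ ⟨p - 1, by omega⟩), y (σ ⟨q - 1, by omega⟩), ?_, hcard p (by omega),
    hcard q hq, ?_, ?_, ?_, ?_, ?_⟩
  · intro v
    rw [hmem, hmem]
    omega
  · exact hm (Fin.le_def.2 (by simp; omega))
  · exact fun v hv => hle p hp (by omega) v ((hmem p v).1 hv)
  · exact fun v hv => hge p hp (by omega) v (mt (hmem p v).2 hv)
  · exact fun v hv => hle q (by omega) hq v ((hmem q v).1 hv)
  · exact fun v hv => hge q (by omega) hq v (mt (hmem q v).2 hv)

/-- If every vertex of every edge can be exchanged for one in `B`, then an edge containing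
`T ⊆ B` can be moved into `B` while still containing `T`. -/
theorem exists_edge_subset_of_exchange {V : Type*} [DecidableEq V] {H : Finset (Finset V)}
    {B T e : Finset V}
    (hB : ∀ e ∈ H, ∀ u ∈ e, ∃ w ∈ B, w ∉ e.erase u ∧ insert w (e.erase u) ∈ H)
    (hTB : T ⊆ B) (he : e ∈ H) (hTe : T ⊆ e) : ∃ e' ∈ H, T ⊆ e' ∧ e' ⊆ B := by
  induction hc : (e \ B).card using Nat.strong_induction_on generalizing e with
  | _ c ih =>
    by_cases heB : e ⊆ B
    · exact ⟨e, he, hTe, heB⟩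
    · obtain ⟨u, hue, huB⟩ := Finset.not_subset.1 heB
      obtain ⟨w, hwB, -, hwH⟩ := hB e he u hue
      refine ih _ ?_ hwH ?_ rfl
      · rw [← hc]
        apply Finset.card_lt_card
        refine Finset.ssubset_iff_subset_ne.2 ⟨?_, ?_⟩
        · intro x hx
          grind
        · intro heq
          have : u ∈ e \ B := by simp [hue, huB]
          rw [← heq] at this
          grind
      · intro x hx
        have := hTe hx
        have := hTB hx
        grind

theorem exists_exchange_of_minPosCodeg {V : Type*} [Fintype V] [DecidableEq V] {k : ℕ}
    (H : Finset (Finset V)) (hu : ∀ e ∈ H, e.card = k) {B : Finset V}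
    (hB : B = univ ∨ Fintype.card V < B.card + minPosCodeg k H) {e : Finset V} (he : e ∈ H)
    {u : V} (hue : u ∈ e) : ∃ w ∈ B, w ∉ e.erase u ∧ insert w (e.erase u) ∈ H := by
  rcases hB with rfl | hB
  · exact ⟨u, by simp, by simp, by simpa [Finset.insert_erase hue] using he⟩
  · set T := e.erase u
    let N := univ.filter fun w => w ∉ T ∧ insert w T ∈ H
    have hT : T.card = k - 1 := by rw [Finset.card_erase_of_mem hue, hu e he]
    have hpos : 0 < deg H T :=
      Finset.card_pos.2 ⟨e, Finset.mem_filter.2 ⟨he, Finset.erase_subset _ _⟩⟩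
    have h1 : minPosCodeg k H ≤ deg H T := Nat.sInf_le ⟨T, hT, hpos, rfl⟩
    have h2 : deg H T ≤ N.card := by
      refine (Finset.card_le_card (t := N.image fun w => insert w T) ?_).trans
        Finset.card_image_le
      intro f hf
      obtain ⟨hfH, hTf⟩ := Finset.mem_filter.1 hf
      have hk : 0 < k := by rw [← hu e he]; exact Finset.card_pos.2 ⟨u, hue⟩
      have hc : (f \ T).card = 1 := by
        rw [Finset.card_sdiff_of_subset hTf, hu f hfH, hT]
        omega
      obtain ⟨w, hw⟩ := Finset.card_eq_one.1 hc
      have hwf : insert w T = f := by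
        rw [Finset.insert_eq, ← hw, Finset.sdiff_union_of_subset hTf]
      have hwT : w ∈ f \ T := by simp [hw]
      exact Finset.mem_image.2 ⟨w, by simp [N, hwf, hfH, (Finset.mem_sdiff.1 hwT).2], hwf⟩
    have h3 : (B ∩ N).Nonempty := by
      rw [← Finset.card_pos]
      have := Finset.card_union_add_card_inter B N
      have := Finset.card_le_univ (B ∪ N)
      omega
    obtain ⟨w, hw⟩ := h3
    obtain ⟨hwB, hwN⟩ := Finset.mem_inter.1 hw
    exact ⟨w, hwB, (Finset.mem_filter.1 hwN).2⟩

theorem card_le_mul_pow_of_forall_exists_mem {V : Type*} [Fintype V] [DecidableEq V] {k : ℕ}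
    (F : Finset (Finset V)) (hu : ∀ e ∈ F, e.card = k) (G : Finset V)
    (hG : ∀ e ∈ F, ∃ v ∈ G, v ∈ e) : F.card ≤ G.card * Fintype.card V ^ (k - 1) := by
  have h : F ⊆ (G ×ˢ (univ : Finset (Fin (k - 1) → V))).image
      fun x => insert x.1 (univ.image x.2) := by
    intro e he
    obtain ⟨v, hvG, hve⟩ := hG e he
    have hc : (e.erase v).card = k - 1 := by rw [Finset.card_erase_of_mem hve, hu e he]
    let g := (e.erase v).equivFinOfCardEq hc
    refine Finset.mem_image.2 ⟨(v, fun i => (g.symm i).1), by simp [hvG], ?_⟩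
    have : univ.image (fun i => (g.symm i).1) = e.erase v := by
      ext x
      simp only [Finset.mem_image, Finset.mem_univ, true_and]
      constructor
      · rintro ⟨i, rfl⟩
        exact (g.symm i).2
      · intro hx
        exact ⟨g ⟨x, hx⟩, by simp⟩
    simp only [this, Finset.insert_erase hve]
  refine (Finset.card_le_card h).trans (Finset.card_image_le.trans ?_)
  simp [Finset.card_product]

theorem sum_nonneg_of_edges_in_sublevel {V : Type*} [Fintype V] [DecidableEq V] {k : ℕ}
    {H : Finset (Finset V)} (hu : ∀ e ∈ H, e.card = k) {y : V → ℝ}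
    (hy : ∀ e ∈ H, 0 ≤ ∑ v ∈ e, y v) {A B G : Finset V} {a b : ℝ} (hAB : A ⊆ B) (hGA : G ⊆ A)
    (hn : k * A.card = Fintype.card V) (hBG : B.card ≤ A.card + G.card) (hab : a ≤ b)
    (hA : ∀ v ∈ A, y v ≤ a) (hA' : ∀ v ∉ A, a ≤ y v) (hB : ∀ v ∈ B, y v ≤ b)
    (hB' : ∀ v ∉ B, b ≤ y v) (hedge : ∀ v ∈ A, ∃ e ∈ H, v ∈ e ∧ e ⊆ B)
    (hgood : ∀ v ∈ G, ∃ e ∈ H, v ∈ e ∧ (∃ u ∈ A, u ≠ v ∧ u ∈ e) ∧ e ⊆ B) :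
    0 ≤ ∑ v, y v := by
  have hsum (e : Finset V) (heB : e ⊆ B) : ∑ v ∈ e, y v ≤ e.card * b := by
    simpa using Finset.sum_le_card_nsmul e y b fun v hv => hB v (heB hv)
  have h1 : ∀ v ∈ A \ G, 0 ≤ y v + (k - 1) * b := by
    intro v hv
    obtain ⟨e, he, hve, heB⟩ := hedge v (Finset.mem_sdiff.1 hv).1
    have h := hy e he
    rw [← Finset.add_sum_erase e y hve] at h
    have h' := hsum (e.erase v) ((Finset.erase_subset _ _).trans heB)
    rw [Finset.cast_card_erase_of_mem hve, hu e he] at h'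
    linarith
  have h2 : ∀ v ∈ G, 0 ≤ y v + (a + (k - 2) * b) := by
    intro v hv
    obtain ⟨e, he, hve, ⟨u, huA, huv, hue⟩, heB⟩ := hgood v hv
    have h := hy e he
    have hue' : u ∈ e.erase v := Finset.mem_erase.2 ⟨huv, hue⟩
    rw [← Finset.add_sum_erase e y hve, ← Finset.add_sum_erase _ y hue'] at h
    have h' := hsum ((e.erase v).erase u)
      (((Finset.erase_subset _ _).trans (Finset.erase_subset _ _)).trans heB)
    rw [Finset.cast_card_erase_of_mem hue', Finset.cast_card_erase_of_mem hve, hu e he] at h'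
    have := hA u huA
    linarith
  have h3 := Finset.sum_nonneg h1
  have h4 := Finset.sum_nonneg h2
  rw [Finset.sum_add_distrib, Finset.sum_const, nsmul_eq_mul] at h3 h4
  have h5 := Finset.sum_sdiff (f := y) hGA
  have h6 := Finset.sum_sdiff (f := y) hAB
  have h7 := Finset.sum_sdiff (f := y) (Finset.subset_univ B)
  have h8 := Finset.card_nsmul_le_sum (B \ A) y a fun v hv => hA' v (Finset.mem_sdiff.1 hv).2
  have h9 := Finset.card_nsmul_le_sum (univ \ B) y b fun v hv => hB' v (Finset.mem_sdiff.1 hv).2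
  rw [nsmul_eq_mul, Finset.cast_card_sdiff hAB] at h8
  rw [nsmul_eq_mul, Finset.cast_card_sdiff (Finset.subset_univ B), Finset.card_univ, ← hn] at h9
  rw [Finset.cast_card_sdiff hGA] at h3
  push_cast at h9
  have h10 : (B.card : ℝ) ≤ A.card + G.card := by exact_mod_cast hBG
  have h11 := mul_nonneg (sub_nonneg.2 h10) (sub_nonneg.2 hab)
  linarith

theorem stmt12 (k : ℕ) (hk : 0 < k) (γ : ℝ) (hγ : 0 < γ) :
    ∃ α₀ : ℝ, 0 < α₀ ∧ ∀ α : ℝ, 0 < α → α ≤ α₀ →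
      ∃ n₀ : ℕ, ∀ n ≥ n₀, k ∣ n →
        ∀ H : Finset (Finset (Fin n)), (∀ e ∈ H, e.card = k) →
          ((k : ℝ) - 1) / k * n - α * n ≤ (minPosCodeg k H : ℝ) →
          (∀ v : Fin n, ∃ e ∈ H, v ∈ e) →
          IsExtremal k γ H ∨ ∃ w : Finset (Fin n) → ℝ, IsPerfFracMatching H w := by
  refine ⟨γ / 2, by positivity, fun α _ hα => ?_⟩
  obtain ⟨n₀, hn₀⟩ := exists_nat_gt (2 / γ)
  refine ⟨max n₀ 1, fun n hn hkn H hu hδ hiso => ?_⟩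
  have hn1 : 0 < n := lt_of_lt_of_le one_pos ((le_max_right _ _).trans hn)
  have hγn : 2 < γ * n := by
    have h1 : (n₀ : ℝ) ≤ n := by exact_mod_cast (le_max_left _ _).trans hn
    rw [mul_comm, ← div_lt_iff₀ hγ]
    linarith
  refine or_iff_not_imp_left.2 fun hext => ?_
  have : Nonempty (Fin n) := ⟨⟨0, hn1⟩⟩
  refine exists_isPerfFracMatching_of_sum_nonneg hk H hu fun y hy => ?_
  obtain ⟨p, rfl⟩ := hkn
  have hp : 0 < p := Nat.pos_of_mul_pos_left hn1
  have hpn : p ≤ k * p := Nat.le_mul_of_pos_left p hk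
  have hk' : (0 : ℝ) < k := by exact_mod_cast hk
  obtain ⟨A, B, a, b, hAB, hAc, hBc, hab, hA, hA', hB, hB'⟩ := exists_nested_sublevel y hp
    (le_min hpn (Nat.le_add_right p ⌊γ * (k * p : ℕ)⌋₊)) (min_le_left (k * p) _)
  have hBbig : B = univ ∨ Fintype.card (Fin (k * p)) < B.card + minPosCodeg k H := by
    rcases le_total (k * p) (p + ⌊γ * (k * p : ℕ)⌋₊) with h | h
    · left
      rw [min_eq_left h] at hBc
      exact Finset.eq_univ_of_card B (by rw [hBc, Fintype.card_fin])
    · right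
      rw [min_eq_right h] at hBc
      rw [hBc, Fintype.card_fin]
      have h1 := Nat.lt_floor_add_one (γ * (k * p : ℕ))
      have h2 : ((k : ℝ) - 1) / k * (k * p : ℕ) = (k * p : ℕ) - p := by
        push_cast
        field_simp
      rw [h2] at hδ
      have h3 : α * (k * p : ℕ) ≤ γ / 2 * (k * p : ℕ) := by gcongr
      have h4 : ((k * p : ℕ) : ℝ) < (p + ⌊γ * (k * p : ℕ)⌋₊ + minPosCodeg k H : ℕ) := by
        push_cast at *
        linarith
      exact_mod_cast h4
  have hexch : ∀ e ∈ H, ∀ u ∈ e, ∃ w ∈ B, w ∉ e.erase u ∧ insert w (e.erase u) ∈ H :=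
    fun e he u hue => exists_exchange_of_minPosCodeg H hu hBbig he hue
  let G := A.filter fun v => ∃ e ∈ H, v ∈ e ∧ ∃ u ∈ A, u ≠ v ∧ u ∈ e
  have hG : γ * (k * p : ℕ) < G.card := by
    have h1 : γ * ((k * p : ℕ) : ℝ) ^ k < (H.filter fun e => 2 ≤ (e ∩ A).card).card := by
      by_contra! h
      refine hext ⟨A, ?_, by rwa [Fintype.card_fin]⟩
      rw [hAc, Fintype.card_fin, Nat.mul_div_cancel_left p hk]
    have h2 := card_le_mul_pow_of_forall_exists_mem (H.filter fun e => 2 ≤ (e ∩ A).card)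
      (fun e he => hu e (Finset.mem_filter.1 he).1) G (by
        intro e he
        obtain ⟨heH, hc⟩ := Finset.mem_filter.1 he
        obtain ⟨v, hv, u, hue, hne⟩ := Finset.one_lt_card.1 hc
        obtain ⟨hve, hvA⟩ := Finset.mem_inter.1 hv
        obtain ⟨hue, huA⟩ := Finset.mem_inter.1 hue
        exact ⟨v, Finset.mem_filter.2 ⟨hvA, e, heH, hve, u, huA, hne.symm, hue⟩, hve⟩)
    rw [Fintype.card_fin] at h2
    have h3 : γ * ((k * p : ℕ) : ℝ) ^ k < G.card * ((k * p : ℕ) : ℝ) ^ (k - 1) :=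
      h1.trans_le (by exact_mod_cast h2)
    rw [← mul_pow_sub_one hk.ne', ← mul_assoc] at h3
    exact lt_of_mul_lt_mul_right h3 (by positivity)
  have hBG : B.card ≤ A.card + G.card := by
    have h1 : ⌊γ * (k * p : ℕ)⌋₊ ≤ G.card := Nat.floor_le_of_le hG.le
    rw [hBc, hAc]
    exact (min_le_right _ _).trans (by omega)
  refine sum_nonneg_of_edges_in_sublevel hu hy hAB (Finset.filter_subset _ _)
    (by rw [hAc, Fintype.card_fin]) hBG hab hA hA' hB hB' ?_ ?_
  · intro v hv
    obtain ⟨e, he, hve⟩ := hiso v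
    obtain ⟨e', he', hT, heB⟩ := exists_edge_subset_of_exchange hexch
      (Finset.singleton_subset_iff.2 (hAB hv)) he (Finset.singleton_subset_iff.2 hve)
    exact ⟨e', he', Finset.singleton_subset_iff.1 hT, heB⟩
  · intro v hv
    obtain ⟨hvA, e, he, hve, u, huA, huv, hue⟩ := Finset.mem_filter.1 hv
    obtain ⟨e', he', hT, heB⟩ := exists_edge_subset_of_exchange (T := {v, u}) hexch
      (by simp [Finset.insert_subset_iff, hAB hvA, hAB huA]) he
      (by simp [Finset.insert_subset_iff, hve, hue])
    exact ⟨e', he', hT (by simp), ⟨u, huA, huv, hT (by simp)⟩, heB⟩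
end

section
/- Suppose 1/n ≪ α, ε ≪ γ, 1/k with k dividing n, and let H be a k-uniform hypergraph on n vertices with δ⁺(H) ≥ ((k−1)/k)·n − αn and no isolated vertices. Then either H is γ-extremal or H admits a perfect fractional matching w such that for all distinct vertices u, v, the total weight w_{uv} = Σ_{e ⊇ {u,v}} w(e) is at most 1/(εn). -/
open Finset

variable {V : Type*} [Fintype V] [DecidableEq V]

/-- A Farkas-type alternative: a system of equations and inequalities has a solution in the
standard simplex as soon as no nonnegative combination of the constraints excludes all vertices. -/
theorem exists_mem_stdSimplex_of_forall_dual {E I J : Type*} [Fintype E] [Fintype I]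
    [Fintype J] [DecidableEq E] [DecidableEq I] [DecidableEq J]
    (A : E → I → ℝ) (b : I → ℝ) (B : E → J → ℝ) (c : J → ℝ)
    (h : ∀ (y : I → ℝ) (z : J → ℝ), (∀ j, 0 ≤ z j) →
      ∃ e, ∑ i, y i * b i - ∑ j, z j * c j ≤ ∑ i, y i * A e i - ∑ j, z j * B e j) :
    ∃ w ∈ stdSimplex ℝ E, (∀ i, ∑ e, w e * A e i = b i) ∧ ∀ j, ∑ e, w e * B e j ≤ c j := by
  let L : (E → ℝ) →ₗ[ℝ] (I → ℝ) × (J → ℝ) :=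
    ((Fintype.linearCombination ℝ A).prod (Fintype.linearCombination ℝ B))
  have hL (w : E → ℝ) : L w = (fun i => ∑ e, w e * A e i, fun j => ∑ e, w e * B e j) := by
    ext <;> simp [L, Fintype.linearCombination_apply]
  have hLc : Continuous L := L.continuous_of_finiteDimensional
  let Q : Set ((I → ℝ) × (J → ℝ)) := {b} ×ˢ Set.Iic c
  by_cases hdisj : Disjoint (L '' stdSimplex ℝ E) Q
  · exfalso
    obtain ⟨φ, s, t, hs, hst, ht⟩ := geometric_hahn_banach_compact_closed
      ((convex_stdSimplex ℝ E).linear_image L) ((isCompact_stdSimplex ℝ E).image hLc)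
      ((convex_singleton b).prod (convex_Iic c)) (isClosed_singleton.prod isClosed_Iic) hdisj
    have hφ (x : I → ℝ) (x' : J → ℝ) : φ (x, x') =
        ∑ i, φ (Pi.single i 1, 0) * x i + ∑ j, φ (0, Pi.single j 1) * x' j := by
      have h1 : φ (x, x') = φ (x, 0) + φ (0, x') := by rw [← map_add]; simp
      have h2 := LinearMap.pi_apply_eq_sum_univ
        (φ.toLinearMap.comp (LinearMap.inl ℝ (I → ℝ) (J → ℝ))) x
      have h3 := LinearMap.pi_apply_eq_sum_univ
        (φ.toLinearMap.comp (LinearMap.inr ℝ (I → ℝ) (J → ℝ))) x'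
      simp only [LinearMap.comp_apply, LinearMap.inl_apply, LinearMap.inr_apply,
        ContinuousLinearMap.coe_coe, smul_eq_mul] at h2 h3
      rw [h1, h2, h3]
      congr 1 <;> refine Finset.sum_congr rfl fun i _ => ?_ <;> rw [mul_comm] <;> congr 3 <;>
        ext j <;> simp [Pi.single_apply, eq_comm]
    have hζ (j : J) : φ (0, Pi.single j 1) ≤ 0 := by
      by_contra! hpos
      set a := φ (0, Pi.single j 1) with ha
      set r := |φ (b, c) - t| / a with hr
      have hr0 : 0 ≤ r := by positivity
      have h1 := ht (b, c - r • Pi.single j 1) (by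
        refine ⟨rfl, fun i => ?_⟩
        have : 0 ≤ (Pi.single j (1 : ℝ) : J → ℝ) i := by
          rw [Pi.single_apply]; split_ifs <;> norm_num
        simp only [Pi.sub_apply, Pi.smul_apply, smul_eq_mul]
        nlinarith)
      have h2 : ((b, c - r • Pi.single j 1) : (I → ℝ) × (J → ℝ)) =
          (b, c) - r • ((0 : I → ℝ), (Pi.single j 1 : J → ℝ)) := by simp
      rw [h2, map_sub, map_smul, smul_eq_mul, ← ha, hr, div_mul_cancel₀ _ hpos.ne'] at h1
      linarith [le_abs_self (φ (b, c) - t)]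
    obtain ⟨e, he⟩ := h (fun i => φ (Pi.single i 1, 0)) (fun j => -φ (0, Pi.single j 1))
      fun j => neg_nonneg.2 (hζ j)
    have h1 := hs (L (Pi.single e 1)) ⟨_, single_mem_stdSimplex ℝ e, rfl⟩
    have h2 := ht (b, c) ⟨rfl, le_refl c⟩
    rw [hL] at h1
    simp only [Pi.single_apply, ite_mul, one_mul, zero_mul, Finset.sum_ite_eq',
      Finset.mem_univ, if_true] at h1
    rw [hφ] at h1 h2
    simp only [neg_mul, Finset.sum_neg_distrib, sub_neg_eq_add] at he
    linarith
  · rw [Set.not_disjoint_iff] at hdisj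
    obtain ⟨_, ⟨w, hw, rfl⟩, h1, h2⟩ := hdisj
    rw [hL] at h1 h2
    exact ⟨w, hw, fun i => congrFun h1 i, fun j => h2 j⟩

/-- The number of edges of a `k`-uniform hypergraph containing a given `j`-set is at most
`n ^ (k - j)`. -/
theorem deg_le_pow {k : ℕ} {H : Finset (Finset V)} (hH : ∀ e ∈ H, e.card = k) (S : Finset V) :
    deg H S ≤ Fintype.card V ^ (k - S.card) := by
  have h : deg H S ≤ ((univ : Finset V).powersetCard (k - S.card)).card := by
    refine Finset.card_le_card_of_injOn (fun e => e \ S) (fun e he => ?_) fun e he f hf hef => ?_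
    · have he' := Finset.mem_filter.1 he
      simp only [Finset.mem_coe, Finset.mem_powersetCard_univ]
      rw [Finset.card_sdiff_of_subset he'.2, hH e he'.1]
    · have he' := (Finset.mem_filter.1 he).2
      have hf' := (Finset.mem_filter.1 hf).2
      rw [← Finset.sdiff_union_of_subset he', ← Finset.sdiff_union_of_subset hf']
      exact congrArg (· ∪ S) hef
  rw [Finset.card_powersetCard, Finset.card_univ] at h
  exact h.trans (Nat.choose_le_pow _ _)

/-- The degree of a `(k-1)`-set is at most its number of neighbours. -/
theorem deg_le_card_neighbours {k : ℕ} {H : Finset (Finset V)} (hH : ∀ e ∈ H, e.card = k)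
    {T : Finset V} (hT : T.card + 1 = k) :
    deg H T ≤ (univ.filter fun x => x ∉ T ∧ insert x T ∈ H).card := by
  have h : (H.filter fun e => T ⊆ e) ⊆
      (univ.filter fun x => x ∉ T ∧ insert x T ∈ H).image fun x => insert x T := by
    intro e he
    obtain ⟨heH, hTe⟩ := Finset.mem_filter.1 he
    have h1 : (e \ T).card = 1 := by
      rw [Finset.card_sdiff_of_subset hTe, hH e heH]; omega
    obtain ⟨x, hx⟩ := Finset.card_eq_one.1 h1
    have hxe : x ∈ e \ T := by simp [hx]
    have hins : insert x T = e := by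
      rw [← Finset.sdiff_union_of_subset hTe, hx, Finset.insert_eq]
    refine Finset.mem_image.2 ⟨x, ?_, hins⟩
    simp only [Finset.mem_filter, Finset.mem_univ, true_and, hins]
    exact ⟨(Finset.mem_sdiff.1 hxe).2, heH⟩
  exact (Finset.card_le_card h).trans Finset.card_image_le

/-- The total weight of the ordered pairs inside `S`. -/
def pairCost {W : Type*} (z : W → W → ℝ) (S : Finset W) : ℝ := ∑ u ∈ S, ∑ v ∈ S, z u v

theorem pairCost_insert {W : Type*} [DecidableEq W] {z : W → W → ℝ} (hz : ∀ u, z u u = 0)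
    {S : Finset W} {x : W} (hx : x ∉ S) :
    pairCost z (insert x S) = pairCost z S + ∑ u ∈ S, (z u x + z x u) := by
  simp only [pairCost, Finset.sum_insert hx, hz, Finset.sum_add_distrib]
  ring

theorem pairCost_insert_le {W : Type*} [DecidableEq W] {z : W → W → ℝ} (hz : ∀ u, z u u = 0)
    {D : W → ℝ} (hD : ∀ v, 0 ≤ D v) {S : Finset W} {x : W} (hx : x ∉ S)
    (hxD : ∀ u ∈ S, z u x + z x u ≤ D u) (hS : pairCost z S ≤ S.card * ∑ v ∈ S, D v) :
    pairCost z (insert x S) ≤ (insert x S).card * ∑ v ∈ insert x S, D v := by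
  rw [pairCost_insert hz hx, Finset.card_insert_of_notMem hx, Finset.sum_insert hx]
  have h1 := Finset.sum_le_sum hxD
  have h2 : (0 : ℝ) ≤ ((S.card : ℝ) + 1) * D x := mul_nonneg (by positivity) (hD x)
  push_cast
  linarith

/-- Greedy extension of a set in the shadow of `H` to an edge inside a large set `U`, avoiding
a small set of forbidden successors for each vertex. -/
theorem exists_edge_extension {k : ℕ} {H : Finset (Finset V)} (hH : ∀ e ∈ H, e.card = k)
    {δ β : ℝ} (hdeg : ∀ T : Finset V, T.card = k - 1 → 0 < deg H T → δ ≤ deg H T)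
    {z : V → V → ℝ} (hz : ∀ u, z u u = 0) {D : V → ℝ} (hD : ∀ v, 0 ≤ D v)
    {B : V → Finset V} (hB : ∀ v, ((B v).card : ℝ) ≤ β)
    (hBD : ∀ v, ∀ u ∉ B v, z v u + z u v ≤ D v)
    {U : Finset V} (hU : Fintype.card V + k * β < δ + U.card)
    {S : Finset V} (hS : ∃ e ∈ H, S ⊆ e) (hcost : pairCost z S ≤ S.card * ∑ v ∈ S, D v) :
    ∃ e ∈ H, S ⊆ e ∧ e \ S ⊆ U ∧ pairCost z e ≤ k * ∑ v ∈ e, D v := by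
  induction hj : k - S.card generalizing S with
  | zero =>
    obtain ⟨e, he, hSe⟩ := hS
    have : S = e := Finset.eq_of_subset_of_card_le hSe (by rw [hH e he]; omega)
    subst this
    rw [hH S he] at hcost
    exact ⟨S, he, subset_rfl, by simp, hcost⟩
  | succ j ih =>
    obtain ⟨e₀, he₀, hSe₀⟩ := hS
    obtain ⟨T, hST, hTe₀, hT⟩ := Finset.exists_subsuperset_card_eq hSe₀
      (show S.card ≤ k - 1 by omega) (by rw [hH e₀ he₀]; omega)
    have hpos : 0 < deg H T := Finset.card_pos.2 ⟨e₀, Finset.mem_filter.2 ⟨he₀, hTe₀⟩⟩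
    set N := univ.filter fun x => x ∉ T ∧ insert x T ∈ H with hN
    have hNδ : δ ≤ N.card :=
      (hdeg T hT hpos).trans (by exact_mod_cast deg_le_card_neighbours hH (by omega))
    have hBS : ((S.biUnion B).card : ℝ) ≤ k * β := by
      have hβ : S.card * β ≤ k * β := by
        by_cases hne : S.Nonempty
        · obtain ⟨v, -⟩ := hne
          have : 0 ≤ β := (Nat.cast_nonneg _).trans (hB v)
          gcongr
          omega
        · obtain ⟨e, he⟩ : ∃ v, v ∈ e₀ := Finset.card_pos.1 (by rw [hH e₀ he₀]; omega)
          have : 0 ≤ β := (Nat.cast_nonneg _).trans (hB e)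
          gcongr
          omega
      calc ((S.biUnion B).card : ℝ) ≤ ∑ v ∈ S, ((B v).card : ℝ) := by
            exact_mod_cast Finset.card_biUnion_le
        _ ≤ S.card * β := by
            rw [← nsmul_eq_mul]; exact Finset.sum_le_card_nsmul _ _ _ fun v _ => hB v
        _ ≤ k * β := hβ
    obtain ⟨x, hx⟩ : ((N ∩ U) \ S.biUnion B).Nonempty := by
      rw [← Finset.card_pos]
      have h1 := Finset.card_union_add_card_inter N U
      have h2 := Finset.card_le_univ (N ∪ U)
      have h3 := Finset.card_le_card_sdiff_add_card (s := N ∩ U) (t := S.biUnion B)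
      have h1' : ((N ∪ U).card : ℝ) + (N ∩ U).card = N.card + U.card := by exact_mod_cast h1
      have h2' : ((N ∪ U).card : ℝ) ≤ Fintype.card V := by exact_mod_cast h2
      have h3' : ((N ∩ U).card : ℝ) ≤ ((N ∩ U) \ S.biUnion B).card + (S.biUnion B).card := by
        exact_mod_cast h3
      have : (0 : ℝ) < ((N ∩ U) \ S.biUnion B).card := by linarith
      exact_mod_cast this
    simp only [Finset.mem_sdiff, Finset.mem_inter, Finset.mem_biUnion, not_exists, not_and,
      hN, Finset.mem_filter, Finset.mem_univ, true_and] at hx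
    obtain ⟨⟨⟨hxT, hxH⟩, hxU⟩, hxB⟩ := hx
    have hxS : x ∉ S := fun h => hxT (hST h)
    obtain ⟨e, he, hSe, heU, hce⟩ := ih ⟨_, hxH, Finset.insert_subset_insert x hST⟩
      (pairCost_insert_le hz hD hxS (fun u hu => hBD u x (hxB u hu)) hcost)
      (by rw [Finset.card_insert_of_notMem hxS]; omega)
    refine ⟨e, he, (Finset.subset_insert x S).trans hSe, fun v hv => ?_, hce⟩
    by_cases hvx : v = x
    · exact hvx ▸ hxU
    · obtain ⟨hve, hvS⟩ := Finset.mem_sdiff.1 hv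
      exact heU (Finset.mem_sdiff.2 ⟨hve, by simp [hvx, hvS]⟩)

/-- If more than `(|R| + nβ) n^(k-1)` edges meet `S` twice, then some edge contains a pair of
vertices of `S \ R` whose second entry is not forbidden for the first one. -/
theorem exists_pair_of_card_lt {k : ℕ} (hk : 2 ≤ k) {H : Finset (Finset V)}
    (hH : ∀ e ∈ H, e.card = k) {S R : Finset V} {B : V → Finset V} {β : ℝ}
    (hB : ∀ v, ((B v).card : ℝ) ≤ β)
    (hS : ((R.card : ℝ) + β) * (Fintype.card V : ℝ) ^ (k - 1) <
      (H.filter fun e => 2 ≤ (e ∩ S).card).card) :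
    ∃ e ∈ H, ∃ x ∈ e ∩ (S \ R), ∃ y ∈ e ∩ (S \ R), x ≠ y ∧ y ∉ B x := by
  by_contra! hcon
  set F := H.filter fun e => 2 ≤ (e ∩ S).card with hF
  let P : Finset (Finset V) := R.biUnion fun x => H.filter fun e => {x} ⊆ e
  let P' : Finset (Finset V) := univ.biUnion fun x => ((B x).erase x).biUnion fun y =>
    H.filter fun e => {x, y} ⊆ e
  have hsub : F ⊆ P ∪ P' := by
    intro e he
    obtain ⟨heH, he2⟩ := Finset.mem_filter.1 he
    obtain ⟨x, hx, y, hy, hxy⟩ := Finset.one_lt_card.1 he2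
    rw [Finset.mem_inter] at hx hy
    by_cases hxR : x ∈ R
    · refine Finset.mem_union_left _ (Finset.mem_biUnion.2 ⟨x, hxR, ?_⟩)
      simp [heH, hx.1]
    by_cases hyR : y ∈ R
    · refine Finset.mem_union_left _ (Finset.mem_biUnion.2 ⟨y, hyR, ?_⟩)
      simp [heH, hy.1]
    have := hcon e heH x (by simp [hx, hxR]) y (by simp [hy, hyR]) hxy
    refine Finset.mem_union_right _ (Finset.mem_biUnion.2 ⟨x, Finset.mem_univ _,
      Finset.mem_biUnion.2 ⟨y, by simp [this, hxy.symm], ?_⟩⟩)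
    simp [heH, hx.1, hy.1, Finset.insert_subset_iff]
  have hP : P.card ≤ R.card * Fintype.card V ^ (k - 1) := by
    refine Finset.card_biUnion_le_card_mul _ _ _ fun x _ => ?_
    simpa [deg] using deg_le_pow hH {x}
  have hP' : (P'.card : ℝ) ≤ β * (Fintype.card V : ℝ) ^ (k - 1) := by
    have hbd (x : V) : ((((B x).erase x).biUnion fun y =>
        H.filter fun e => {x, y} ⊆ e).card : ℝ) ≤ β * (Fintype.card V : ℝ) ^ (k - 2) := by
      have h1 : (((B x).erase x).biUnion fun y => H.filter fun e => {x, y} ⊆ e).card ≤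
          ((B x).erase x).card * Fintype.card V ^ (k - 2) := by
        refine Finset.card_biUnion_le_card_mul _ _ _ fun y hy => ?_
        have := deg_le_pow hH {x, y}
        rwa [Finset.card_pair (Finset.ne_of_mem_erase hy).symm] at this
      have h2 : (((B x).erase x).card : ℝ) ≤ β :=
        (by exact_mod_cast Finset.card_le_card (Finset.erase_subset x (B x)) :
          (((B x).erase x).card : ℝ) ≤ (B x).card).trans (hB x)
      calc _ ≤ (((B x).erase x).card : ℝ) * (Fintype.card V : ℝ) ^ (k - 2) := by
            exact_mod_cast h1
        _ ≤ _ := by gcongr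
    calc (P'.card : ℝ) ≤ ∑ x : V, ((((B x).erase x).biUnion fun y =>
          H.filter fun e => {x, y} ⊆ e).card : ℝ) := by exact_mod_cast Finset.card_biUnion_le
      _ ≤ ∑ _x : V, β * (Fintype.card V : ℝ) ^ (k - 2) := Finset.sum_le_sum fun x _ => hbd x
      _ = β * (Fintype.card V : ℝ) ^ (k - 1) := by
          rw [Finset.sum_const, Finset.card_univ, nsmul_eq_mul,
            show k - 1 = k - 2 + 1 by omega, pow_succ]
          ring
  have h1 : (F.card : ℝ) ≤ P.card + P'.card := by
    exact_mod_cast (Finset.card_le_card hsub).trans (Finset.card_union_le _ _)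
  have h2 : (P.card : ℝ) ≤ R.card * (Fintype.card V : ℝ) ^ (k - 1) := by exact_mod_cast hP
  linarith

theorem card_filter_perm_symm_lt {n : ℕ} (σ : Equiv.Perm (Fin n)) {a : ℕ} (ha : a ≤ n) :
    (univ.filter fun v => (σ.symm v : ℕ) < a).card = a := by
  have h : (univ.filter fun v => (σ.symm v : ℕ) < a) =
      (univ.filter fun i : Fin n => (i : ℕ) < a).map σ.toEmbedding := by
    ext v
    simp only [Finset.mem_filter, Finset.mem_univ, true_and, Finset.mem_map_equiv]
  rw [h, Finset.card_map, Fin.card_filter_val_lt, min_eq_right ha]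

theorem exists_perm_antitone {n : ℕ} (g : Fin n → ℝ) :
    ∃ σ : Equiv.Perm (Fin n), ∀ u v, (σ.symm u : ℕ) ≤ σ.symm v → g v ≤ g u := by
  refine ⟨Tuple.sort fun i => -g i, fun u v huv => ?_⟩
  have := Tuple.monotone_sort (fun i => -g i) (Fin.le_def.2 huv)
  simpa using this

/-- In a non-extremal hypergraph with large minimum positive codegree, every vertex weighting
admits a cheap edge whose average weight is at least the global average. -/
theorem exists_heavy_edge {k q n : ℕ} (hk : 2 ≤ k) (hq : 0 < q) (hn : n = k * q)
    {H : Finset (Finset (Fin n))} (hH : ∀ e ∈ H, e.card = k) {α β γ : ℝ} (hα : 0 ≤ α)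
    (hβ : 0 ≤ β)
    (hdeg : ∀ T : Finset (Fin n), T.card = k - 1 → 0 < deg H T →
      ((k : ℝ) - 1) / k * n - α * n ≤ deg H T)
    (hiso : ∀ v : Fin n, ∃ e ∈ H, v ∈ e)
    (hαβ : α * n + k * β ≤ γ * n) (hγ : γ * n ≤ q / 2)
    (hext : ∀ S : Finset (Fin n), S.card = q → (γ * n + β) * (n : ℝ) ^ (k - 1) <
      (H.filter fun e => 2 ≤ (e ∩ S).card).card)
    {z : Fin n → Fin n → ℝ} (hz : ∀ u, z u u = 0) {D : Fin n → ℝ} (hD : ∀ v, 0 ≤ D v)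
    {B : Fin n → Finset (Fin n)} (hB : ∀ v, ((B v).card : ℝ) ≤ β)
    (hBD : ∀ v, ∀ u ∉ B v, z v u + z u v ≤ D v) (g : Fin n → ℝ) :
    ∃ e ∈ H, pairCost z e ≤ k * ∑ v ∈ e, D v ∧ k * ∑ v, g v ≤ n * ∑ v ∈ e, g v := by
  have hk0 : (0 : ℝ) < k := by positivity
  have hq0 : (0 : ℝ) < q := by positivity
  have hnR : (n : ℝ) = k * q := by rw [hn]; push_cast; ring
  have hγ0 : 0 ≤ γ * n := le_trans (by positivity) hαβ
  obtain ⟨σ, hσ⟩ := exists_perm_antitone g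
  set r := ⌊γ * n⌋₊ + 1 with hr
  have hrle : (r : ℝ) - 1 ≤ γ * n := by rw [hr]; push_cast; linarith [Nat.floor_le hγ0]
  have hrlt : γ * n < r := by rw [hr]; push_cast; exact Nat.lt_floor_add_one _
  have hrq : r ≤ q := by
    have : (r : ℝ) < q + 1 := by linarith
    have : r < q + 1 := by exact_mod_cast this
    omega
  obtain ⟨p, hp⟩ : ∃ p, q = p + r := ⟨q - r, by omega⟩
  set m := ⌊(q : ℝ) + α * n + k * β⌋₊ with hm
  have hm0 : (0 : ℝ) ≤ (q : ℝ) + α * n + k * β := by positivity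
  have hmlt : (q : ℝ) + α * n + k * β < m + 1 := Nat.lt_floor_add_one _
  have hmr : m < q + r := by
    have h1 := Nat.floor_le hm0
    rw [← hm] at h1
    have : (m : ℝ) < q + r := by linarith
    exact_mod_cast this
  have hqm : q ≤ m := Nat.le_floor (by nlinarith [hα, hβ, Nat.cast_nonneg (α := ℝ) n])
  have h2qn : 2 * q ≤ n := by rw [hn]; exact Nat.mul_le_mul_right q hk
  have hpn : p < n := by omega
  have hmn : m < n := by omega
  set a := g (σ ⟨0, by omega⟩) with ha
  set b := g (σ ⟨p, hpn⟩) with hb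
  set c := g (σ ⟨m, hmn⟩) with hc
  have hab : b ≤ a := hσ _ _ (by simp)
  have hbc : c ≤ b := hσ _ _ (by simp; omega)
  set U := univ.filter fun v => (σ.symm v : ℕ) < m + 1 with hUdef
  have hUc (v) (hv : v ∈ U) : c ≤ g v :=
    hσ _ _ (by have := (Finset.mem_filter.1 hv).2; simp; omega)
  have hU : (Fintype.card (Fin n) : ℝ) + k * β <
      ((k : ℝ) - 1) / k * n - α * n + U.card := by
    rw [card_filter_perm_symm_lt σ hmn, Fintype.card_fin]
    have : ((k : ℝ) - 1) / k * n = n - q := by rw [hnR]; field_simp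
    rw [this]
    push_cast
    linarith
  -- the average of the weights, in terms of the three thresholds
  have hsum : ∑ v, g v ≤ n * c + m * (b - c) + p * (a - b) := by
    have h1 (v : Fin n) : g v ≤ c + (if (σ.symm v : ℕ) < m then b - c else 0) +
        (if (σ.symm v : ℕ) < p then a - b else 0) := by
      split_ifs with h1 h2
      · have : g v ≤ a := hσ _ _ (by simp)
        linarith
      · have : g v ≤ b := hσ _ _ (by simp; omega)
        linarith
      · omega
      · have : g v ≤ c := hσ _ _ (by simp; omega)
        linarith
    refine (Finset.sum_le_sum fun v _ => h1 v).trans_eq ?_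
    rw [Finset.sum_add_distrib, Finset.sum_add_distrib, ← Finset.sum_filter, ← Finset.sum_filter]
    simp only [Finset.sum_const, nsmul_eq_mul]
    rw [card_filter_perm_symm_lt σ hmn.le, card_filter_perm_symm_lt σ hpn.le, Finset.card_univ,
      Fintype.card_fin]
  have hedge (S e : Finset (Fin n)) (hSe : S ⊆ e) (he : e ∈ H) (heU : e \ S ⊆ U) :
      ∑ v ∈ S, g v + (k - S.card) * c ≤ ∑ v ∈ e, g v := by
    rw [← Finset.sum_sdiff hSe, add_comm]
    have h1 := Finset.card_nsmul_le_sum (e \ S) g c fun v hv => hUc v (heU hv)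
    have h2 := Finset.card_le_card hSe
    rw [Finset.card_sdiff_of_subset hSe, nsmul_eq_mul, Nat.cast_sub h2, hH e he] at h1
    linarith
  by_contra! hcon
  have hcost1 (x : Fin n) : pairCost z {x} ≤ ({x} : Finset (Fin n)).card * ∑ v ∈ {x}, D v := by
    simpa [pairCost, hz] using hD x
  -- an edge containing the heaviest vertex
  have hE1 : (q : ℝ) * (a + (k - 1) * c) < ∑ v, g v := by
    obtain ⟨e₀, he₀, hxe₀⟩ := hiso (σ ⟨0, by omega⟩)
    obtain ⟨e, he, hSe, heU, hce⟩ := exists_edge_extension hH hdeg hz hD hB hBD hU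
      ⟨e₀, he₀, Finset.singleton_subset_iff.2 hxe₀⟩ (hcost1 _)
    have h1 := hcon e he hce
    have h2 := hedge _ e hSe he heU
    rw [Finset.sum_singleton, Finset.card_singleton, ← ha, Nat.cast_one] at h2
    rw [hnR, mul_assoc] at h1
    have h3 := lt_of_mul_lt_mul_left h1 hk0.le
    exact lt_of_le_of_lt (by gcongr) h3
  -- an edge containing two heavy vertices
  have hE2 : (q : ℝ) * (2 * b + (k - 2) * c) < ∑ v, g v := by
    set S := univ.filter fun v => (σ.symm v : ℕ) < q with hS
    set S' := univ.filter fun v => (σ.symm v : ℕ) < p + 1 with hS'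
    have hSS' : S' ⊆ S := fun v hv => by
      simp only [hS', hS, Finset.mem_filter, Finset.mem_univ, true_and] at hv ⊢; omega
    have hScard : S.card = q := card_filter_perm_symm_lt σ (by omega)
    have hRcard : ((S \ S').card : ℝ) ≤ γ * n := by
      rw [Finset.card_sdiff_of_subset hSS', hScard, card_filter_perm_symm_lt σ (by omega),
        show q - (p + 1) = r - 1 by omega, Nat.cast_sub (by omega), Nat.cast_one]
      exact hrle
    obtain ⟨e₀, he₀, x, hx, y, hy, hxy, hyB⟩ := exists_pair_of_card_lt hk hH (S := S)
      (R := S \ S') hB (by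
        rw [Fintype.card_fin]
        refine lt_of_le_of_lt ?_ (hext S hScard)
        gcongr)
    rw [Finset.sdiff_sdiff_eq_self hSS', Finset.mem_inter] at hx hy
    have hle (v) (hv : v ∈ S') : b ≤ g v :=
      hσ _ _ (by have := (Finset.mem_filter.1 hv).2; simp; omega)
    have hyx : y ∉ ({x} : Finset (Fin n)) := by simpa using hxy.symm
    obtain ⟨e, he, hSe, heU, hce⟩ := exists_edge_extension hH hdeg hz hD hB hBD hU
      ⟨e₀, he₀, Finset.insert_subset hy.1 (Finset.singleton_subset_iff.2 hx.1)⟩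
      (pairCost_insert_le hz hD hyx (by simpa using hBD x y hyB) (hcost1 x))
    have h1 := hcon e he hce
    have h2 := hedge _ e hSe he heU
    rw [Finset.sum_insert hyx, Finset.sum_singleton, Finset.card_insert_of_notMem hyx,
      Finset.card_singleton] at h2
    push_cast at h2
    rw [hnR, mul_assoc] at h1
    have h3 := lt_of_mul_lt_mul_left h1 hk0.le
    have h4 := hle x hx.2
    have h5 := hle y hy.2
    refine lt_of_le_of_lt ?_ h3
    gcongr
    linarith
  have hmR : (m : ℝ) ≤ p + 2 * r - 1 := by
    have : m + 1 ≤ p + 2 * r := by omega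
    have : (m : ℝ) + 1 ≤ p + 2 * r := by exact_mod_cast this
    linarith
  have hpR : (q : ℝ) = p + r := by exact_mod_cast hp
  have hr1 : (0 : ℝ) < r := by rw [hr]; positivity
  have hp0 : (0 : ℝ) ≤ p := by positivity
  have hbc' : 0 ≤ b - c := by linarith
  have hm' : (m : ℝ) * (b - c) ≤ (p + 2 * r - 1) * (b - c) := by gcongr
  rw [hnR] at hsum
  have e1 : r * (a - c) < (2 * r - 1) * (b - c) := by rw [hpR] at hE1 hE2 hsum; linarith
  have e2 : (2 * p + 1) * (b - c) < p * (a - c) := by rw [hpR] at hE1 hE2 hsum; linarith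
  have e3 := mul_le_mul_of_nonneg_left e1.le hp0
  have e4 := mul_lt_mul_of_pos_left e2 hr1
  have e5 : 0 ≤ (p + r) * (b - c) := by positivity
  linarith

/-- Only few vertices carry much more than their share of a nonnegative total. -/
theorem card_filter_lt_le {W : Type*} [Fintype W] {f : W → ℝ} (hf : ∀ u, 0 ≤ f u) {t : ℝ}
    (ht : 0 < t) : ((univ.filter fun u => (∑ x, f x) / t < f u).card : ℝ) ≤ t := by
  set s := ∑ x, f x with hs
  set F := univ.filter fun u => s / t < f u with hF
  by_contra! hcon
  have hne : F.Nonempty := by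
    rw [← Finset.card_pos]; exact_mod_cast ht.trans hcon
  have hs0 : 0 ≤ s := Finset.sum_nonneg fun u _ => hf u
  have h1 : ∑ u ∈ F, s / t < ∑ u ∈ F, f u :=
    Finset.sum_lt_sum_of_nonempty hne fun u hu => (Finset.mem_filter.1 hu).2
  have h2 : ∑ u ∈ F, f u ≤ s :=
    Finset.sum_le_sum_of_subset_of_nonneg (Finset.subset_univ _) fun u _ _ => hf u
  rw [Finset.sum_const, nsmul_eq_mul] at h1
  have h3 : t * (s / t) ≤ F.card * (s / t) := by gcongr
  rw [mul_div_cancel₀ _ ht.ne'] at h3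
  linarith

/-- The dual form of the fractional matching problem with bounded pair weights. -/
theorem exists_dual_edge {k q n : ℕ} (hk : 2 ≤ k) (hq : 0 < q) (hn : n = k * q)
    {H : Finset (Finset (Fin n))} (hH : ∀ e ∈ H, e.card = k) {α θ γ ε : ℝ} (hα : 0 ≤ α)
    (hθ : 0 < θ) (hε : 0 < ε) (hεθ : 2 * k * ε ≤ θ)
    (hdeg : ∀ T : Finset (Fin n), T.card = k - 1 → 0 < deg H T →
      ((k : ℝ) - 1) / k * n - α * n ≤ deg H T)
    (hiso : ∀ v : Fin n, ∃ e ∈ H, v ∈ e)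
    (hαθ : α + k * θ ≤ γ) (hγ : γ * n ≤ q / 2)
    (hext : ∀ S : Finset (Fin n), S.card = q → (γ * n + θ * n) * (n : ℝ) ^ (k - 1) <
      (H.filter fun e => 2 ≤ (e ∩ S).card).card)
    (y : Fin n → ℝ) {z : Fin n → Fin n → ℝ} (hz : ∀ u v, 0 ≤ z u v) (hzz : ∀ u, z u u = 0) :
    ∃ e ∈ H, k / n * (∑ v, y v - 1 / (ε * n) * ∑ u, ∑ v, z u v) ≤
      ∑ v ∈ e, y v - pairCost z e := by
  have hn0 : (0 : ℝ) < n := by rw [hn]; positivity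
  have ht : 0 < θ * n := by positivity
  set D : Fin n → ℝ := fun v => (∑ u, (z v u + z u v)) / (θ * n) with hD
  have hD0 (v) : 0 ≤ D v :=
    div_nonneg (Finset.sum_nonneg fun u _ => add_nonneg (hz _ _) (hz _ _)) ht.le
  obtain ⟨e, he, hcost, hg⟩ := exists_heavy_edge hk hq hn hH hα ht.le hdeg hiso
    (by linarith [mul_le_mul_of_nonneg_right hαθ hn0.le]) hγ hext hzz hD0
    (B := fun v => univ.filter fun u => D v < z v u + z u v)
    (fun v => card_filter_lt_le (fun u => add_nonneg (hz v u) (hz u v)) ht)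
    (fun v u hu => by simpa using hu) (fun v => y v - k * D v)
  refine ⟨e, he, ?_⟩
  have hDsum : ∑ v, D v = 2 * (∑ u, ∑ v, z u v) / (θ * n) := by
    rw [hD, ← Finset.sum_div]
    congr 1
    simp only [Finset.sum_add_distrib]
    rw [Finset.sum_comm (f := fun v u => z u v)]
    ring
  have hZ : 0 ≤ ∑ u, ∑ v, z u v :=
    Finset.sum_nonneg fun u _ => Finset.sum_nonneg fun v _ => hz u v
  have hDle : k * ∑ v, D v ≤ 1 / (ε * n) * ∑ u, ∑ v, z u v := by
    rw [hDsum, ← mul_div_assoc, ← mul_assoc, mul_div_right_comm]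
    refine mul_le_mul_of_nonneg_right ?_ hZ
    rw [div_le_div_iff₀ ht (by positivity)]
    linarith [mul_le_mul_of_nonneg_right hεθ hn0.le]
  rw [Finset.sum_sub_distrib, Finset.sum_sub_distrib, ← Finset.mul_sum, ← Finset.mul_sum] at hg
  rw [div_mul_eq_mul_div, div_le_iff₀ hn0]
  calc (k : ℝ) * (∑ v, y v - 1 / (ε * n) * ∑ u, ∑ v, z u v)
      ≤ k * (∑ v, y v - k * ∑ v, D v) := by gcongr
    _ ≤ n * (∑ v ∈ e, y v - k * ∑ v ∈ e, D v) := hg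
    _ ≤ n * (∑ v ∈ e, y v - pairCost z e) := by gcongr
    _ = _ := mul_comm _ _

/-- Rescaling a solution in the simplex of edge weights to a perfect fractional matching. -/
theorem exists_isPerfFracMatching_of_dual {k n : ℕ} (hk : 0 < k) (hn : 0 < n)
    {H : Finset (Finset (Fin n))} {c : ℝ}
    (h : ∀ (y : Fin n → ℝ) (z : Fin n → Fin n → ℝ), (∀ u v, 0 ≤ z u v) → (∀ u, z u u = 0) →
      ∃ e ∈ H, k / n * (∑ v, y v - c * ∑ u, ∑ v, z u v) ≤ ∑ v ∈ e, y v - pairCost z e)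
    (hc : 0 ≤ c) :
    ∃ w : Finset (Fin n) → ℝ, IsPerfFracMatching H w ∧
      ∀ u v : Fin n, u ≠ v → (∑ e ∈ H.filter fun e => u ∈ e ∧ v ∈ e, w e) ≤ c := by
  have hn0 : (0 : ℝ) < n := by exact_mod_cast hn
  have hk0 : (0 : ℝ) < k := by exact_mod_cast hk
  obtain ⟨w, ⟨hw0, -⟩, hw1, hw2⟩ := exists_mem_stdSimplex_of_forall_dual
    (E := H) (I := Fin n) (J := Fin n × Fin n)
    (fun e v => if v ∈ e.1 then 1 else 0) (fun _ => k / n)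
    (fun e p => if p.1 ≠ p.2 ∧ p.1 ∈ e.1 ∧ p.2 ∈ e.1 then 1 else 0) (fun _ => k / n * c) (by
      intro y z hz
      obtain ⟨e, he, hle⟩ := h y (fun u v => if u ≠ v then z (u, v) else 0)
        (fun u v => by split_ifs; exacts [hz _, le_rfl]) (by simp)
      refine ⟨⟨e, he⟩, ?_⟩
      have h1 : ∑ u, ∑ v, (if u ≠ v then z (u, v) else 0) ≤ ∑ p, z p := by
        rw [Fintype.sum_prod_type]
        refine Finset.sum_le_sum fun u _ => Finset.sum_le_sum fun v _ => ?_
        split_ifs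
        exacts [le_rfl, hz _]
      have h2 : ∑ p : Fin n × Fin n, z p * (if p.1 ≠ p.2 ∧ p.1 ∈ e ∧ p.2 ∈ e then 1 else 0) =
          pairCost (fun u v => if u ≠ v then z (u, v) else 0) e := by
        rw [Fintype.sum_prod_type, pairCost, ← Finset.sum_filter_add_sum_filter_not univ (· ∈ e)]
        rw [Finset.filter_univ_mem]
        rw [Finset.sum_eq_zero (s := univ.filter (· ∉ e)) fun u hu => Finset.sum_eq_zero
          fun v _ => by simp [(Finset.mem_filter.1 hu).2], add_zero]
        refine Finset.sum_congr rfl fun u hu => ?_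
        rw [← Finset.sum_subset (Finset.subset_univ e)]
        · refine Finset.sum_congr rfl fun v hv => ?_
          simp [hu, hv]
        · intro v _ hv
          simp [hv]
      have h3 : ∑ v, y v * (if v ∈ e then 1 else 0) = ∑ v ∈ e, y v := by simp
      rw [h2, h3, ← Finset.sum_mul, ← Finset.sum_mul]
      refine le_trans ?_ hle
      have h4 := mul_le_mul_of_nonneg_left h1 (show (0 : ℝ) ≤ k / n * c by positivity)
      linarith)
  let w' : Finset (Fin n) → ℝ := fun e => if he : e ∈ H then n / k * w ⟨e, he⟩ else 0
  have hsum (P : Finset (Fin n) → Prop) [DecidablePred P] :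
      ∑ e ∈ H.filter P, w' e = n / k * ∑ e : H, w e * (if P e.1 then 1 else 0) := by
    rw [Finset.sum_filter, ← Finset.sum_coe_sort H, Finset.mul_sum]
    refine Finset.sum_congr rfl fun e _ => ?_
    split_ifs <;> simp [w']
  refine ⟨w', ⟨fun e => ?_, fun e he => dif_neg he, fun v => ?_⟩, fun u v huv => ?_⟩
  · by_cases he : e ∈ H
    · simpa [w', he] using mul_nonneg (by positivity) (hw0 ⟨e, he⟩)
    · simp [w', he]
  · rw [hsum, hw1 v]
    field_simp
  · rw [hsum]
    have h1 := hw2 (u, v)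
    simp only [ne_eq, huv, not_false_eq_true, true_and] at h1
    calc _ ≤ (n : ℝ) / k * (k / n * c) := by gcongr
      _ = c := by field_simp

theorem stmt13 (k : ℕ) (hk : 0 < k) (γ : ℝ) (hγ : 0 < γ) :
    ∃ δ₀ : ℝ, 0 < δ₀ ∧ ∀ α ε : ℝ, 0 < α → α ≤ δ₀ → 0 < ε → ε ≤ δ₀ →
      ∃ n₀ : ℕ, ∀ n ≥ n₀, k ∣ n →
        ∀ H : Finset (Finset (Fin n)), (∀ e ∈ H, e.card = k) →
          ((k : ℝ) - 1) / k * n - α * n ≤ (minPosCodeg k H : ℝ) →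
          (∀ v : Fin n, ∃ e ∈ H, v ∈ e) →
          IsExtremal k γ H ∨
            ∃ w : Finset (Fin n) → ℝ, IsPerfFracMatching H w ∧
              ∀ u v : Fin n, u ≠ v →
                (∑ e ∈ H.filter fun e => u ∈ e ∧ v ∈ e, w e) ≤ 1 / (ε * n) := by
  obtain rfl | hk2 : k = 1 ∨ 2 ≤ k := by omega
  · refine ⟨1, one_pos, fun α ε _ _ _ _ => ⟨0, fun n _ _ H hH _ _ => Or.inl ⟨univ, ?_, ?_⟩⟩⟩
    · simp
    · rw [Finset.filter_false_of_mem fun e he => by simp [hH e he]]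
      simp only [Finset.card_empty, Nat.cast_zero]
      positivity
  have hk0 : (0 : ℝ) < k := by exact_mod_cast hk
  have hk1 : (1 : ℝ) ≤ k := by exact_mod_cast hk
  obtain ⟨η, hη0, hη1, hη2⟩ : ∃ η : ℝ, 0 < η ∧ η ≤ γ / 2 ∧ η ≤ 1 / (2 * k) :=
    ⟨min (γ / 2) (1 / (2 * k)), by positivity, min_le_left _ _, min_le_right _ _⟩
  refine ⟨η / (4 * k ^ 2), by positivity, fun α ε hα hαδ hε hεδ => ⟨1, ?_⟩⟩
  rintro n hn ⟨q, hq⟩ H hH hdeg hiso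
  have hq0 : 0 < q := Nat.pos_of_ne_zero (by rintro rfl; omega)
  have hnR : (n : ℝ) = k * q := by exact_mod_cast hq
  have hn0 : (0 : ℝ) < n := by exact_mod_cast hn
  rw [or_iff_not_imp_left]
  intro hext
  have hθη : k * (η / (2 * k)) = η / 2 := by field_simp
  have hθle : η / (2 * k) ≤ η / 2 := by gcongr; linarith
  refine exists_isPerfFracMatching_of_dual hk hn (fun y z hz hzz => ?_) (by positivity)
  refine exists_dual_edge (α := α) (θ := η / (2 * k)) (γ := η) hk2 hq0 hq hH hα.le (by positivity)
    hε ?_ (fun T hT hpos => hdeg.trans ?_) hiso ?_ ?_ (fun S hS => ?_) y hz hzz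
  · calc 2 * k * ε ≤ 2 * k * (η / (4 * k ^ 2)) := by gcongr
      _ = η / (2 * k) := by field_simp; norm_num
  · have h : minPosCodeg k H ≤ deg H T := Nat.sInf_le ⟨T, hT, hpos, rfl⟩
    exact_mod_cast h
  · have : η / (4 * k ^ 2) ≤ η / 2 := by gcongr; nlinarith
    linarith
  · calc η * n ≤ 1 / (2 * k) * n := by gcongr
      _ = q / 2 := by rw [hnR]; field_simp
  · have h1 : γ * (n : ℝ) ^ k < (H.filter fun e => 2 ≤ (e ∩ S).card).card := by
      by_contra! hle
      refine hext ⟨S, ?_, by simpa using hle⟩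
      rw [hS, Fintype.card_fin, hq, Nat.mul_div_cancel_left _ hk]
    refine lt_of_le_of_lt ?_ h1
    calc (η * n + η / (2 * k) * n) * (n : ℝ) ^ (k - 1)
        = (η + η / (2 * k)) * (n * (n : ℝ) ^ (k - 1)) := by ring
      _ = (η + η / (2 * k)) * (n : ℝ) ^ k := by rw [mul_pow_sub_one hk.ne']
      _ ≤ γ * (n : ℝ) ^ k := by gcongr; linarith
end
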